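/- arXiv:1102.1681 — 5 statements merged into one kernel-verified Lean document; each statement's English description precedes it below -/
import Mathlib

section
/- (Toruńczyk) Let Z and F be fibered Z-sets in ℝ^ω × ℝ^ω with respect to the projection π₁ : ℝ^ω × ℝ^ω → ℝ^ω onto the first factor. Then every homeomorphism h : Z → F satisfying π₁ ∘ h = π₁|Z extends to a homeomorphism H : ℝ^ω × ℝ^ω → ℝ^ω × ℝ^ω such that π₁ ∘ H = π₁. -/
open Set Topology

/-- A subset `U` of a topological space is functionally open (a cozero set). -/
def FunctionallyOpen {X : Type*} [TopologicalSpace X] (U : Set X) : Prop :=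
  ∃ φ : X → ℝ, Continuous φ ∧ U = φ ⁻¹' {(0 : ℝ)}ᶜ

/-- A countable cover by functionally open sets. -/
def IsCFOCover {X : Type*} [TopologicalSpace X] (𝒰 : Set (Set X)) : Prop :=
  𝒰.Countable ∧ (∀ U ∈ 𝒰, FunctionallyOpen U) ∧ ⋃₀ 𝒰 = Set.univ

/-- Two maps are `𝒰`-close if every point's images lie in a common member of `𝒰`. -/
def UClose {X Y : Type*} (𝒰 : Set (Set Y)) (f g : X → Y) : Prop :=
  ∀ x, ∃ U ∈ 𝒰, f x ∈ U ∧ g x ∈ U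

/-- `Z` is a fibered `Z`-set in `X` with respect to `p`. -/
def FiberedZSet {X Y : Type*} [TopologicalSpace X] [TopologicalSpace Y]
    (p : X → Y) (Z : Set X) : Prop :=
  IsClosed Z ∧ ∀ 𝒰 : Set (Set X), IsCFOCover 𝒰 →
    ∃ f : X → X, Continuous f ∧ closure (Set.range f) ∩ Z = ∅ ∧
      (∀ x, p (f x) = p x) ∧ UClose 𝒰 f id

section Metric

open scoped PiCountable

lemma seq_dist_add_right (x y z : ℕ → ℝ) : dist (x + z) (y + z) = dist x y := by
  simp [PiCountable.dist_eq_tsum]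

lemma seq_dist_add_smul_le (u y δ : ℕ → ℝ) {s : ℝ} (hs : |s| ≤ 1) :
    dist (u + s • δ) u ≤ dist (y + δ) y := by
  rw [PiCountable.dist_eq_tsum, PiCountable.dist_eq_tsum]
  refine (PiCountable.dist_summable _ _).tsum_le_tsum (fun i ↦ ?_) (PiCountable.dist_summable _ _)
  refine min_le_min_left _ ?_
  simp only [Real.dist_eq, Pi.add_apply, Pi.smul_apply, smul_eq_mul, add_sub_cancel_left, abs_mul]
  exact mul_le_of_le_one_left (abs_nonneg _) hs

lemma seq_dist_le_of_eqOn {x y : ℕ → ℝ} {n : ℕ} (h : ∀ i < n, x i = y i) :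
    dist x y ≤ 2 * 2⁻¹ ^ n := by
  have hg : HasSum (fun i ↦ (2⁻¹ : ℝ) ^ n * 2⁻¹ ^ i) (2⁻¹ ^ n * 2) := by
    simpa [one_div] using hasSum_geometric_two.mul_left ((2⁻¹ : ℝ) ^ n)
  rw [PiCountable.dist_eq_tsum, ← (PiCountable.dist_summable x y).sum_add_tsum_nat_add n,
    Finset.sum_eq_zero, zero_add, mul_comm, ← hg.tsum_eq]
  · refine ((summable_nat_add_iff n).2 (PiCountable.dist_summable x y)).tsum_le_tsum
      (fun i ↦ ?_) hg.summable
    rw [← pow_add, add_comm n i]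
    exact min_le_left _ _
  · intro i hi
    simp [h i (Finset.mem_range.1 hi)]

lemma abs_zero_coord_sub_lt_one {x y : ℕ → ℝ} (h : dist x y < 1) : |x 0 - y 0| < 1 := by
  have h' := PiCountable.min_dist_le_dist_pi x y 0
  rw [← Real.dist_eq]
  exact (PiCountable.dist_le_dist_pi_of_dist_lt (by simpa using h)).trans_lt h

end Metric

/-- Any open neighbourhood of the diagonal contains
all pairs that are `r x`-close for some positive `1`-Lipschitz function `r`. -/
lemma exists_lipschitz_radius {X : Type*} [PseudoMetricSpace X] {W : Set (X × X)} (hW : IsOpen W)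
    (hd : ∀ x, (x, x) ∈ W) :
    ∃ r : X → ℝ, LipschitzWith 1 r ∧ (∀ x, 0 < r x) ∧
      ∀ x y, dist x y < r x → (x, y) ∈ W := by
  set K : Set ((X × X) × ℝ) := (W ×ˢ Ioo (-1) 1)ᶜ with hK
  have hKc : IsClosed K := (hW.prod isOpen_Ioo).isClosed_compl
  have hKne (x : X) : ((x, x), (1 : ℝ)) ∈ K := by simp [hK]
  refine ⟨fun x ↦ Metric.infDist ((x, x), (0 : ℝ)) K, ?_, fun x ↦ ?_, fun x y h ↦ ?_⟩
  · refine LipschitzWith.of_dist_le_mul fun x y ↦ ?_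
    have := (Metric.lipschitz_infDist_pt K).dist_le_mul ((x, x), (0 : ℝ)) ((y, y), (0 : ℝ))
    simpa [Prod.dist_eq] using this
  · refine (hKc.notMem_iff_infDist_pos ⟨_, hKne x⟩).1 ?_
    simp [hK, hd x]
  · by_contra hn
    have : ((x, y), (0 : ℝ)) ∈ K := by simp [hK, hn]
    have h' := Metric.infDist_le_dist_of_mem (x := ((x, x), (0 : ℝ))) this
    simp only [Prod.dist_eq, dist_self, dist_nonneg, sup_of_le_right, sup_of_le_left] at h'
    exact absurd h (not_lt.2 h')

/-- Variant of `FiberedZSet` in which closeness is measured by open neighbourhoods of the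
diagonal. -/
def FineFiberedZSet {X Y : Type*} [TopologicalSpace X] (p : X → Y) (Z : Set X) : Prop :=
  IsClosed Z ∧ ∀ W : Set (X × X), IsOpen W → (∀ x, (x, x) ∈ W) →
    ∃ f : X → X, Continuous f ∧ closure (Set.range f) ∩ Z = ∅ ∧
      (∀ x, p (f x) = p x) ∧ ∀ x, (x, f x) ∈ W

lemma IsOpen.functionallyOpen {X : Type*} [PseudoMetricSpace X] {U : Set X} (hU : IsOpen U) :
    FunctionallyOpen U := by
  rcases eq_or_ne U univ with rfl | hne
  · exact ⟨fun _ ↦ 1, continuous_const, by simp⟩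
  refine ⟨fun x ↦ Metric.infDist x Uᶜ, Metric.continuous_infDist_pt _, ?_⟩
  ext x
  have h := hU.isClosed_compl.mem_iff_infDist_zero (x := x) (nonempty_compl.2 hne)
  rw [mem_preimage, mem_compl_iff, mem_singleton_iff, ← h, mem_compl_iff, not_not]

lemma FiberedZSet.fine {X Y : Type*} [PseudoMetricSpace X] [SecondCountableTopology X]
    [TopologicalSpace Y] {p : X → Y} {Z : Set X} (h : FiberedZSet p Z) :
    FineFiberedZSet p Z := by
  refine ⟨h.1, fun W hW hd ↦ ?_⟩
  have hU (x : X) : ∃ U : Set X, IsOpen U ∧ x ∈ U ∧ U ×ˢ U ⊆ W := by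
    obtain ⟨u, v, hu, hv, hxu, hxv, huv⟩ := isOpen_prod_iff.1 hW x x (hd x)
    exact ⟨u ∩ v, hu.inter hv, ⟨hxu, hxv⟩,
      (prod_mono inter_subset_left inter_subset_right).trans huv⟩
  choose U hUo hxU hUW using hU
  obtain ⟨s, hs, hsU⟩ :=
    TopologicalSpace.countable_cover_nhds fun x ↦ (hUo x).mem_nhds (hxU x)
  obtain ⟨f, hf, hfZ, hfp, hfU⟩ := h.2 (U '' s)
    ⟨hs.image _, forall_mem_image.2 fun x _ ↦ (hUo x).functionallyOpen, by rwa [sUnion_image]⟩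
  refine ⟨f, hf, hfZ, hfp, fun x ↦ ?_⟩
  obtain ⟨_, ⟨a, -, rfl⟩, h1, h2⟩ := hfU x
  exact hUW a ⟨h2, h1⟩

lemma FineFiberedZSet.image {X Y : Type*} [TopologicalSpace X] {p : X → Y} {Z : Set X}
    (h : FineFiberedZSet p Z) (G : X ≃ₜ X) (hG : ∀ x, p (G x) = p x) :
    FineFiberedZSet p (G '' Z) := by
  refine ⟨G.isClosed_image.2 h.1, fun W hW hd ↦ ?_⟩
  obtain ⟨f, hf, hfZ, hfp, hfW⟩ := h.2 (Prod.map G G ⁻¹' W)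
    (hW.preimage (G.continuous.prodMap G.continuous)) fun x ↦ hd _
  refine ⟨fun x ↦ G (f (G.symm x)), by fun_prop, ?_, fun x ↦ ?_, fun x ↦ ?_⟩
  · have : range (fun x ↦ G (f (G.symm x))) = G '' range f := by
      ext x
      simp only [mem_range, mem_image, exists_exists_eq_and]
      exact ⟨fun ⟨y, hy⟩ ↦ ⟨_, hy⟩, fun ⟨y, hy⟩ ↦ ⟨G y, by simpa using hy⟩⟩
    rw [this, ← G.image_closure, ← image_inter G.injective, hfZ, image_empty]
  · rw [hG, hfp, ← hG, G.apply_symm_apply]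
  · simpa using hfW (G.symm x)

/-- Interleaving of two sequences, the second one at the even positions. -/
def interleave : (ℕ → ℝ) × (ℕ → ℝ) ≃ₜ (ℕ → ℝ) where
  toFun p k := if k % 2 = 0 then p.2 (k / 2) else p.1 (k / 2)
  invFun w := (fun j ↦ w (2 * j + 1), fun j ↦ w (2 * j))
  left_inv p := by
    ext j
    · simp [Nat.add_mod, show (2 * j + 1) / 2 = j by omega]
    · simp
  right_inv w := by
    ext k
    rcases Nat.mod_two_eq_zero_or_one k with h | h
    · simp [h, show 2 * (k / 2) = k by omega]
    · simp [h, show 2 * (k / 2) + 1 = k by omega]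
  continuous_toFun := by
    refine continuous_pi fun k ↦ ?_
    by_cases h : k % 2 = 0 <;> simp only [h, if_true, if_false] <;> fun_prop
  continuous_invFun := by fun_prop

/-- Rotation by the angle `π θ / 2` in the coordinate planes `(n + 2 j, n + 2 j + 1)`. -/
noncomputable def rotPairs (n : ℕ) (θ : ℝ) (w : ℕ → ℝ) (i : ℕ) : ℝ :=
  if i < n then w i
  else if (i - n) % 2 = 0 then
    Real.cos (Real.pi * θ / 2) * w i + Real.sin (Real.pi * θ / 2) * w (i + 1)
  else -Real.sin (Real.pi * θ / 2) * w (i - 1) + Real.cos (Real.pi * θ / 2) * w i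

lemma continuous_rotPairs (n : ℕ) :
    Continuous fun p : ℝ × (ℕ → ℝ) ↦ rotPairs n p.1 p.2 := by
  refine continuous_pi fun i ↦ ?_
  unfold rotPairs
  split_ifs <;> fun_prop

lemma rotPairs_zero (n : ℕ) (w : ℕ → ℝ) : rotPairs n 0 w = w := by
  ext i
  simp [rotPairs]

lemma rotPairs_neg_rotPairs (n : ℕ) (θ : ℝ) (w : ℕ → ℝ) :
    rotPairs n (-θ) (rotPairs n θ w) = w := by
  ext i
  have hc : Real.cos (Real.pi * -θ / 2) = Real.cos (Real.pi * θ / 2) := by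
    rw [← Real.cos_neg]; ring_nf
  have hs : Real.sin (Real.pi * -θ / 2) = -Real.sin (Real.pi * θ / 2) := by
    rw [← Real.sin_neg]; ring_nf
  have h1 := Real.sin_sq_add_cos_sq (Real.pi * θ / 2)
  unfold rotPairs
  rw [hc, hs]
  by_cases hi : i < n
  · simp [hi]
  by_cases hm : (i - n) % 2 = 0
  · simp only [hi, hm, show ¬ (i + 1 < n) by omega, show ¬ ((i + 1 - n) % 2 = 0) by omega,
      if_true, if_false, add_tsub_cancel_right]
    linear_combination (w i) * h1
  · simp only [hi, hm, show ¬ (i - 1 < n) by omega, show (i - 1 - n) % 2 = 0 by omega,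
      if_true, if_false, show i - 1 + 1 = i by omega]
    linear_combination (w i) * h1

/-- The angle parameter of the `n`-th rotation at time `t`. -/
noncomputable def stageAngle (t : ℝ) (n : ℕ) : ℝ := max 0 (min 1 (t - n))

lemma stageAngle_eq_zero {t : ℝ} {n : ℕ} (h : t ≤ n) : stageAngle t n = 0 :=
  max_eq_left ((min_le_right _ _).trans (sub_nonpos.2 h))

lemma stageAngle_eq_one {t : ℝ} {n : ℕ} (h : (n : ℝ) + 1 ≤ t) : stageAngle t n = 1 := by
  rw [stageAngle, min_eq_left (by linarith), max_eq_right zero_le_one]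

/-- The composition of the first `m` rotations at time `t`. -/
noncomputable def rotSeq (t : ℝ) : ℕ → (ℕ → ℝ) → (ℕ → ℝ)
  | 0, w => w
  | m + 1, w => rotPairs m (stageAngle t m) (rotSeq t m w)

/-- The inverse of `rotSeq`. -/
noncomputable def rotSeqInv (t : ℝ) : ℕ → (ℕ → ℝ) → (ℕ → ℝ)
  | 0, w => w
  | m + 1, w => rotSeqInv t m (rotPairs m (-stageAngle t m) w)

lemma continuous_rotSeq (m : ℕ) : Continuous fun p : ℝ × (ℕ → ℝ) ↦ rotSeq p.1 m p.2 := by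
  induction m with
  | zero => exact continuous_snd
  | succ m ih =>
    have : Continuous fun p : ℝ × (ℕ → ℝ) ↦ stageAngle p.1 m := by unfold stageAngle; fun_prop
    simpa only [rotSeq, Function.comp_def] using (continuous_rotPairs m).comp (this.prodMk ih)

lemma continuous_rotSeqInv (m : ℕ) : Continuous fun p : ℝ × (ℕ → ℝ) ↦ rotSeqInv p.1 m p.2 := by
  induction m with
  | zero => exact continuous_snd
  | succ m ih =>
    have : Continuous fun p : ℝ × (ℕ → ℝ) ↦ -stageAngle p.1 m := by unfold stageAngle; fun_prop
    simpa only [rotSeqInv, Function.comp_def] using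
      ih.comp (continuous_fst.prodMk ((continuous_rotPairs m).comp (this.prodMk continuous_snd)))

lemma rotSeqInv_rotSeq (t : ℝ) (m : ℕ) (w : ℕ → ℝ) : rotSeqInv t m (rotSeq t m w) = w := by
  induction m with
  | zero => rfl
  | succ m ih => rw [rotSeqInv, rotSeq, rotPairs_neg_rotPairs, ih]

lemma rotSeq_rotSeqInv (t : ℝ) (m : ℕ) (w : ℕ → ℝ) : rotSeq t m (rotSeqInv t m w) = w := by
  induction m generalizing w with
  | zero => rfl
  | succ m ih =>
    rw [rotSeqInv, rotSeq, ih]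
    simpa using rotPairs_neg_rotPairs m (-stageAngle t m) w

lemma rotSeq_eq {t : ℝ} {m : ℕ} (h : ⌈t⌉₊ ≤ m) (w : ℕ → ℝ) :
    rotSeq t m w = rotSeq t ⌈t⌉₊ w := by
  induction m, h using Nat.le_induction with
  | base => rfl
  | succ m h ih => rw [rotSeq, stageAngle_eq_zero (Nat.ceil_le.1 h), rotPairs_zero, ih]

lemma rotSeqInv_eq {t : ℝ} {m : ℕ} (h : ⌈t⌉₊ ≤ m) (w : ℕ → ℝ) :
    rotSeqInv t m w = rotSeqInv t ⌈t⌉₊ w := by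
  induction m, h using Nat.le_induction with
  | base => rfl
  | succ m h ih =>
    rw [rotSeqInv, stageAngle_eq_zero (Nat.ceil_le.1 h), neg_zero, rotPairs_zero, ih]

lemma continuous_of_eq_of_ceil_le {α β : Type*} [TopologicalSpace α] [TopologicalSpace β]
    {F : ℝ → ℕ → α → β} (hF : ∀ m, Continuous fun p : ℝ × α ↦ F p.1 m p.2)
    (h : ∀ t m w, ⌈t⌉₊ ≤ m → F t m w = F t ⌈t⌉₊ w) :
    Continuous fun p : ℝ × α ↦ F p.1 ⌈p.1⌉₊ p.2 := by
  refine continuous_iff_continuousAt.2 fun p ↦ ?_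
  obtain ⟨m, hm⟩ := exists_nat_gt p.1
  refine (hF m).continuousAt.congr ?_
  filter_upwards [continuous_fst.continuousAt.eventually_lt continuousAt_const hm] with q hq
  exact h _ _ _ (Nat.ceil_le.2 hq.le)

lemma rotSeq_interleave_coord (t : ℝ) (x y : ℕ → ℝ) (n : ℕ) (hn : (n : ℝ) ≤ t) :
    (∀ i < n, rotSeq t n (interleave (x, y)) i = x i) ∧
      ∀ j, rotSeq t n (interleave (x, y)) (n + 2 * j + 1) = x (n + j) := by
  induction n with
  | zero =>
    refine ⟨by simp, fun j ↦ ?_⟩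
    simp [rotSeq, interleave, Nat.add_mod, show (2 * j + 1) / 2 = j by omega]
  | succ n ih =>
    push_cast at hn
    obtain ⟨h1, h2⟩ := ih (by linarith)
    have key (j : ℕ) : rotSeq t (n + 1) (interleave (x, y)) (n + 2 * j) = x (n + j) := by
      rw [rotSeq, stageAngle_eq_one hn, rotPairs]
      simp [h2]
    refine ⟨fun i hi ↦ ?_, fun j ↦ ?_⟩
    · rcases (Nat.lt_succ_iff_lt_or_eq.1 hi) with hi | rfl
      · rw [rotSeq, rotPairs, if_pos hi, h1 i hi]
      · simpa using key 0
    · have := key (j + 1)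
      rwa [show n + 2 * (j + 1) = n + 1 + 2 * j + 1 by ring,
        show n + (j + 1) = n + 1 + j by ring] at this

/-- A continuous one-parameter family of homeomorphisms `ℝ^ω × ℝ^ω → ℝ^ω` that
eventually preserve any prescribed coordinate of the first factor. -/
lemma exists_insertion : ∃ e : ℝ → ((ℕ → ℝ) × (ℕ → ℝ) ≃ (ℕ → ℝ)),
    (Continuous fun p : ℝ × ((ℕ → ℝ) × (ℕ → ℝ)) ↦ e p.1 p.2) ∧
    (Continuous fun p : ℝ × (ℕ → ℝ) ↦ (e p.1).symm p.2) ∧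
    ∀ (t : ℝ) (x y : ℕ → ℝ) (i : ℕ), (i : ℝ) + 1 ≤ t → e t (x, y) i = x i := by
  let r (t : ℝ) : (ℕ → ℝ) ≃ (ℕ → ℝ) :=
    ⟨rotSeq t ⌈t⌉₊, rotSeqInv t ⌈t⌉₊, rotSeqInv_rotSeq t _, rotSeq_rotSeqInv t _⟩
  refine ⟨fun t ↦ interleave.toEquiv.trans (r t), ?_, ?_, fun t x y i hi ↦ ?_⟩
  · exact (continuous_of_eq_of_ceil_le continuous_rotSeq fun t m w h ↦ rotSeq_eq h w).comp
      (continuous_fst.prodMk (interleave.continuous.comp continuous_snd))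
  · exact interleave.symm.continuous.comp
      (continuous_of_eq_of_ceil_le continuous_rotSeqInv fun t m w h ↦ rotSeqInv_eq h w)
  · have h1 : i + 1 ≤ ⌈t⌉₊ := by
      have : ((i + 1 : ℕ) : ℝ) ≤ ⌈t⌉₊ := by push_cast; exact hi.trans (Nat.le_ceil t)
      exact_mod_cast this
    change rotSeq t ⌈t⌉₊ (interleave (x, y)) i = x i
    generalize ⌈t⌉₊ = m at h1
    induction m, h1 using Nat.le_induction with
    | base => exact (rotSeq_interleave_coord t x y (i + 1) (by exact_mod_cast hi)).1 i (by omega)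
    | succ m h ih => rw [rotSeq, rotPairs, if_pos (by omega), ih]

section Cutoff

open scoped PiCountable

variable {B : Type*} [PseudoMetricSpace B]

lemma dist_mk_le_of_eqOn (b : B) {x y : ℕ → ℝ} {n : ℕ} (h : ∀ i < n, x i = y i) :
    dist (b, x) (b, y) ≤ 2 * 2⁻¹ ^ n := by
  rw [Prod.dist_eq, dist_self]
  exact max_le (by positivity) (seq_dist_le_of_eqOn h)

/-- Set all coordinates from the `n`-th on to zero. -/
def truncate (n : ℕ) (x : ℕ → ℝ) (i : ℕ) : ℝ := if i < n then x i else 0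

lemma truncate_eq {n : ℕ} (x : ℕ → ℝ) {i : ℕ} (h : i < n) : truncate n x i = x i := if_pos h

lemma continuous_truncate (n : ℕ) : Continuous (truncate n) := by
  refine continuous_pi fun i ↦ ?_
  unfold truncate
  split_ifs <;> fun_prop

/-- The `n`-th summand of the cutoff function associated with a radius function `r`. -/
noncomputable def cutoffTerm (r : B × (ℕ → ℝ) → ℝ) (n : ℕ) (a : B × (ℕ → ℝ)) : ℝ :=
  max 0 (min 1 (6 - 2 ^ n * r (a.1, truncate n a.2)))

omit [PseudoMetricSpace B] in
lemma cutoffTerm_congr (r : B × (ℕ → ℝ) → ℝ) {n : ℕ} (b : B) {x y : ℕ → ℝ}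
    (h : ∀ i < n, x i = y i) : cutoffTerm r n (b, x) = cutoffTerm r n (b, y) := by
  have : truncate n x = truncate n y := by
    ext i
    unfold truncate
    split_ifs with hi
    exacts [h i hi, rfl]
  simp [cutoffTerm, this]

variable {r : B × (ℕ → ℝ) → ℝ} (hr : LipschitzWith 1 r)
include hr

lemma radius_le_of_eqOn (b : B) {x y : ℕ → ℝ} {n : ℕ} (h : ∀ i < n, x i = y i) :
    2 ^ n * r (b, x) ≤ 2 ^ n * r (b, y) + 2 := by
  have h1 := hr.dist_le_mul (b, x) (b, y)
  have h2 := (le_abs_self _).trans ((h1.trans (by simp)).trans (dist_mk_le_of_eqOn b h))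
  have h3 : (2 : ℝ) ^ n * 2⁻¹ ^ n = 1 := by rw [← mul_pow]; simp
  have h4 : (0 : ℝ) < 2 ^ n := by positivity
  nlinarith [mul_le_mul_of_nonneg_left h2 h4.le]

lemma cutoffTerm_succ_eq_zero {n : ℕ} {a : B × (ℕ → ℝ)} (h : cutoffTerm r n a < 1) :
    cutoffTerm r (n + 1) a = 0 := by
  obtain ⟨b, x⟩ := a
  have h1 := radius_le_of_eqOn hr b (n := n) (x := truncate n x) (y := truncate (n + 1) x)
    fun i hi ↦ by rw [truncate_eq x hi, truncate_eq x (by omega)]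
  have h2 : 5 < 2 ^ n * r (b, truncate n x) := by
    by_contra! h'
    refine h.ne ?_
    rw [cutoffTerm, min_eq_left (by linarith), max_eq_right zero_le_one]
  refine max_eq_left ((min_le_right _ _).trans ?_)
  rw [pow_succ']
  linarith

lemma cutoffTerm_eq_zero_of_lt {m n : ℕ} {a : B × (ℕ → ℝ)} (h : cutoffTerm r n a < 1)
    (hm : n < m) : cutoffTerm r m a = 0 := by
  replace hm : n + 1 ≤ m := hm
  induction m, hm using Nat.le_induction with
  | base => exact cutoffTerm_succ_eq_zero hr h
  | succ m hm ih => exact cutoffTerm_succ_eq_zero hr (ih.trans_lt one_pos)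

lemma exists_cutoffTerm_lt_one (h0 : ∀ a, 0 < r a) (a : B × (ℕ → ℝ)) :
    ∃ n, cutoffTerm r n a < 1 := by
  obtain ⟨n, hn⟩ := pow_unbounded_of_one_lt (7 / r a) one_lt_two
  refine ⟨n, max_lt one_pos ((min_le_right _ _).trans_lt ?_)⟩
  have h1 := radius_le_of_eqOn hr a.1 (n := n) (x := a.2) (y := truncate n a.2)
    fun i hi ↦ (truncate_eq _ hi).symm
  have h2 := (div_lt_iff₀ (h0 a)).1 hn
  change 7 < 2 ^ n * r (a.1, a.2) at h2
  linarith

lemma tsum_cutoffTerm_eq {n : ℕ} {a : B × (ℕ → ℝ)} (h : cutoffTerm r n a < 1) :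
    ∑' k, cutoffTerm r k a = ∑ k ∈ Finset.range (n + 1), cutoffTerm r k a :=
  tsum_eq_sum fun m hm ↦ cutoffTerm_eq_zero_of_lt hr h (by simpa using hm)

lemma continuous_cutoffTerm (n : ℕ) : Continuous (cutoffTerm r n) := by
  have := hr.continuous
  have := continuous_truncate n
  unfold cutoffTerm
  fun_prop

lemma continuous_tsum_cutoffTerm (h0 : ∀ a, 0 < r a) :
    Continuous fun a ↦ ∑' k, cutoffTerm r k a := by
  refine continuous_iff_continuousAt.2 fun a ↦ ?_
  obtain ⟨n, hn⟩ := exists_cutoffTerm_lt_one hr h0 a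
  have hc : Continuous fun a ↦ ∑ k ∈ Finset.range (n + 1), cutoffTerm r k a :=
    continuous_finsetSum _ fun k _ ↦ continuous_cutoffTerm hr k
  refine hc.continuousAt.congr ?_
  filter_upwards [(continuous_cutoffTerm hr n).continuousAt.eventually_lt continuousAt_const hn]
    with b hb
  exact (tsum_cutoffTerm_eq hr hb).symm

omit hr in
/-- There is a continuous function `τ` such that changing only the coordinates of `x` beyond
`τ (b, x)` neither affects `τ` nor leaves a prescribed neighbourhood of the diagonal. -/
lemma exists_cutoff {W : Set ((B × (ℕ → ℝ)) × (B × (ℕ → ℝ)))} (hW : IsOpen W)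
    (hd : ∀ a, (a, a) ∈ W) :
    ∃ τ : B × (ℕ → ℝ) → ℝ, Continuous τ ∧ ∀ b x y,
      (∀ i : ℕ, (i : ℝ) + 1 ≤ τ (b, x) → x i = y i) →
        τ (b, y) = τ (b, x) ∧ ((b, x), (b, y)) ∈ W := by
  obtain ⟨r, hr, h0, hrW⟩ := exists_lipschitz_radius hW hd
  refine ⟨fun a ↦ ∑' k, cutoffTerm r k a, continuous_tsum_cutoffTerm hr h0, fun b x y h ↦ ?_⟩
  classical
  have hex := exists_cutoffTerm_lt_one hr h0 (b, x)
  obtain ⟨n, hn, hmin⟩ : ∃ n, cutoffTerm r n (b, x) < 1 ∧ ∀ m < n, cutoffTerm r m (b, x) = 1 :=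
    ⟨Nat.find hex, Nat.find_spec hex, fun m hm ↦ le_antisymm
      (max_le zero_le_one (min_le_left _ _)) (not_lt.1 (Nat.find_min hex hm))⟩
  have hτ : ∑' k, cutoffTerm r k (b, x) = n + cutoffTerm r n (b, x) := by
    rw [tsum_cutoffTerm_eq hr hn, Finset.sum_range_succ,
      Finset.sum_congr rfl fun k hk ↦ hmin k (Finset.mem_range.1 hk)]
    simp
  have hxy : ∀ i < n, x i = y i := by
    refine fun i hi ↦ h i ?_
    have h1 : ((i + 1 : ℕ) : ℝ) ≤ n := by exact_mod_cast hi
    push_cast at h1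
    have h2 : 0 ≤ cutoffTerm r n (b, x) := le_max_left _ _
    linarith
  have hcongr (k : ℕ) (hk : k ≤ n) : cutoffTerm r k (b, y) = cutoffTerm r k (b, x) :=
    cutoffTerm_congr r b fun i hi ↦ (hxy i (hi.trans_le hk)).symm
  refine ⟨?_, hrW _ _ ((dist_mk_le_of_eqOn b hxy).trans_lt ?_)⟩
  · beta_reduce
    rw [tsum_cutoffTerm_eq hr hn, tsum_cutoffTerm_eq hr ((hcongr n le_rfl).trans_lt hn)]
    exact Finset.sum_congr rfl fun k hk ↦ hcongr k (Nat.lt_succ_iff.1 (Finset.mem_range.1 hk))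
  · have h1 := radius_le_of_eqOn hr b (n := n) (x := truncate n x) (y := x)
      fun i hi ↦ truncate_eq _ hi
    have h2 : 5 < 2 ^ n * r (b, truncate n x) := by
      by_contra! h'
      refine hn.ne ?_
      rw [cutoffTerm, min_eq_left (by linarith), max_eq_right zero_le_one]
    have h3 : (2 : ℝ) ^ n * 2⁻¹ ^ n = 1 := by rw [← mul_pow]; simp
    have h4 : (0 : ℝ) < 2 ^ n := by positivity
    refine lt_of_mul_lt_mul_left ?_ h4.le
    linarith

omit hr in
/-- The projection `X × ℝ^ω → X`, `X = B × ℝ^ω`, can be approximated by homeomorphisms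
over `B`. -/
lemma exists_homeomorph_near_fst {W : Set ((B × (ℕ → ℝ)) × (B × (ℕ → ℝ)))} (hW : IsOpen W)
    (hd : ∀ a, (a, a) ∈ W) :
    ∃ g : (B × (ℕ → ℝ)) × (ℕ → ℝ) ≃ₜ B × (ℕ → ℝ),
      ∀ p, (g p).1 = p.1.1 ∧ (p.1, g p) ∈ W := by
  obtain ⟨τ, hτ, hτW⟩ := exists_cutoff hW hd
  obtain ⟨e, he, he', hex⟩ := exists_insertion
  have key (b : B) (x y : ℕ → ℝ) := hτW b x (e (τ (b, x)) (x, y)) fun i hi ↦ (hex _ x y i hi).symm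
  refine ⟨⟨⟨fun p ↦ (p.1.1, e (τ p.1) (p.1.2, p.2)),
    fun w ↦ ((w.1, ((e (τ w)).symm w.2).1), ((e (τ w)).symm w.2).2), ?_, ?_⟩, ?_, ?_⟩, ?_⟩
  · rintro ⟨⟨b, x⟩, y⟩
    simp [(key b x y).1]
  · rintro ⟨b, w⟩
    have h := key b ((e (τ (b, w))).symm w).1 ((e (τ (b, w))).symm w).2
    have h2 := hτW b w ((e (τ (b, w))).symm w).1 fun i hi ↦ by
      conv_lhs => rw [← (e (τ (b, w))).apply_symm_apply w]
      exact hex _ _ _ i hi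
    simp [h2.1]
  · exact continuous_fst.fst.prodMk (he.comp ((hτ.comp continuous_fst).prodMk
      (continuous_fst.snd.prodMk continuous_snd)))
  · have := he'.comp (hτ.prodMk (continuous_snd (X := B)))
    exact (continuous_fst.prodMk this.fst).prodMk this.snd
  · exact fun p ↦ ⟨rfl, (key p.1.1 p.1.2 p.2).2⟩

end Cutoff

/-- Projection of the real line to the unit interval. -/
noncomputable def clampUnit (t : ℝ) : ℝ := max 0 (min 1 t)

lemma continuous_clampUnit : Continuous clampUnit := by unfold clampUnit; fun_prop

lemma abs_clampUnit_le (t : ℝ) : |clampUnit t| ≤ 1 := by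
  rw [abs_of_nonneg (le_max_left _ _)]
  exact max_le zero_le_one (min_le_left _ _)

/-- The homeomorphism of `(B × E) × (ℝ × E)` that, with `z = y + x`, moves `x` in the direction
`δ (b, z)`, the motion being governed by the time coordinate, which is increased by `c`. -/
noncomputable def slide {B E : Type*} [TopologicalSpace B] [AddCommGroup E] [TopologicalSpace E]
    [IsTopologicalAddGroup E] [Module ℝ E] [ContinuousSMul ℝ E]
    (δ : B × E → E) (c : (B × E) × E → ℝ) (hδ : Continuous δ) (hc : Continuous c) :
    (B × E) × (ℝ × E) ≃ₜ (B × E) × (ℝ × E) where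
  toFun p :=
    let z := p.2.2 + p.1.2
    let u := p.1.2 - clampUnit p.2.1 • δ (p.1.1, z)
    let t := p.2.1 + c ((p.1.1, z), u)
    ((p.1.1, u + clampUnit t • δ (p.1.1, z)), (t, z))
  invFun p :=
    let u := p.1.2 - clampUnit p.2.1 • δ (p.1.1, p.2.2)
    let t := p.2.1 - c ((p.1.1, p.2.2), u)
    let x := u + clampUnit t • δ (p.1.1, p.2.2)
    ((p.1.1, x), (t, p.2.2 - x))
  left_inv p := by simp
  right_inv p := by simp
  continuous_toFun := by
    have := continuous_clampUnit
    fun_prop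
  continuous_invFun := by
    have := continuous_clampUnit
    fun_prop

section Slide

open scoped PiCountable

variable {B : Type*} [PseudoMetricSpace B]

/-- A fine fibered `Z`-set can be avoided by a homeomorphism of `X × ℝ × ℝ^ω` that is close to
the identity in the direction of `X`: it pushes the zero section off the set. -/
lemma FineFiberedZSet.exists_slide {Z : Set (B × (ℕ → ℝ))}
    (hZ : FineFiberedZSet Prod.fst Z)
    {W : Set ((B × (ℕ → ℝ)) × (B × (ℕ → ℝ)))} (hW : IsOpen W) (hd : ∀ a, (a, a) ∈ W) :
    ∃ C : Set (B × (ℕ → ℝ)), IsClosed C ∧ C ∩ Z = ∅ ∧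
      ∃ Θ : (B × (ℕ → ℝ)) × (ℝ × (ℕ → ℝ)) ≃ₜ (B × (ℕ → ℝ)) × (ℝ × (ℕ → ℝ)),
        (∀ p, (Θ p).1.1 = p.1.1 ∧ (p.1, (Θ p).1) ∈ W) ∧ ∀ x, (Θ (x, 0)).1 ∈ C := by
  obtain ⟨r, hr, h0, hrW⟩ := exists_lipschitz_radius hW hd
  have hrc := hr.continuous
  obtain ⟨f, hf, hfZ, hfp, hfr⟩ := hZ.2 {p | dist p.1 p.2 < r p.1 / 5}
    (isOpen_lt (by fun_prop) (by fun_prop)) fun a ↦ by simpa using h0 a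
  refine ⟨closure (range f), isClosed_closure, hfZ, ?_⟩
  have hδ : Continuous fun a ↦ (f a).2 - a.2 := by fun_prop
  have hc : Continuous fun q : (B × (ℕ → ℝ)) × (ℕ → ℝ) ↦
      max 0 (1 - dist (q.1.1, q.2) q.1 / (r q.1 / 5)) := by
    have (q : (B × (ℕ → ℝ)) × (ℕ → ℝ)) : r q.1 / 5 ≠ 0 := (div_pos (h0 _) (by norm_num)).ne'
    fun_prop (disch := assumption)
  refine ⟨slide _ _ hδ hc, fun p ↦ ⟨rfl, ?_⟩, fun x ↦ subset_closure ⟨x, ?_⟩⟩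
  · obtain ⟨⟨b, x⟩, ⟨t, y⟩⟩ := p
    set a : B × (ℕ → ℝ) := (b, y + x)
    set δ : ℕ → ℝ := (f a).2 - a.2 with hδ'
    set u : ℕ → ℝ := x - clampUnit t • δ with hu
    set c : ℝ := max 0 (1 - dist (b, u) a / (r a / 5))
    have hmove (s : ℝ) : dist (b, u + clampUnit s • δ) (b, u) < r a / 5 := by
      rw [Prod.dist_eq, dist_self]
      refine (max_le dist_nonneg (seq_dist_add_smul_le u a.2 δ (abs_clampUnit_le s))).trans_lt ?_
      refine lt_of_le_of_lt ?_ (hfr a)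
      rw [hδ', add_sub_cancel, dist_comm a]
      exact le_max_right _ _
    have hx : x = u + clampUnit t • δ := by simp [hu]
    change ((b, x), (b, u + clampUnit (t + c) • δ)) ∈ W
    rcases eq_or_ne c 0 with h | h
    · rw [h, add_zero, ← hx]
      exact hd _
    · have hpos : 0 < r a / 5 := div_pos (h0 _) (by norm_num)
      have hua : dist (b, u) a < r a / 5 := by
        by_contra! hn
        refine h (max_eq_left (sub_nonpos.2 ?_))
        rwa [one_le_div hpos]
      refine hrW _ _ ?_
      rw [hx]
      have h1 := hmove t
      have h2 := hmove (t + c)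
      have h3 := dist_triangle_right (b, u + clampUnit t • δ) (b, u + clampUnit (t + c) • δ) (b, u)
      have h4 := dist_triangle (b, u + clampUnit t • δ) (b, u) a
      have h5 := hr.dist_le_mul a (b, u + clampUnit t • δ)
      rw [Real.dist_eq, NNReal.coe_one, one_mul, dist_comm a] at h5
      have h6 := (le_abs_self _).trans h5
      linarith
  · have : clampUnit 1 = 1 := by simp [clampUnit]
    have h' : clampUnit 0 = 0 := by simp [clampUnit]
    ext1
    · exact hfp x
    · simp [slide, this, h']

end Slide

/-- Prepending a term to a sequence. -/
def consSeq : ℝ × (ℕ → ℝ) ≃ₜ (ℕ → ℝ) where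
  toFun p n := Nat.casesOn n p.1 p.2
  invFun y := (y 0, fun n ↦ y (n + 1))
  left_inv p := rfl
  right_inv y := by
    ext n
    cases n <;> rfl
  continuous_toFun := by
    refine continuous_pi fun n ↦ ?_
    cases n
    · exact continuous_fst
    · exact (continuous_apply _).comp continuous_snd
  continuous_invFun := by fun_prop

/-- A closed set missing the zero section contains `(x, v / (1 + |t|))` only for `t` bounded by a
continuous function of `(x, v)`. -/
lemma exists_continuous_bound {X V : Type*} [TopologicalSpace X] [AddCommGroup V] [Module ℝ V]
    [TopologicalSpace V] [ContinuousSMul ℝ V] [NormalSpace (X × V)] [ParacompactSpace (X × V)]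
    {C : Set (X × V)} (hC : IsClosed C) (h0 : ∀ x, (x, 0) ∉ C) :
    ∃ M : X × V → ℝ, Continuous M ∧ (∀ p, 0 ≤ M p) ∧
      ∀ p (t : ℝ), (p.1, (1 + |t|)⁻¹ • p.2) ∈ C → |t| ≤ M p := by
  have hconv (p : X × V) :
      Convex ℝ {m : ℝ | 0 ≤ m ∧ ∀ t : ℝ, (p.1, (1 + |t|)⁻¹ • p.2) ∈ C → |t| ≤ m} := by
    refine Set.OrdConnected.convex ⟨fun a ha b hb c hc ↦ ?_⟩
    exact ⟨ha.1.trans hc.1, fun t ht ↦ (ha.2 t ht).trans hc.1⟩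
  obtain ⟨M, hM⟩ := exists_continuous_forall_mem_convex_of_local_const hconv fun p ↦ by
    have hcont : Continuous fun q : ℝ × (X × V) ↦ (q.2.1, q.1 • q.2.2) := by fun_prop
    have hmem : ∀ᶠ q : ℝ × (X × V) in 𝓝 0 ×ˢ 𝓝 p, (q.2.1, q.1 • q.2.2) ∉ C := by
      rw [← nhds_prod_eq]
      refine hcont.continuousAt.eventually (hC.isOpen_compl.mem_nhds ?_)
      simpa using h0 p.1
    obtain ⟨u, hu, v, hv, huv⟩ := Filter.eventually_prod_iff.1 hmem
    obtain ⟨ε, hε, hεu⟩ := Metric.eventually_nhds_iff.1 hu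
    refine ⟨ε⁻¹, hv.mono fun p' hp' ↦ ⟨by positivity, fun t ht ↦ ?_⟩⟩
    by_contra! hlt
    have hpos : 0 < 1 + |t| := by positivity
    refine huv (x := (1 + |t|)⁻¹) (hεu ?_) hp' ht
    rw [Real.dist_0_eq_abs, abs_of_pos (by positivity)]
    exact inv_lt_of_inv_lt₀ hε (hlt.trans (lt_one_add _))
  exact ⟨M, M.continuous, fun p ↦ (hM p).1, fun p ↦ (hM p).2⟩

/-- A fibrewise rescaling of `ℝ × V` that compresses the line according to `M`. -/
noncomputable def rescale {X V : Type*} [TopologicalSpace X] [AddCommGroup V] [Module ℝ V]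
    [TopologicalSpace V] [ContinuousSMul ℝ V] (M : X × V → ℝ) (hM : Continuous M)
    (h0 : ∀ p, 0 ≤ M p) : X × (ℝ × V) ≃ₜ X × (ℝ × V) where
  toFun p :=
    let t := p.2.1 * (1 + M (p.1, p.2.2))
    (p.1, (t, (1 + |t|)⁻¹ • p.2.2))
  invFun p :=
    let v := (1 + |p.2.1|) • p.2.2
    (p.1, (p.2.1 / (1 + M (p.1, v)), v))
  left_inv p := by
    have h1 : 1 + M (p.1, p.2.2) ≠ 0 := by linarith [h0 (p.1, p.2.2)]
    have h2 : 1 + |p.2.1 * (1 + M (p.1, p.2.2))| ≠ 0 := by positivity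
    simp only [smul_smul, mul_inv_cancel₀ h2, one_smul, mul_div_cancel_right₀ _ h1]
  right_inv p := by
    have h1 : 1 + M (p.1, (1 + |p.2.1|) • p.2.2) ≠ 0 := by
      linarith [h0 (p.1, (1 + |p.2.1|) • p.2.2)]
    have h2 : 1 + |p.2.1| ≠ 0 := by positivity
    simp only [div_mul_cancel₀ _ h1, smul_smul, inv_mul_cancel₀ h2, one_smul]
  continuous_toFun := by
    have (p : X × (ℝ × V)) : 1 + |p.2.1 * (1 + M (p.1, p.2.2))| ≠ 0 := by positivity
    dsimp only
    fun_prop (disch := assumption)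
  continuous_invFun := by
    have (p : X × (ℝ × V)) : 1 + M (p.1, (1 + |p.2.1|) • p.2.2) ≠ 0 := by
      linarith [h0 (p.1, (1 + |p.2.1|) • p.2.2)]
    dsimp only
    fun_prop (disch := assumption)

section Confine

open scoped PiCountable

variable {B : Type*} [PseudoMetricSpace B]

/-- The projection `X × ℝ^ω → X` can be approximated by homeomorphisms over `B` for which the
preimage of a given fine fibered `Z`-set is bounded in the direction of the first coordinate. -/
lemma FineFiberedZSet.exists_homeomorph {Z : Set (B × (ℕ → ℝ))}
    (hZ : FineFiberedZSet Prod.fst Z)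
    {W : Set ((B × (ℕ → ℝ)) × (B × (ℕ → ℝ)))} (hW : IsOpen W) (hd : ∀ a, (a, a) ∈ W) :
    ∃ q : (B × (ℕ → ℝ)) × (ℕ → ℝ) ≃ₜ B × (ℕ → ℝ),
      ∀ p, (q p).1 = p.1.1 ∧ (p.1, q p) ∈ W ∧ (q p ∈ Z → |p.2 0| ≤ 1) := by
  obtain ⟨r, hr, h0, hrW⟩ := exists_lipschitz_radius hW hd
  have hrc := hr.continuous
  have hV : IsOpen {p : (B × (ℕ → ℝ)) × (B × (ℕ → ℝ)) | dist p.1 p.2 < r p.1 / 3} :=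
    isOpen_lt (by fun_prop) (by fun_prop)
  have hVd (a : B × (ℕ → ℝ)) : dist a a < r a / 3 := by simpa using h0 a
  obtain ⟨C, hC, hCZ, Θ, hΘ, hΘ0⟩ := hZ.exists_slide hV hVd
  obtain ⟨χ, hχC, hχZ, -⟩ := exists_continuous_zero_one_of_isClosed hC hZ.1
    (disjoint_iff_inter_eq_empty.2 hCZ)
  obtain ⟨g, hg⟩ := exists_homeomorph_near_fst
    (hV.inter (isOpen_lt (f := fun p : (B × (ℕ → ℝ)) × (B × (ℕ → ℝ)) ↦ |χ p.1 - χ p.2|)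
      (g := fun _ ↦ (1 / 2 : ℝ)) (by fun_prop) continuous_const)) fun a ↦ ⟨hVd a, by simp⟩
  obtain ⟨M, hMc, hM0, hM⟩ := exists_continuous_bound (C := {p | 1 / 2 ≤ χ (Θ p).1})
    (isClosed_le continuous_const (by fun_prop)) fun x ↦ by simp [hχC (hΘ0 x)]
  let e : (B × (ℕ → ℝ)) × (ℕ → ℝ) ≃ₜ (B × (ℕ → ℝ)) × (ℝ × (ℝ × (ℕ → ℝ))) :=
    (Homeomorph.refl _).prodCongr (consSeq.symm.trans
      ((Homeomorph.refl _).prodCongr consSeq.symm))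
  let j : (B × (ℕ → ℝ)) × (ℝ × (ℝ × (ℕ → ℝ))) ≃ₜ ((B × (ℕ → ℝ)) × (ℝ × (ℕ → ℝ))) × ℝ :=
    ((Homeomorph.refl _).prodCongr (Homeomorph.prodComm _ _)).trans (Homeomorph.prodAssoc _ _ _).symm
  refine ⟨(((e.trans (rescale M hMc hM0)).trans j).trans
    (Θ.prodCongr (Homeomorph.refl _))).trans (j.symm.trans (e.symm.trans g)), fun p ↦ ?_⟩
  set t := (e p).2.1 * (1 + M ((e p).1, (e p).2.2)) with ht
  set v := (1 + |t|)⁻¹ • (e p).2.2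
  set x := (Θ (p.1, v)).1
  obtain ⟨y, hy⟩ : ∃ y, ((((e.trans (rescale M hMc hM0)).trans j).trans
    (Θ.prodCongr (Homeomorph.refl _))).trans (j.symm.trans (e.symm.trans g))) p = g (x, y) :=
    ⟨_, rfl⟩
  rw [hy]
  obtain ⟨h1, h2, h3⟩ := hg (x, y)
  obtain ⟨h4, h5⟩ := hΘ (p.1, v)
  refine ⟨h1.trans h4, hrW _ _ ?_, fun hmem ↦ ?_⟩
  · have h6 := hr.dist_le_mul x p.1
    rw [Real.dist_eq, NNReal.coe_one, one_mul, dist_comm] at h6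
    have h7 := (le_abs_self _).trans h6
    have h8 := dist_triangle p.1 x (g (x, y))
    have h9 := h0 p.1
    change dist x _ < r x / 3 at h2
    change dist p.1 x < r p.1 / 3 at h5
    linarith
  · change |χ x - χ (g (x, y))| < 1 / 2 at h3
    have h6 : 1 / 2 ≤ χ x := by
      have h7 := (abs_lt.1 h3).1
      have h8 := hχZ hmem
      simp only [Pi.one_apply] at h8
      linarith
    have h7 : |t| ≤ M ((e p).1, (e p).2.2) := hM ((e p).1, (e p).2.2) t h6
    have h8 := hM0 ((e p).1, (e p).2.2)
    rw [ht, abs_mul, abs_of_nonneg (a := 1 + _) (by linarith)] at h7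
    change |(e p).2.1| ≤ 1
    by_contra! hlt
    nlinarith

end Confine

section Limit

open Filter

variable {X Y : Type*} [TopologicalSpace Y]

/-- The point at level `k` of the sequence built by iterating `c` from an initial point along
a sequence of parameters. -/
def iterLevel (c : X × Y → X) (w : X × (ℕ → Y)) : ℕ → X
  | 0 => w.1
  | k + 1 => c (iterLevel c w k, w.2 k)

lemma continuous_iterLevel [TopologicalSpace X] {c : X × Y → X} (hc : Continuous c) (k : ℕ) :
    Continuous fun w ↦ iterLevel c w k := by
  induction k with
  | zero => exact continuous_fst
  | succ k ih =>
    exact hc.comp (ih.prodMk ((continuous_apply k).comp continuous_snd))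

lemma exists_uniform_limit {α X : Type*} [TopologicalSpace α] [PseudoMetricSpace X]
    [CompleteSpace X] {u : ℕ → α → X} (hu : ∀ k, Continuous (u k))
    (h : ∀ k x, dist (u k x) (u (k + 1) x) ≤ 1 / 2 / 2 / 2 ^ k) :
    ∃ v : α → X, Continuous v ∧ (∀ k x, dist (u k x) (v x) ≤ 1 / 2 / 2 ^ k) ∧
      ∀ x, Tendsto (fun k ↦ u k x) atTop (𝓝 (v x)) := by
  choose v hv using fun x ↦ cauchySeq_tendsto_of_complete
    (cauchySeq_of_le_geometric_two fun k ↦ h k x)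
  have hd (k : ℕ) (x : α) : dist (u k x) (v x) ≤ 1 / 2 / 2 ^ k :=
    dist_le_of_le_geometric_two_of_tendsto (fun k ↦ h k x) (hv x) k
  have h0 : Tendsto (fun k : ℕ ↦ (1 / 2 : ℝ) / 2 ^ k) atTop (𝓝 0) :=
    tendsto_const_nhds.div_atTop (tendsto_pow_atTop_atTop_of_one_lt one_lt_two)
  have hunif : TendstoUniformly u v atTop := by
    refine Metric.tendstoUniformly_iff.2 fun ε hε ↦ ?_
    filter_upwards [h0.eventually_lt_const hε] with k hk x
    rw [dist_comm]
    exact (hd k x).trans_lt hk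
  exact ⟨v, hunif.continuous (Frequently.of_forall hu), hd, hv⟩

/-- If the homeomorphisms `G k` are such that `G (k + 1)` followed by the projection
`p = fst ∘ c⁻¹` is close to `G k`, and similarly for the inverses, then they induce in the limit
a homeomorphism of `X` onto `X × Y^ω`. -/
lemma exists_limit_homeomorph [PseudoMetricSpace X] [CompleteSpace X] [T2Space X]
    (c : X × Y ≃ₜ X) (G : ℕ → (X ≃ₜ X))
    (h1 : ∀ k, ∀ m ≤ k, ∀ x, dist ((fun w ↦ (c.symm w).1)^[m] (G k x))
      ((fun w ↦ (c.symm w).1)^[m] (c.symm (G (k + 1) x)).1) ≤ 1 / 2 / 2 / 2 ^ k)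
    (h2 : ∀ k w, dist ((G k).symm (c.symm w).1) ((G (k + 1)).symm w) ≤ 1 / 2 / 2 / 2 ^ k) :
    ∃ Γ : X ≃ₜ X × (ℕ → Y), ∀ x,
      Tendsto (fun k ↦ (fun w ↦ (c.symm w).1)^[k] (G k x)) atTop (𝓝 (Γ x).1) ∧
      ∀ k, ∃ x', dist (G (k + 1) x) x' < 1 ∧ (Γ x).2 k = (c.symm x').2 := by
  set p : X → X := fun w ↦ (c.symm w).1 with hp
  have hpc : Continuous p := by fun_prop
  have hcp (w : X) : c (p w, (c.symm w).2) = w := c.apply_symm_apply w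
  have hpc' (v : X × Y) : p (c v) = v.1 := by simp [hp]
  have h0 : Tendsto (fun k : ℕ ↦ (1 / 2 : ℝ) / 2 ^ k) atTop (𝓝 0) :=
    tendsto_const_nhds.div_atTop (tendsto_pow_atTop_atTop_of_one_lt one_lt_two)
  let a (i k : ℕ) (x : X) : X := p^[k] (G (i + k) x)
  have ha0 (i : ℕ) (x : X) : a i 0 x = G i x := rfl
  have hac (i k : ℕ) : Continuous (a i k) := (hpc.iterate k).comp (G (i + k)).continuous
  have hap (i k : ℕ) (x : X) : p (a (i + 1) k x) = a i (k + 1) x := by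
    simp only [a, Function.iterate_succ_apply', show i + (k + 1) = i + 1 + k by omega]
  have had (i k : ℕ) (x : X) : dist (a i k x) (a i (k + 1) x) ≤ 1 / 2 / 2 / 2 ^ k := by
    refine (h1 (i + k) k (by omega) x).trans ?_
    gcongr
    · exact one_le_two
    · omega
  choose g hgc hgd hgt using fun i ↦ exists_uniform_limit (hac i) (had i)
  have hgp (i : ℕ) (x : X) : p (g (i + 1) x) = g i x := by
    refine tendsto_nhds_unique ((hpc.tendsto _).comp (hgt (i + 1) x)) ?_
    refine ((tendsto_add_atTop_iff_nat 1).2 (hgt i x)).congr fun k ↦ ?_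
    exact (hap i k x).symm
  let pr (k : ℕ) (w : X × (ℕ → Y)) : X := iterLevel c w k
  have hprc (k : ℕ) : Continuous (pr k) := continuous_iterLevel c.continuous k
  have hprp (k : ℕ) (w : X × (ℕ → Y)) : p (pr (k + 1) w) = pr k w := hpc' _
  have hpry (k : ℕ) (w : X × (ℕ → Y)) : (c.symm (pr (k + 1) w)).2 = w.2 k := by
    simp [pr, iterLevel]
  obtain ⟨f, hfc, hfd, hft⟩ := exists_uniform_limit (u := fun k w ↦ (G k).symm (pr k w))
    (fun k ↦ (G k).symm.continuous.comp (hprc k)) fun k w ↦ by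
      have := h2 k (pr (k + 1) w)
      rwa [show (c.symm (pr (k + 1) w)).1 = pr k w from hprp k w] at this
  let gg (x : X) : X × (ℕ → Y) := (g 0 x, fun k ↦ (c.symm (g (k + 1) x)).2)
  have hggc : Continuous gg := by fun_prop
  have hfg (x : X) : f (gg x) = x := by
    let v (k : ℕ) : X × (ℕ → Y) := (a 0 k x, fun i ↦ (c.symm (a (i + 1) (k - (i + 1)) x)).2)
    have hv (k j : ℕ) (hj : j ≤ k) : pr j (v k) = a j (k - j) x := by
      induction j with
      | zero => rfl
      | succ j ih =>
        have h := hap j (k - (j + 1)) x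
        rw [show k - (j + 1) + 1 = k - j by omega, ← ih (by omega)] at h
        change c (pr j (v k), (c.symm (a (j + 1) (k - (j + 1)) x)).2) = _
        rw [← h, hcp]
    have hvt : Tendsto v atTop (𝓝 (gg x)) := by
      refine (hgt 0 x).prodMk_nhds (tendsto_pi_nhds.2 fun i ↦ ?_)
      exact ((continuous_snd.comp c.symm.continuous).tendsto _).comp
        ((hgt (i + 1) x).comp (tendsto_sub_atTop_nat (i + 1)))
    refine tendsto_nhds_unique ((hfc.tendsto _).comp hvt)
      (tendsto_iff_dist_tendsto_zero.2 (squeeze_zero (fun _ ↦ dist_nonneg) (fun k ↦ ?_) h0))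
    have := hfd k (v k)
    rwa [hv k k le_rfl, Nat.sub_self, ha0, Homeomorph.symm_apply_apply, dist_comm] at this
  have hgf (i : ℕ) (w : X × (ℕ → Y)) : g i (f w) = pr i w := by
    have hpi (k : ℕ) : p^[k] (pr (i + k) w) = pr i w := by
      induction k with
      | zero => rfl
      | succ k ih => rw [Function.iterate_succ_apply, ← add_assoc, hprp, ih]
    have ht : Tendsto (fun k ↦ (G (i + k)).symm (pr (i + k) w)) atTop (𝓝 (f w)) := by
      simpa only [add_comm] using (tendsto_add_atTop_iff_nat i).2 (hft w)
    refine tendsto_nhds_unique (((hgc i).tendsto _).comp ht)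
      (tendsto_iff_dist_tendsto_zero.2 (squeeze_zero (fun _ ↦ dist_nonneg) (fun k ↦ ?_) h0))
    have := hgd i k ((G (i + k)).symm (pr (i + k) w))
    rwa [show a i k ((G (i + k)).symm (pr (i + k) w)) = pr i w by
      simp only [a, Homeomorph.apply_symm_apply, hpi], dist_comm] at this
  refine ⟨⟨⟨gg, f, hfg, fun w ↦ ?_⟩, hggc, hfc⟩, fun x ↦ ⟨?_, fun k ↦ ⟨g (k + 1) x, ?_, rfl⟩⟩⟩
  · ext1
    · exact hgf 0 w
    · ext1 k
      change (c.symm (g (k + 1) (f w))).2 = w.2 k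
      rw [hgf, hpry]
  · change Tendsto _ _ (𝓝 (g 0 x))
    simpa only [a, zero_add] using hgt 0 x
  · exact (hgd (k + 1) 0 x).trans_lt (by norm_num)

end Limit

section ConfineAll

open scoped PiCountable

open Filter

variable {B : Type*}

/-- The homeomorphism `B × ℝ^ω × ℝ^ω → B × ℝ^ω` interleaving two sequences. -/
def interleaveOver (B : Type*) [TopologicalSpace B] :
    (B × (ℕ → ℝ)) × (ℕ → ℝ) ≃ₜ B × (ℕ → ℝ) :=
  (Homeomorph.prodAssoc _ _ _).trans ((Homeomorph.refl B).prodCongr interleave)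

lemma FineFiberedZSet.exists_next [PseudoMetricSpace B] {Z : Set (B × (ℕ → ℝ))}
    (hZ : FineFiberedZSet Prod.fst Z) (G : B × (ℕ → ℝ) ≃ₜ B × (ℕ → ℝ))
    (hG : ∀ x, (G x).1 = x.1) (k : ℕ) :
    ∃ G' : B × (ℕ → ℝ) ≃ₜ B × (ℕ → ℝ), (∀ x, (G' x).1 = x.1) ∧
      (∀ m ≤ k, ∀ x, dist ((fun w ↦ ((interleaveOver B).symm w).1)^[m] (G x))
        ((fun w ↦ ((interleaveOver B).symm w).1)^[m] ((interleaveOver B).symm (G' x)).1)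
          ≤ 1 / 2 / 2 / 2 ^ k) ∧
      (∀ w, dist (G.symm ((interleaveOver B).symm w).1) (G'.symm w) ≤ 1 / 2 / 2 / 2 ^ k) ∧
      ∀ z ∈ Z, |((interleaveOver B).symm (G' z)).2 0| ≤ 1 := by
  set c := interleaveOver B
  set p : B × (ℕ → ℝ) → B × (ℕ → ℝ) := fun w ↦ (c.symm w).1 with hp
  have hpc : Continuous p := by fun_prop
  have hε : (0 : ℝ) < 1 / 2 / 2 / 2 ^ k := by positivity
  have hW : IsOpen ((⋂ m ∈ Finset.range (k + 1),
      {w : (B × (ℕ → ℝ)) × (B × (ℕ → ℝ)) | dist (p^[m] w.1) (p^[m] w.2) < 1 / 2 / 2 / 2 ^ k}) ∩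
      {w | dist (G.symm w.1) (G.symm w.2) < 1 / 2 / 2 / 2 ^ k}) := by
    refine (isOpen_biInter_finset fun m _ ↦ isOpen_lt ?_ continuous_const).inter
      (isOpen_lt (by fun_prop) continuous_const)
    exact ((hpc.iterate m).comp continuous_fst).dist ((hpc.iterate m).comp continuous_snd)
  obtain ⟨q, hq⟩ := (hZ.image G hG).exists_homeomorph hW fun a ↦ by simp
  have hq1 (x : B × (ℕ → ℝ)) := hq (q.symm (G x))
  simp only [Homeomorph.apply_symm_apply] at hq1
  refine ⟨G.trans (q.symm.trans c), fun x ↦ ?_, fun m hm x ↦ ?_, fun w ↦ ?_, fun z hz ↦ ?_⟩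
  · exact (hq1 x).1.symm.trans (hG x)
  · have h := mem_iInter₂.1 (hq1 x).2.1.1 m (Finset.mem_range.2 (Nat.lt_succ_iff.2 hm))
    rw [mem_ofPred_eq, dist_comm] at h
    simpa using h.le
  · exact (hq (c.symm w)).2.1.2.le
  · simpa using (hq1 z).2.2 (mem_image_of_mem G hz)

/-- Up to a homeomorphism over `B`, a fine fibered `Z`-set is bounded in infinitely many
coordinate directions. -/
lemma FineFiberedZSet.exists_bounded [MetricSpace B] [CompleteSpace B] {Z : Set (B × (ℕ → ℝ))}
    (hZ : FineFiberedZSet Prod.fst Z) :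
    ∃ Γ : B × (ℕ → ℝ) ≃ₜ (B × (ℕ → ℝ)) × (ℕ → ℕ → ℝ),
      (∀ x, (Γ x).1.1 = x.1) ∧ ∀ z ∈ Z, ∀ k, |(Γ z).2 k 0| ≤ 2 := by
  choose N hN1 hN2 hN3 hN4 using hZ.exists_next
  let G (k : ℕ) : {G : B × (ℕ → ℝ) ≃ₜ B × (ℕ → ℝ) // ∀ x, (G x).1 = x.1} :=
    Nat.rec ⟨Homeomorph.refl _, fun _ ↦ rfl⟩ (fun k G ↦ ⟨N G.1 G.2 k, hN1 G.1 G.2 k⟩) k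
  obtain ⟨Γ, hΓ⟩ := exists_limit_homeomorph (interleaveOver B) (fun k ↦ (G k).1)
    (fun k ↦ hN2 (G k).1 (G k).2 k) fun k ↦ hN3 (G k).1 (G k).2 k
  refine ⟨Γ, fun x ↦ ?_, fun z hz k ↦ ?_⟩
  · have h : ∀ k w, ((fun w ↦ ((interleaveOver B).symm w).1)^[k] w).1 = w.1 := by
      intro k
      induction k with
      | zero => exact fun _ ↦ rfl
      | succ k ih => exact fun w ↦ by rw [Function.iterate_succ_apply, ih]; rfl
    refine tendsto_nhds_unique ((continuous_fst.tendsto _).comp (hΓ x).1) ?_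
    exact tendsto_const_nhds.congr fun k ↦ ((h k _).trans ((G k).2 x)).symm
  · obtain ⟨x', hx', hΓx⟩ := (hΓ z).2 k
    rw [hΓx]
    have h1 := abs_zero_coord_sub_lt_one ((le_max_right _ _).trans_lt hx')
    have h2 : |((G (k + 1)).1 z).2 0| ≤ 1 := hN4 (G k).1 (G k).2 k z hz
    change |x'.2 0| ≤ 2
    rw [abs_sub_comm] at h1
    have h3 := abs_sub_abs_le_abs_sub (x'.2 0) (((G (k + 1)).1 z).2 0)
    linarith

end ConfineAll

/-- Double sequences as sequences. -/
def uncurrySeq : (ℕ → ℕ → ℝ) ≃ₜ (ℕ → ℝ) where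
  toFun y n := y n.unpair.1 n.unpair.2
  invFun s i j := s (Nat.pair i j)
  left_inv y := by simp
  right_inv s := by simp
  continuous_toFun := by fun_prop
  continuous_invFun := by fun_prop

/-- A linear change of coordinates of `(ℝ^ω)^ω`. Writing `a k` for the leading entry of the row
`(k, 0)`, the quantity `2 ^ (i + 4) * a k` is subtracted from the leading entry of the row
`(k, i + 1)`. -/
def shearRows : (ℕ → ℕ → ℝ) ≃ₜ ((ℕ → ℕ → ℝ) × (ℕ → ℕ → ℝ)) × (ℕ → ℝ) where
  toFun y := ((fun k i ↦ y (Nat.pair k (i + 1)) 0 - 2 ^ (i + 4) * y (Nat.pair k 0) 0,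
    fun n j ↦ y n (j + 1)), fun k ↦ y (Nat.pair k 0) 0)
  invFun p n j := Nat.casesOn j
    (Nat.casesOn n.unpair.2 (p.2 n.unpair.1)
      fun i ↦ p.1.1 n.unpair.1 i + 2 ^ (i + 4) * p.2 n.unpair.1)
    (p.1.2 n)
  left_inv y := by
    ext n j
    cases j with
    | zero =>
      conv_rhs => rw [← Nat.pair_unpair n]
      rcases h : n.unpair.2 with _ | i <;> simp [h]
    | succ j => rfl
  right_inv p := by simp
  continuous_toFun := by fun_prop
  continuous_invFun := by
    refine continuous_pi fun n ↦ continuous_pi fun j ↦ ?_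
    cases j with
    | zero => rcases n.unpair.2 with _ | i <;> simp only <;> fun_prop
    | succ j => fun_prop

lemma exists_shear : ∃ (e : (ℕ → ℝ) × (ℕ → ℕ → ℝ) ≃ₜ (ℕ → ℝ) × (ℕ → ℝ))
    (ω : ℕ → ℕ → (ℕ → ℝ) → ℝ), (∀ k i, Continuous (ω k i)) ∧
      ∀ p k i, ω k i (e p).1 + 2 ^ (i + 4) * (e p).2 k = p.2 (Nat.pair k (i + 1)) 0 := by
  let s : (ℕ → ℕ → ℝ) ≃ₜ (ℕ → ℝ) × (ℕ → ℝ) := shearRows.trans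
    (((uncurrySeq.prodCongr uncurrySeq).trans interleave).prodCongr (Homeomorph.refl _))
  let t : (ℕ → ℝ) × (ℕ → ℝ) ≃ₜ (ℕ → ℝ) := interleave
  refine ⟨((Homeomorph.refl _).prodCongr s).trans ((Homeomorph.prodAssoc _ _ _).symm.trans
    (t.prodCongr (Homeomorph.refl _))),
    fun k i r ↦ uncurrySeq.symm (interleave.symm (t.symm r).2).1 k i, fun k i ↦ by fun_prop,
    fun p k i ↦ ?_⟩
  have h : (t.symm (t (p.1, (s p.2).1))).2 = (s p.2).1 := by simp
  change uncurrySeq.symm (interleave.symm (t.symm (t (p.1, (s p.2).1))).2).1 k i +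
    2 ^ (i + 4) * p.2 (Nat.pair k 0) 0 = _
  rw [h]
  simp [s, shearRows]

section Flatten

open scoped PiCountable

open Filter

variable {B : Type*} [MetricSpace B] [CompleteSpace B]

/-- Flattening of fine fibered `Z`-sets: up to a homeomorphism over `B`, a fine fibered `Z`-set
is contained in the zero section of `(B × ℝ^ω) × ℝ^ω`. -/
lemma FineFiberedZSet.exists_flat {Z : Set (B × (ℕ → ℝ))} (hZ : FineFiberedZSet Prod.fst Z) :
    ∃ G : B × (ℕ → ℝ) ≃ₜ (B × (ℕ → ℝ)) × (ℕ → ℝ),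
      (∀ x, (G x).1.1 = x.1) ∧ ∀ z ∈ Z, (G z).2 = 0 := by
  obtain ⟨Γ, hΓ, hΓZ⟩ := hZ.exists_bounded
  obtain ⟨e, ω, hω, heω⟩ := exists_shear
  let E : B × (ℕ → ℝ) ≃ₜ (B × (ℕ → ℝ)) × (ℕ → ℝ) :=
    Γ.trans ((Homeomorph.prodAssoc _ _ _).trans
      (((Homeomorph.refl B).prodCongr e).trans (Homeomorph.prodAssoc _ _ _).symm))
  let u (k i : ℕ) (x : B × (ℕ → ℝ)) : ℝ := -ω k i x.2 / 2 ^ (i + 4)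
  have huc (k i : ℕ) : Continuous (u k i) := by
    have := hω k i
    fun_prop
  have hu (z : B × (ℕ → ℝ)) (hz : z ∈ Z) (k i : ℕ) :
      dist (u k i (E z).1) ((E z).2 k) ≤ 2 / 2 ^ (i + 4) := by
    have h1 : ω k i (E z).1.2 + 2 ^ (i + 4) * (E z).2 k = (Γ z).2 (Nat.pair k (i + 1)) 0 :=
      heω ((Γ z).1.2, (Γ z).2) k i
    have h2 : u k i (E z).1 - (E z).2 k = -((Γ z).2 (Nat.pair k (i + 1)) 0) / 2 ^ (i + 4) := by
      rw [← h1]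
      simp only [u]
      field_simp
      ring
    rw [Real.dist_eq, h2, abs_div, abs_neg, abs_of_pos (a := (2 : ℝ) ^ (i + 4)) (by positivity)]
    gcongr
    exact hΓZ z hz _
  let K : Set (B × (ℕ → ℝ)) := {x | ∀ k i, dist (u k i x) (u k (i + 1) x) ≤ 1 / 2 / 2 / 2 ^ i}
  have hK : IsClosed K := by
    simp only [K, ofPred_forall]
    exact isClosed_iInter fun k ↦ isClosed_iInter fun i ↦
      isClosed_le ((huc k i).dist (huc k (i + 1))) continuous_const
  have hEK (z : B × (ℕ → ℝ)) (hz : z ∈ Z) : (E z).1 ∈ K := fun k i ↦ by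
    refine (dist_triangle_right _ _ ((E z).2 k)).trans
      ((add_le_add (hu z hz k i) (hu z hz k (i + 1))).trans ?_)
    have h : (2 : ℝ) / 2 ^ (i + 4) + 2 / 2 ^ (i + 1 + 4) = 3 / 16 / 2 ^ i := by
      rw [pow_add, pow_add, pow_add]
      field_simp
      norm_num
    rw [h]
    exact div_le_div_of_nonneg_right (by norm_num) (by positivity)
  choose v hvc _ hvt using fun k ↦ exists_uniform_limit (α := K) (u := fun i x ↦ u k i x)
    (fun i ↦ (huc k i).comp continuous_subtype_val) fun i x ↦ x.2 k i
  obtain ⟨A, hA⟩ := ContinuousMap.exists_extension hK.isClosedEmbedding_subtypeVal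
    (⟨fun x k ↦ v k x, continuous_pi hvc⟩ : C(K, ℕ → ℝ))
  refine ⟨E.trans ⟨⟨fun p ↦ (p.1, p.2 - A p.1), fun p ↦ (p.1, p.2 + A p.1), fun p ↦ by simp,
    fun p ↦ by simp⟩, by fun_prop, by fun_prop⟩, hΓ, fun z hz ↦ ?_⟩
  have hAz (k : ℕ) : A (E z).1 k = (E z).2 k := by
    have h1 : A (E z).1 k = v k ⟨_, hEK z hz⟩ :=
      congrFun (DFunLike.congr_fun hA ⟨_, hEK z hz⟩) k
    rw [h1]
    refine tendsto_nhds_unique (hvt k ⟨_, hEK z hz⟩)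
      (tendsto_iff_dist_tendsto_zero.2 (squeeze_zero (fun _ ↦ dist_nonneg) (hu z hz k) ?_))
    exact tendsto_const_nhds.div_atTop
      ((tendsto_pow_atTop_atTop_of_one_lt one_lt_two).comp (tendsto_add_atTop_nat 4))
  ext k
  exact sub_eq_zero.2 (hAz k).symm

end Flatten

lemma isClosedEmbedding_fst_of_flat {X Y E : Type*} [TopologicalSpace X] [TopologicalSpace Y]
    [TopologicalSpace E] [Zero E] [T1Space E] {Z : Set X} (hZ : IsClosed Z) (G : X ≃ₜ Y × E)
    (h0 : ∀ z ∈ Z, (G z).2 = 0) : IsClosedEmbedding fun z : Z ↦ (G z).1 := by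
  have hι : IsClosedEmbedding fun y : Y ↦ (y, (0 : E)) :=
    ⟨isEmbedding_prodMkLeft 0, by
      have : range (fun y : Y ↦ (y, (0 : E))) = Prod.snd ⁻¹' {0} := by
        ext ⟨y, e⟩
        simp [eq_comm]
      rw [this]
      exact isClosed_singleton.preimage continuous_snd⟩
  refine (IsClosedEmbedding.of_comp_iff hι).1 ?_
  have : (fun y : Y ↦ (y, (0 : E))) ∘ (fun z : Z ↦ (G z).1) = G ∘ Subtype.val := by
    ext z
    exacts [rfl, (h0 z z.2).symm]
  rw [this]
  exact G.isClosedEmbedding.comp hZ.isClosedEmbedding_subtypeVal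

/-- Klee's trick: homeomorphisms over `B` between flat closed sets extend. -/
lemma exists_extension_of_flat.{u, v} {B : Type u} {E : Type v} {X X' : Type*}
    [TopologicalSpace B] [TopologicalSpace X] [TopologicalSpace X'] [AddCommGroup E]
    [TopologicalSpace E] [IsTopologicalAddGroup E]
    [T1Space E] [NormalSpace (B × E)] [TietzeExtension.{max u v} E]
    {p : X → B} {p' : X' → B} {Z : Set X} {F : Set X'} (hZ : IsClosed Z) (hF : IsClosed F)
    (G : X ≃ₜ (B × E) × E) (hG : ∀ x, (G x).1.1 = p x) (hGZ : ∀ z ∈ Z, (G z).2 = 0)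
    (G' : X' ≃ₜ (B × E) × E) (hG' : ∀ x, (G' x).1.1 = p' x) (hGF : ∀ z ∈ F, (G' z).2 = 0)
    (h : Z ≃ₜ F) (hp : ∀ z : Z, p' (h z) = p z) :
    ∃ H : X ≃ₜ X', (∀ z : Z, H z = h z) ∧ ∀ x, p' (H x) = p x := by
  obtain ⟨k, hk⟩ := ContinuousMap.exists_extension (isClosedEmbedding_fst_of_flat hZ G hGZ)
    (⟨fun z ↦ (G' (h z)).1.2, by fun_prop⟩ : C(Z, E))
  obtain ⟨k', hk'⟩ := ContinuousMap.exists_extension (isClosedEmbedding_fst_of_flat hF G' hGF)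
    (⟨fun z ↦ (G (h.symm z)).1.2, by fun_prop⟩ : C(F, E))
  let T : (B × E) × E ≃ₜ (B × E) × E :=
    { toFun := fun q ↦ ((q.1.1, q.2 + k q.1), q.1.2 - k' (q.1.1, q.2 + k q.1))
      invFun := fun q ↦ ((q.1.1, q.2 + k' q.1), q.1.2 - k (q.1.1, q.2 + k' q.1))
      left_inv := fun q ↦ by simp
      right_inv := fun q ↦ by simp
      continuous_toFun := by fun_prop
      continuous_invFun := by fun_prop }
  refine ⟨G.trans (T.trans G'.symm), fun z ↦ ?_, fun x ↦ ?_⟩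
  · have h1 : k (G z).1 = (G' (h z)).1.2 := DFunLike.congr_fun hk z
    have h2 : k' (G' (h z)).1 = (G z).1.2 := by
      simpa using DFunLike.congr_fun hk' (h z)
    have h3 : ((G z).1.1, (G' (h z)).1.2) = (G' (h z)).1 :=
      Prod.ext ((hG _).trans ((hp z).symm.trans (hG' _).symm)) rfl
    refine G'.symm_apply_eq.2 ?_
    change (((G z).1.1, (G z).2 + k (G z).1),
      (G z).1.2 - k' ((G z).1.1, (G z).2 + k (G z).1)) = G' (h z)
    rw [hGZ z z.2, zero_add, h1, h3, h2, sub_self, ← hGF _ (h z).2]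
  · rw [← hG', ← hG]
    simp [T]

section Unknotting

open scoped PiCountable

/-- Unknotting of fibered `Z`-sets over an arbitrary Polish base. -/
lemma FiberedZSet.exists_extension {B : Type*} [TopologicalSpace B] [PolishSpace B]
    {Z F : Set (B × (ℕ → ℝ))} (hZ : FiberedZSet Prod.fst Z) (hF : FiberedZSet Prod.fst F)
    (h : Z ≃ₜ F) (hp : ∀ z : Z, (h z : B × (ℕ → ℝ)).1 = (z : B × (ℕ → ℝ)).1) :
    ∃ H : B × (ℕ → ℝ) ≃ₜ B × (ℕ → ℝ), (∀ z : Z, H z = h z) ∧ ∀ x, (H x).1 = x.1 := by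
  let := TopologicalSpace.upgradeIsCompletelyMetrizable B
  obtain ⟨G, hG, hGZ⟩ := hZ.fine.exists_flat
  obtain ⟨G', hG', hGF⟩ := hF.fine.exists_flat
  exact exists_extension_of_flat hZ.1 hF.1 G hG hGZ G' hG' hGF h hp

end Unknotting

/-- (Toruńczyk) Fibered `Z`-set unknotting in `ℝ^ω × ℝ^ω` over the first projection. -/
theorem fibered_Z_set_unknotting_R_omega
    (Z F : Set ((ℕ → ℝ) × (ℕ → ℝ)))
    (hZ : FiberedZSet Prod.fst Z) (hF : FiberedZSet Prod.fst F)
    (h : ↥Z ≃ₜ ↥F)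
    (hfib : ∀ z : Z, ((h z : (ℕ → ℝ) × (ℕ → ℝ))).1 = (z : (ℕ → ℝ) × (ℕ → ℝ)).1) :
    ∃ H : ((ℕ → ℝ) × (ℕ → ℝ)) ≃ₜ ((ℕ → ℝ) × (ℕ → ℝ)),
      (∀ z : Z, H (z : (ℕ → ℝ) × (ℕ → ℝ)) = (h z : (ℕ → ℝ) × (ℕ → ℝ))) ∧
      ∀ x, (H x).1 = x.1 := by
  exact hZ.exists_extension hF h hfib
end

section
/- Let Z and F be fibered Z-sets in I^ω × I^ω with respect to the projection π₁ : I^ω × I^ω → I^ω onto the first factor, where I = [0,1]. Then every homeomorphism h : Z → F satisfying π₁ ∘ h = π₁|Z extends to a homeomorphism H : I^ω × I^ω → I^ω × I^ω such that π₁ ∘ H = π₁. -/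
open Set Topology

/-- The Hilbert cube. -/
abbrev HilbertCube := ℕ → unitInterval

/-- The homeomorphisms of `I^ω × I^ω` over the first factor that move each coordinate in `A`
by increasing homeomorphisms of `I` depending on the other coordinates only. -/
theorem exists_block_homeomorph (A : Set ℕ) (θ : ℕ → HilbertCube × HilbertCube → ℝ → ℝ)
    (hcont : ∀ i ∈ A, Continuous fun p : (HilbertCube × HilbertCube) × ℝ => θ i p.1 p.2)
    (hdep : ∀ i ∈ A, ∀ p q : HilbertCube × HilbertCube, p.1 = q.1 →
      (∀ j ∉ A, p.2 j = q.2 j) → θ i p = θ i q)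
    (hmono : ∀ i ∈ A, ∀ p, StrictMono (θ i p))
    (h0 : ∀ i ∈ A, ∀ p, θ i p 0 = 0) (h1 : ∀ i ∈ A, ∀ p, θ i p 1 = 1) :
    ∃ Φ : (HilbertCube × HilbertCube) ≃ₜ (HilbertCube × HilbertCube),
      (∀ p, (Φ p).1 = p.1) ∧ (∀ p, ∀ j ∉ A, (Φ p).2 j = p.2 j) ∧
      ∀ p, ∀ i ∈ A, ((Φ p).2 i : ℝ) = θ i p (p.2 i) := by
  classical
  have hmem : ∀ i ∈ A, ∀ p, ∀ x : unitInterval, θ i p x ∈ Icc (0 : ℝ) 1 := fun i hi p x =>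
    ⟨(h0 i hi p).symm.le.trans ((hmono i hi p).monotone x.2.1),
      ((hmono i hi p).monotone x.2.2).trans (h1 i hi p).le⟩
  let f : HilbertCube × HilbertCube → HilbertCube × HilbertCube := fun p =>
    (p.1, fun i => if hi : i ∈ A then ⟨θ i p (p.2 i), hmem i hi p _⟩ else p.2 i)
  have hfA : ∀ p, ∀ i ∈ A, ((f p).2 i : ℝ) = θ i p (p.2 i) := fun p i hi => by simp [f, hi]
  have hfn : ∀ p, ∀ i ∉ A, (f p).2 i = p.2 i := fun p i hi => by simp [f, hi]
  have hf : Continuous f := by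
    refine continuous_fst.prodMk (continuous_pi fun i => ?_)
    by_cases hi : i ∈ A
    · simp only [hi, dite_true]
      refine Continuous.subtype_mk ?_ _
      exact (hcont i hi).comp (continuous_id.prodMk
        (continuous_subtype_val.comp ((continuous_apply i).comp continuous_snd)))
    · simp only [hi, dite_false]
      exact (continuous_apply i).comp continuous_snd
  have hbij : Function.Bijective f := by
    constructor
    · intro p q hpq
      have e1 : p.1 = q.1 := (congrArg Prod.fst hpq : (f p).1 = (f q).1)
      have e2 : ∀ j ∉ A, p.2 j = q.2 j := fun j hj => by
        rw [← hfn p j hj, ← hfn q j hj, hpq]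
      refine Prod.ext e1 (funext fun i => ?_)
      by_cases hi : i ∈ A
      · have := hfA p i hi
        rw [hpq, hfA q i hi, hdep i hi p q e1 e2] at this
        exact Subtype.ext ((hmono i hi q).injective this).symm
      · exact e2 i hi
    · intro q
      have key : ∀ i ∈ A, ∃ x : unitInterval, θ i q x = q.2 i := by
        intro i hi
        have hc : ContinuousOn (θ i q) (Icc 0 1) :=
          ((hcont i hi).comp (continuous_const.prodMk continuous_id)).continuousOn
        have := intermediate_value_Icc zero_le_one hc
        rw [h0 i hi, h1 i hi] at this
        obtain ⟨x, hx, e⟩ := this (q.2 i).2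
        exact ⟨⟨x, hx⟩, e⟩
      choose! g hg using key
      let r : HilbertCube × HilbertCube := (q.1, fun i => if i ∈ A then g i else q.2 i)
      have e1 : ∀ i ∈ A, r.2 i = g i := fun i hi => by simp [r, hi]
      have e2 : ∀ j ∉ A, r.2 j = q.2 j := fun j hj => by simp [r, hj]
      refine ⟨r, Prod.ext rfl (funext fun i => ?_)⟩
      by_cases hi : i ∈ A
      · apply Subtype.ext
        rw [hfA _ i hi, hdep i hi r q rfl e2, e1 i hi, hg i hi]
      · rw [hfn _ i hi, e2 i hi]
  exact ⟨hf.homeoOfEquivCompactToT2 (f := Equiv.ofBijective f hbij), fun p => rfl,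
    hfn, hfA⟩

/-- For `a ≤ t ≤ b`, an increasing homeomorphism of the line that is supported on `[a, b]` and
for large `S` and small `κ` takes a large part of `[a, b]` close to `t`. -/
def squeeze (S κ a b t x : ℝ) : ℝ :=
  min (a + S * (max a (min x b) - a))
    (max (t + κ * (max a (min x b) - t)) (b + S * (max a (min x b) - b))) +
    (x - max a (min x b))

theorem squeeze_strictMono {S κ a b t : ℝ} (hS : 0 < S) (hκ : 0 < κ) :
    StrictMono (squeeze S κ a b t) := by
  intro x y hxy
  unfold squeeze
  set c := max a (min x b) with hc
  set d := max a (min y b) with hd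
  have h1 : c ≤ d := by grind
  have h2 : x - c ≤ y - d := by grind
  rcases h1.eq_or_lt with h | h
  · rw [h]; gcongr
  · have : S * (c - a) < S * (d - a) := by gcongr
    have : κ * (c - t) < κ * (d - t) := by gcongr
    have : S * (c - b) < S * (d - b) := by gcongr
    refine add_lt_add_of_lt_of_le ?_ h2
    refine min_lt_min (by linarith) (max_lt_max (by linarith) (by linarith))

theorem squeeze_of_le {S κ a b t x : ℝ} (hκ : κ ≤ 1) (ht : t ∈ Icc a b) (hx : x ≤ a) :
    squeeze S κ a b t x = x := by
  obtain ⟨h1, h2⟩ := ht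
  have : max a (min x b) = a := by grind
  rw [squeeze, this, min_eq_left]
  · ring
  · refine le_max_of_le_left ?_
    nlinarith

theorem squeeze_of_ge {S κ a b t x : ℝ} (hS : 1 ≤ S) (hκ : κ ≤ 1) (ht : t ∈ Icc a b)
    (hx : b ≤ x) : squeeze S κ a b t x = x := by
  obtain ⟨h1, h2⟩ := ht
  have : max a (min x b) = b := by grind
  rw [squeeze, this, max_eq_right, min_eq_right]
  · ring
  · nlinarith
  · nlinarith

theorem squeeze_mem {S κ a b t x : ℝ} (hS : 1 ≤ S) (hκ : 0 < κ) (hκ1 : κ ≤ 1) (ht : t ∈ Icc a b)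
    (hx : x ∈ Icc a b) : squeeze S κ a b t x ∈ Icc a b := by
  have hm := (squeeze_strictMono (a := a) (b := b) (t := t) (zero_lt_one.trans_le hS) hκ).monotone
  exact ⟨(squeeze_of_le hκ1 ht le_rfl).symm.le.trans (hm hx.1),
    (hm hx.2).trans (squeeze_of_ge hS hκ1 ht le_rfl).le⟩

theorem abs_squeeze_sub_le {S κ a b t x : ℝ} (hS : 1 ≤ S) (hκ : 0 < κ) (hκ1 : κ ≤ 1)
    (ht : t ∈ Icc a b) : |squeeze S κ a b t x - x| ≤ b - a := by
  have hab := ht.1.trans ht.2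
  rcases le_total x a with h | h
  · rw [squeeze_of_le hκ1 ht h]; simpa using hab
  rcases le_total b x with h' | h'
  · rw [squeeze_of_ge hS hκ1 ht h']; simpa using hab
  have := squeeze_mem hS hκ hκ1 ht ⟨h, h'⟩
  rw [abs_le]
  constructor <;> linarith [this.1, this.2]

theorem squeeze_eq {S κ a b t x η : ℝ} (hκ : 0 ≤ κ) (hκ1 : κ ≤ 1) (hη : 0 < η) (hS : S * η = 1)
    (hab : b - a ≤ 1) (ht : t ∈ Icc a b) (hxa : a + η ≤ x) (hxb : x ≤ b - η) :
    squeeze S κ a b t x = t + κ * (x - t) := by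
  have hS0 : 0 < S := by by_contra! h; nlinarith
  obtain ⟨h1, h2⟩ := ht
  have h3 : max a (min x b) = x := by grind
  have h4 : S * (x - a) ≥ 1 := by nlinarith
  have h5 : S * (b - x) ≥ 1 := by nlinarith
  have h6 : t + κ * (x - t) ∈ Icc a b := by constructor <;> nlinarith
  rw [squeeze, h3, max_eq_left, min_eq_right]
  · ring
  · linarith [h6.2]
  · linarith [h6.1]

theorem Continuous.squeeze {X : Type*} [TopologicalSpace X] {a b t x : X → ℝ} (S κ : ℝ)
    (ha : Continuous a) (hb : Continuous b) (ht : Continuous t) (hx : Continuous x) :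
    Continuous fun p => squeeze S κ (a p) (b p) (t p) (x p) := by
  unfold _root_.squeeze
  fun_prop

/-- Half of the distance from the center of the horizontal slices of a square with its
upper corners cut off. -/
noncomputable def cutWidth (ε v : ℝ) : ℝ := min 1 (1 - ε * (v - 1 / 4))

/-- The height of the vertical slices of a square with its upper corners cut off. -/
noncomputable def cutHeight (ε u : ℝ) : ℝ := min 1 (1 / 4 + (1 - |2 * u - 1|) / ε)

theorem cutWidth_pos {ε v : ℝ} (hε : 0 < ε) (hε1 : ε < 1) (hv : v ≤ 1) : 0 < cutWidth ε v :=
  lt_min one_pos (by nlinarith)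

theorem cutWidth_le_one (ε v : ℝ) : cutWidth ε v ≤ 1 := min_le_left _ _

theorem one_sub_le_cutWidth {ε v : ℝ} (hε : 0 < ε) (hv : v ≤ 1) : 1 - ε ≤ cutWidth ε v :=
  le_min (by linarith) (by nlinarith)

theorem cutHeight_pos {ε u : ℝ} (hε : 0 < ε) (hu : u ∈ Icc (0 : ℝ) 1) : 0 < cutHeight ε u := by
  refine lt_min one_pos ?_
  have : |2 * u - 1| ≤ 1 := abs_le.2 ⟨by linarith [hu.1], by linarith [hu.2]⟩
  have : 0 ≤ (1 - |2 * u - 1|) / ε := div_nonneg (by linarith) hε.le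
  linarith

theorem cutHeight_le_one (ε u : ℝ) : cutHeight ε u ≤ 1 := min_le_left _ _

theorem le_cutHeight_iff {ε u v : ℝ} (hε : 0 < ε) (hu : u ∈ Icc (0 : ℝ) 1) (hv : v ≤ 1) :
    v ≤ cutHeight ε u ↔ |2 * u - 1| ≤ cutWidth ε v := by
  have h1 : |2 * u - 1| ≤ 1 := abs_le.2 ⟨by linarith [hu.1], by linarith [hu.2]⟩
  have h2 : v - 1 / 4 ≤ (1 - |2 * u - 1|) / ε ↔ (v - 1 / 4) * ε ≤ 1 - |2 * u - 1| :=
    le_div_iff₀ hε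
  rw [cutHeight, cutWidth, le_min_iff, le_min_iff]
  constructor
  · rintro ⟨-, h⟩
    exact ⟨h1, by linarith [h2.1 (by linarith)]⟩
  · rintro ⟨-, h⟩
    exact ⟨hv, by linarith [h2.2 (by linarith)]⟩

/-- A homeomorphism of the square that opens its upper corners. -/
theorem exists_square_homeomorph_cut {ε : ℝ} (hε : 0 < ε) (hε1 : ε < 1) :
    ∃ P : (unitInterval × unitInterval) ≃ₜ (unitInterval × unitInterval), ∀ q,
      ((P q).1 : ℝ) = 1 / 2 + (q.1 - 1 / 2) * cutWidth ε q.2 ∧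
      ((P q).2 : ℝ) = q.2 / cutHeight ε (P q).1 := by
  have hu : ∀ q : unitInterval × unitInterval,
      1 / 2 + ((q.1 : ℝ) - 1 / 2) * cutWidth ε q.2 ∈ Icc (0 : ℝ) 1 := fun q => by
    have h1 := cutWidth_pos hε hε1 q.2.2.2
    have h2 := cutWidth_le_one ε q.2
    have h3 := q.1.2.1
    have h4 := q.1.2.2
    constructor <;> nlinarith
  have hv : ∀ q : unitInterval × unitInterval,
      (q.2 : ℝ) / cutHeight ε (1 / 2 + ((q.1 : ℝ) - 1 / 2) * cutWidth ε q.2) ∈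
        Icc (0 : ℝ) 1 := fun q => by
    have h1 := cutHeight_pos hε (hu q)
    refine ⟨div_nonneg q.2.2.1 h1.le, (div_le_one h1).2 ?_⟩
    rw [le_cutHeight_iff hε (hu q) q.2.2.2]
    have e : 2 * (1 / 2 + ((q.1 : ℝ) - 1 / 2) * cutWidth ε q.2) - 1 =
      (2 * q.1 - 1) * cutWidth ε q.2 := by ring
    have h2 := cutWidth_pos hε hε1 q.2.2.2
    rw [e, abs_mul, abs_of_pos h2]
    have : |2 * (q.1 : ℝ) - 1| ≤ 1 :=
      abs_le.2 ⟨by linarith [q.1.2.1], by linarith [q.1.2.2]⟩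
    nlinarith
  have hv' : ∀ q : unitInterval × unitInterval,
      (q.2 : ℝ) * cutHeight ε q.1 ∈ Icc (0 : ℝ) 1 := fun q => by
    have h1 := cutHeight_pos hε q.1.2
    have h2 := cutHeight_le_one ε q.1
    have h3 := q.2.2.1
    have h4 := q.2.2.2
    constructor <;> nlinarith
  have hu' : ∀ q : unitInterval × unitInterval,
      1 / 2 + ((q.1 : ℝ) - 1 / 2) / cutWidth ε (q.2 * cutHeight ε q.1) ∈
        Icc (0 : ℝ) 1 := fun q => by
    have h1 := cutWidth_pos hε hε1 (hv' q).2
    have h2 : (q.2 : ℝ) * cutHeight ε q.1 ≤ cutHeight ε q.1 := by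
      have := cutHeight_pos hε q.1.2
      nlinarith [q.2.2.2]
    rw [le_cutHeight_iff hε q.1.2 (hv' q).2] at h2
    obtain ⟨h3, h4⟩ := abs_le.1 h2
    have h5 : -(1 / 2) ≤ ((q.1 : ℝ) - 1 / 2) / cutWidth ε (q.2 * cutHeight ε q.1) := by
      rw [le_div_iff₀ h1]; linarith
    have h6 : ((q.1 : ℝ) - 1 / 2) / cutWidth ε (q.2 * cutHeight ε q.1) ≤ 1 / 2 := by
      rw [div_le_iff₀ h1]; linarith
    constructor <;> linarith
  have cu : Continuous fun q : unitInterval × unitInterval =>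
      1 / 2 + ((q.1 : ℝ) - 1 / 2) * cutWidth ε q.2 := by
    unfold cutWidth; fun_prop
  have cv : Continuous fun q : unitInterval × unitInterval =>
      (q.2 : ℝ) / cutHeight ε (1 / 2 + ((q.1 : ℝ) - 1 / 2) * cutWidth ε q.2) := by
    refine Continuous.div (by fun_prop) ?_ fun q => (cutHeight_pos hε (hu q)).ne'
    unfold cutHeight cutWidth; fun_prop
  let e : (unitInterval × unitInterval) ≃ (unitInterval × unitInterval) :=
    { toFun := fun q => (⟨_, hu q⟩, ⟨_, hv q⟩)
      invFun := fun q => (⟨_, hu' q⟩, ⟨_, hv' q⟩)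
      left_inv := fun q => by
        have h1 := (cutHeight_pos hε (hu q)).ne'
        have h2 := (cutWidth_pos hε hε1 q.2.2.2).ne'
        ext
        · simp only [div_mul_cancel₀ _ h1]
          field_simp
          ring
        · exact div_mul_cancel₀ _ h1
      right_inv := fun q => by
        have h1 := (cutHeight_pos hε q.1.2).ne'
        have h2 := (cutWidth_pos hε hε1 (hv' q).2).ne'
        have e1 : 1 / 2 + (1 / 2 + ((q.1 : ℝ) - 1 / 2) / cutWidth ε (q.2 * cutHeight ε q.1) -
            1 / 2) * cutWidth ε (q.2 * cutHeight ε q.1) = q.1 := by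
          field_simp
          ring
        ext
        · exact e1
        · simp only [e1]
          exact mul_div_cancel_right₀ _ h1 }
  have he : Continuous e := (cu.subtype_mk hu).prodMk (cv.subtype_mk hv)
  exact ⟨he.homeoOfEquivCompactToT2, fun q => ⟨rfl, rfl⟩⟩

/-- A homeomorphism of the square that moves little horizontally and takes the lateral and upper
sides into the interior of the upper side. -/
theorem exists_square_homeomorph_slide {ε : ℝ} (hε : 0 < ε) (hε1 : ε < 1) :
    ∃ R : (unitInterval × unitInterval) ≃ₜ (unitInterval × unitInterval),
      (∀ q, |((R q).1 : ℝ) - q.1| ≤ ε) ∧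
      ∀ q, q.1 = 0 ∨ q.1 = 1 ∨ q.2 = 1 → (R q).2 = 1 ∧ (R q).1 ∈ Ioo 0 1 := by
  obtain ⟨P, hP⟩ := exists_square_homeomorph_cut hε hε1
  have near : ∀ q, |((P q).1 : ℝ) - q.1| ≤ ε / 2 := fun q => by
    rw [(hP q).1]
    have h1 := one_sub_le_cutWidth hε q.2.2.2
    have h2 := cutWidth_le_one ε q.2
    have h3 := q.1.2.1
    have h4 := q.1.2.2
    rw [abs_le]
    constructor <;> nlinarith
  let M := (Homeomorph.refl unitInterval).prodCongr unitInterval.symmHomeomorph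
  have hM : ∀ q, M q = (q.1, unitInterval.symm q.2) := fun q => rfl
  have side : ∀ u v : unitInterval, u = 0 ∨ u = 1 → ∃ v' : unitInterval, (v' : ℝ) = v / 4 ∧
      P.symm (u, v) = (u, v') := by
    intro u v hu
    have hv0 := v.2.1
    have hv1 := v.2.2
    refine ⟨⟨v / 4, by linarith, by linarith⟩, rfl, ?_⟩
    rw [Homeomorph.symm_apply_eq]
    have e0 : cutWidth ε (v / 4) = 1 := min_eq_left (by nlinarith)
    have e1 : (P (u, ⟨v / 4, by linarith, by linarith⟩)).1 = u := by
      ext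
      rw [(hP _).1]
      simp [e0]
    refine Prod.ext e1.symm (Subtype.ext ?_)
    rw [(hP _).2, e1]
    have : cutHeight ε u = 1 / 4 := by
      rcases hu with rfl | rfl <;> norm_num [cutHeight]
    simp only [this]
    ring
  have bot : ∀ u : unitInterval, P.symm (u, 0) = (u, 0) := by
    intro u
    rw [Homeomorph.symm_apply_eq]
    have e0 : cutWidth ε 0 = 1 := min_eq_left (by nlinarith)
    refine (Prod.ext (Subtype.ext ?_) (Subtype.ext ?_)).symm
    · rw [(hP _).1]; simp [e0]
    · rw [(hP _).2]; simp
  have key : ∀ u v : unitInterval, (3 / 4 : ℝ) ≤ v → v = 1 ∨ u = 0 ∨ u = 1 →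
      (P (u, v)).2 = 1 ∧ (P (u, v)).1 ∈ Ioo 0 1 := by
    intro u v hv huv
    have hu0 := u.2.1
    have hu1 := u.2.2
    have hv1 := v.2.2
    have e0 : cutWidth ε v = 1 - ε * (v - 1 / 4) := min_eq_right (by nlinarith)
    have h1 := (hP (u, v)).1
    have h2 := (hP (u, v)).2
    simp only [e0] at h1
    have e1 : cutHeight ε (P (u, v)).1 = v := by
      rcases huv with rfl | hu
      · refine min_eq_left ?_
        have : |2 * ((P (u, 1)).1 : ℝ) - 1| ≤ 1 - ε * (3 / 4) := by
          rw [h1, abs_le]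
          push_cast
          constructor <;> nlinarith
        have : 3 / 4 ≤ (1 - |2 * ((P (u, 1)).1 : ℝ) - 1|) / ε := by
          rw [le_div_iff₀ hε]; linarith
        linarith
      · have : |2 * (1 / 2 + ((u : ℝ) - 1 / 2) * (1 - ε * (v - 1 / 4))) - 1| =
            1 - ε * (v - 1 / 4) := by
          rcases hu with rfl | rfl
          · rw [Icc.coe_zero, abs_of_nonpos (by nlinarith)]; ring
          · rw [Icc.coe_one, abs_of_nonneg (by nlinarith)]; ring
        rw [cutHeight, h1, this]
        have e : 1 / 4 + (1 - (1 - ε * ((v : ℝ) - 1 / 4))) / ε = v := by field_simp; ring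
        rw [e, min_eq_right hv1]
    refine ⟨Subtype.ext ?_, ?_⟩
    · rw [h2, e1, div_self (by linarith)]; rfl
    · rw [mem_Ioo, ← Subtype.coe_lt_coe, ← Subtype.coe_lt_coe, h1]
      have h3 : 0 < 1 - ε * ((v : ℝ) - 1 / 4) := by nlinarith
      have h4 : 1 - ε * ((v : ℝ) - 1 / 4) < 1 := by nlinarith
      push_cast
      constructor <;> nlinarith
  refine ⟨((M.trans P.symm).trans M).trans P, fun q => ?_, fun q hq => ?_⟩
  · simp only [Homeomorph.trans_apply]
    have h1 := near (M (P.symm (M q)))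
    have h2 := near (P.symm (M q))
    rw [Homeomorph.apply_symm_apply] at h2
    simp only [hM] at h1 h2 ⊢
    rw [abs_le] at *
    constructor <;> linarith
  · simp only [Homeomorph.trans_apply]
    have hor : (q.1 = 0 ∨ q.1 = 1) ∨ q.2 = 1 := by tauto
    rcases hor with h | h
    · obtain ⟨v, hv, e⟩ := side q.1 (unitInterval.symm q.2) h
      rw [hM q, e, hM]
      refine key _ _ ?_ (Or.inr h)
      have := (unitInterval.symm q.2).2.2
      rw [unitInterval.coe_symm_eq, hv]
      linarith
    · rw [hM q, h, unitInterval.symm_one, bot, hM, unitInterval.symm_zero]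
      exact key _ _ (by norm_num) (Or.inl rfl)

/-- The homeomorphism `exists_square_homeomorph_slide` in the coordinates `i` and `j`. -/
theorem exists_slide_homeomorph {i j : ℕ} (hij : i ≠ j) {ε : ℝ} (hε : 0 < ε) (hε1 : ε < 1) :
    ∃ Φ : (HilbertCube × HilbertCube) ≃ₜ (HilbertCube × HilbertCube),
      (∀ p, (Φ p).1 = p.1) ∧ (∀ p, |((Φ p).2 i : ℝ) - p.2 i| ≤ ε) ∧
      (∀ p, ∀ k, k ≠ i → k ≠ j → (Φ p).2 k = p.2 k) ∧
      ∀ p, p.2 i = 0 ∨ p.2 i = 1 ∨ p.2 j = 1 → (Φ p).2 j = 1 ∧ (Φ p).2 i ∈ Ioo 0 1 := by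
  obtain ⟨R, hR1, hR2⟩ := exists_square_homeomorph_slide hε hε1
  let F : (unitInterval × unitInterval ≃ₜ unitInterval × unitInterval) →
      HilbertCube × HilbertCube → HilbertCube × HilbertCube := fun R p =>
    (p.1, Function.update (Function.update p.2 i (R (p.2 i, p.2 j)).1) j (R (p.2 i, p.2 j)).2)
  have hi : ∀ R p, (F R p).2 i = (R (p.2 i, p.2 j)).1 := fun R p => by simp [F, hij]
  have hj : ∀ R p, (F R p).2 j = (R (p.2 i, p.2 j)).2 := fun R p => by simp [F]
  have hk : ∀ R p k, k ≠ i → k ≠ j → (F R p).2 k = p.2 k := fun R p k h1 h2 => by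
    simp [F, h1, h2]
  have hinv : ∀ R, Function.LeftInverse (F R.symm) (F R) := fun R p => by
    refine Prod.ext rfl (funext fun k => ?_)
    rcases eq_or_ne k i with rfl | h1
    · rw [hi, hi, hj, Prod.mk.eta, R.symm_apply_apply]
    rcases eq_or_ne k j with rfl | h2
    · rw [hj, hi, hj, Prod.mk.eta, R.symm_apply_apply]
    rw [hk _ _ k h1 h2, hk _ _ k h1 h2]
  have hc : ∀ R, Continuous (F R) := fun R => by
    have hp : Continuous fun p : HilbertCube × HilbertCube => R (p.2 i, p.2 j) := by fun_prop
    exact continuous_fst.prodMk ((continuous_snd.update i hp.fst).update j hp.snd)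
  refine ⟨⟨⟨F R, F R.symm, hinv R, hinv R.symm⟩, hc R, hc R.symm⟩, fun p => rfl, fun p => ?_,
    hk R, fun p h => ?_⟩
  · change |((F R p).2 i : ℝ) - p.2 i| ≤ ε
    rw [hi]
    exact hR1 _
  · change (F R p).2 j = 1 ∧ (F R p).2 i ∈ Ioo 0 1
    rw [hi, hj]
    exact hR2 _ h

/-- Endfaces can be moved off finitely many endfaces by homeomorphisms close to the identity. -/
theorem exists_homeomorph_endface {n N : ℕ} (hn : n < N) {m : ℕ} (hm : m ≤ N) :
    ∀ {ε : ℝ}, 0 < ε → ε < 1 →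
    ∃ Φ : (HilbertCube × HilbertCube) ≃ₜ (HilbertCube × HilbertCube),
      (∀ p, (Φ p).1 = p.1) ∧ (∀ p, ∀ k < N, |((Φ p).2 k : ℝ) - p.2 k| ≤ ε) ∧
      ∀ p, p.2 n = 0 ∨ p.2 n = 1 → (Φ p).2 N = 1 ∧ ∀ k < m, (Φ p).2 k ∈ Ioo 0 1 := by
  induction m with
  | zero =>
    intro ε hε hε1
    obtain ⟨Φ, h1, h2, h3, h4⟩ := exists_slide_homeomorph hn.ne hε hε1
    refine ⟨Φ, h1, fun p k hk => ?_, fun p hp => ⟨(h4 p (by tauto)).1, by simp⟩⟩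
    rcases eq_or_ne k n with rfl | h
    · exact h2 p
    · rw [h3 p k h hk.ne]; simpa using hε.le
  | succ m ih =>
    intro ε hε hε1
    obtain ⟨Φ, h1, h2, h3⟩ := ih (by omega) (half_pos hε) (by linarith)
    obtain ⟨Ψ, k1, k2, k3, k4⟩ := exists_slide_homeomorph (show m ≠ N by omega) (half_pos hε)
      (by linarith)
    refine ⟨Φ.trans Ψ, fun p => (k1 _).trans (h1 p), fun p k hk => ?_, fun p hp => ?_⟩
    · have e1 := h2 p k hk
      have e2 : |((Ψ (Φ p)).2 k : ℝ) - (Φ p).2 k| ≤ ε / 2 := by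
        rcases eq_or_ne k m with rfl | h
        · exact k2 _
        · rw [k3 _ k h hk.ne, sub_self, abs_zero]; exact (half_pos hε).le
      rw [Homeomorph.trans_apply]
      rw [abs_le] at *
      constructor <;> linarith
    · obtain ⟨e1, e2⟩ := h3 p hp
      obtain ⟨e3, e4⟩ := k4 (Φ p) (by tauto)
      refine ⟨e3, fun k hk => ?_⟩
      rcases eq_or_ne k m with rfl | h
      · exact e4
      · rw [Homeomorph.trans_apply, k3 _ k h (by omega)]
        exact e2 k (by omega)

theorem IsCompact.exists_margin {C : Set (HilbertCube × HilbertCube)} (hC : IsCompact C) {k : ℕ}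
    (hk : ∀ p ∈ C, p.2 k ∈ Ioo 0 1) :
    ∃ η : ℝ, 0 < η ∧ η ≤ 1 ∧ ∀ p ∈ C, η ≤ p.2 k ∧ (p.2 k : ℝ) ≤ 1 - η := by
  rcases C.eq_empty_or_nonempty with rfl | hne
  · exact ⟨1, by simp⟩
  have hc : Continuous fun p : HilbertCube × HilbertCube => min (p.2 k : ℝ) (1 - p.2 k) := by
    fun_prop
  obtain ⟨p, hp, hmin⟩ := hC.exists_isMinOn hne hc.continuousOn
  have h0 : (0 : ℝ) < p.2 k := (hk p hp).1
  have h1 : (p.2 k : ℝ) < 1 := (hk p hp).2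
  refine ⟨min (p.2 k : ℝ) (1 - p.2 k), lt_min h0 (by linarith), (min_le_left _ _).trans h1.le,
    fun q hq => ?_⟩
  have := hmin hq
  simp only [mem_ofPred_eq] at this
  have h2 := min_le_left (q.2 k : ℝ) (1 - q.2 k)
  have h3 := min_le_right (q.2 k : ℝ) (1 - q.2 k)
  constructor <;> linarith

theorem FiberedZSet.exists_map {Z : Set (HilbertCube × HilbertCube)}
    (hZ : FiberedZSet Prod.fst Z) (K : ℕ) {ε : ℝ} (hε : 0 < ε) :
    ∃ f : HilbertCube × HilbertCube → HilbertCube, Continuous f ∧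
      (∀ p, ∀ i < K, |(f p i : ℝ) - p.2 i| ≤ ε) ∧ ∀ p, (p.1, f p) ∉ Z := by
  let g : HilbertCube → HilbertCube → ℝ := fun c x =>
    max 0 (ε / 2 - ∑ i ∈ Finset.range K, |(x i : ℝ) - c i|)
  have hg : ∀ c, Continuous (g c) := fun c => by fun_prop
  let U : ℕ → Set (HilbertCube × HilbertCube) := fun m =>
    (fun p => g (TopologicalSpace.denseSeq HilbertCube m) p.2) ⁻¹' {(0 : ℝ)}ᶜ
  have hU : ∀ c x, g c x ≠ 0 → ∀ i < K, |(x i : ℝ) - c i| ≤ ε / 2 := fun c x h i hi => by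
    by_contra! h'
    have := Finset.single_le_sum (f := fun i => |(x i : ℝ) - c i|) (fun _ _ => abs_nonneg _)
      (Finset.mem_range.2 hi)
    exact h (max_eq_left (by linarith))
  obtain ⟨f, hf, hfZ, hfst, hclose⟩ := hZ.2 (range U) ⟨countable_range U, by
    rintro _ ⟨m, rfl⟩
    exact ⟨_, (hg _).comp continuous_snd, rfl⟩, by
    refine eq_univ_of_forall fun p => ?_
    have ho : IsOpen {c : HilbertCube | ∑ i ∈ Finset.range K, |(p.2 i : ℝ) - c i| < ε / 2} :=
      isOpen_lt (by fun_prop) continuous_const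
    obtain ⟨m, hm⟩ := (TopologicalSpace.denseRange_denseSeq HilbertCube).exists_mem_open ho
      ⟨p.2, by simpa using hε⟩
    refine ⟨_, ⟨m, rfl⟩, ?_⟩
    have hm' : 0 < g (TopologicalSpace.denseSeq HilbertCube m) p.2 :=
      lt_max_of_lt_right (by simpa using hm)
    exact hm'.ne'⟩
  refine ⟨fun p => (f p).2, hf.snd, fun p i hi => ?_, fun p hp => ?_⟩
  · obtain ⟨_, ⟨m, rfl⟩, h1, h2⟩ := hclose p
    have e1 := hU _ _ h1 i hi
    have e2 := hU _ _ h2 i hi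
    simp only [id] at e2
    rw [abs_le] at *
    constructor <;> linarith
  · have : f p ∈ closure (range f) ∩ Z := ⟨subset_closure (mem_range_self p), by
      rwa [← hfst p] at hp⟩
    rwa [hfZ] at this

theorem exists_nhds_graph_disjoint {Z : Set (HilbertCube × HilbertCube)} (hZ : IsClosed Z)
    {f : HilbertCube × HilbertCube → HilbertCube} (hf : Continuous f)
    (hfZ : ∀ p, (p.1, f p) ∉ Z) :
    ∃ (N : ℕ) (δ : ℝ), 0 < δ ∧ ∀ p, ∀ q : HilbertCube,
      (∀ i < N, |(q i : ℝ) - f p i| < δ) → (p.1, q) ∉ Z := by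
  by_contra! h
  choose p q hpq hmem using fun m : ℕ => h m (1 / ((m : ℝ) + 1)) Nat.one_div_pos_of_nat
  obtain ⟨a, φ, hφ, ha⟩ := CompactSpace.tendsto_subseq p
  have hfa := (hf.tendsto a).comp ha
  have hq : Filter.Tendsto (q ∘ φ) Filter.atTop (𝓝 (f a)) := by
    rw [tendsto_pi_nhds] at hfa ⊢
    intro i
    rw [tendsto_subtype_rng]
    have h0 : Filter.Tendsto (fun m => (q (φ m) i : ℝ) - f (p (φ m)) i) Filter.atTop (𝓝 0) := by
      refine squeeze_zero_norm' (a := fun m => 1 / ((φ m : ℝ) + 1)) ?_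
        (tendsto_one_div_add_atTop_nhds_zero_nat.comp hφ.tendsto_atTop)
      filter_upwards [Filter.eventually_gt_atTop i] with m hm
      exact (hpq (φ m) i (hm.trans_le hφ.le_apply)).le
    have := h0.add (tendsto_subtype_rng.1 (hfa i))
    simpa using this
  exact hfZ a (hZ.mem_of_tendsto ((continuous_fst.tendsto a).comp ha |>.prodMk_nhds hq)
    (Filter.Eventually.of_forall fun m => hmem (φ m)))

/-- Endfaces can be moved off a fibered `Z`-set by homeomorphisms close to the identity. -/
theorem FiberedZSet.exists_homeomorph_endface {Z : Set (HilbertCube × HilbertCube)}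
    (hZ : FiberedZSet Prod.fst Z) (n K : ℕ) {ε : ℝ} (hε : 0 < ε) :
    ∃ Φ : (HilbertCube × HilbertCube) ≃ₜ (HilbertCube × HilbertCube),
      (∀ p, (Φ p).1 = p.1) ∧ (∀ p, ∀ k < K, |((Φ p).2 k : ℝ) - p.2 k| ≤ ε) ∧
      ∀ p, p.2 n = 0 ∨ p.2 n = 1 → Φ p ∉ Z := by
  obtain ⟨ρ, hρ, hρ1, hρε⟩ : ∃ ρ : ℝ, 0 < ρ ∧ ρ < 1 ∧ 5 * ρ ≤ ε :=
    ⟨min ε 1 / 5, by positivity, by linarith [min_le_right ε 1], by linarith [min_le_left ε 1]⟩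
  obtain ⟨f, hf, hfK, hfZ⟩ := hZ.exists_map K hρ
  obtain ⟨N₀, δ, hδ, hN₀⟩ := exists_nhds_graph_disjoint hZ.1 hf hfZ
  obtain ⟨N, hNn, hNK, hNN₀⟩ : ∃ N, n < N ∧ K ≤ N ∧ N₀ ≤ N :=
    ⟨n + 1 + K + N₀, by omega, by omega, by omega⟩
  obtain ⟨Φ₀, hΦ₀, hΦ₀K, hΦ₀n⟩ :=
    _root_.exists_homeomorph_endface (show n < 2 * N by omega) le_rfl hρ hρ1
  have hC : IsCompact (Φ₀ '' {p | p.2 n = 0 ∨ p.2 n = 1}) := by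
    refine (IsClosed.isCompact ?_).image Φ₀.continuous
    exact (isClosed_eq (by fun_prop) continuous_const).union
      (isClosed_eq (by fun_prop) continuous_const)
  have hη : ∀ k < 2 * N, ∃ η : ℝ, 0 < η ∧ η ≤ 1 ∧ ∀ p, p.2 n = 0 ∨ p.2 n = 1 →
      η ≤ (Φ₀ p).2 k ∧ ((Φ₀ p).2 k : ℝ) ≤ 1 - η := fun k hk => by
    obtain ⟨η, h1, h2, h3⟩ := hC.exists_margin (k := k)
      (by rintro _ ⟨p, hp, rfl⟩; exact (hΦ₀n p hp).2 k hk)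
    exact ⟨η, h1, h2, fun p hp => h3 _ ⟨p, hp, rfl⟩⟩
  choose! η hη0 hη1 hη using hη
  -- the coordinates `N + k` are made close to the coordinates `k < N`
  obtain ⟨Φ₁, hΦ₁, hΦ₁n, hΦ₁e⟩ := exists_block_homeomorph {k | N ≤ k ∧ k < 2 * N}
    (fun k p x => squeeze (1 / η k) ρ 0 1 (p.2 (k - N)) x)
    (fun k _ => Continuous.squeeze _ _ continuous_const continuous_const (by fun_prop)
      (by fun_prop))
    (fun k hk p q _ h => by
      simp only [mem_ofPred_eq] at hk h
      rw [h (k - N) (by omega)])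
    (fun k hk p => squeeze_strictMono (one_div_pos.2 (hη0 k hk.2)) hρ)
    (fun k hk p => squeeze_of_le hρ1.le (p.2 _).2 le_rfl)
    (fun k hk p => squeeze_of_ge ((one_le_div (hη0 k hk.2)).2 (hη1 k hk.2)) hρ1.le
      (p.2 _).2 le_rfl)
  -- the coordinates `k < N` are made close to the values of `f`
  let r : ℕ → ℝ := fun k => if k < K then ρ else 1
  have hr : ∀ k, 0 < r k := fun k => by by_cases h : k < K <;> simp [r, h, hρ]
  have hρr : ∀ k, ρ ≤ r k := fun k => by by_cases h : k < K <;> simp [r, h, hρ1.le]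
  let y : HilbertCube × HilbertCube → HilbertCube := fun p k => p.2 (N + k)
  have hy : Continuous y := by fun_prop
  have hfr : ∀ p k, |(f (p.1, y p) k : ℝ) - y p k| ≤ r k := fun p k => by
    by_cases h : k < K
    · simpa [r, h] using hfK (p.1, y p) k h
    · have h1 := (f (p.1, y p) k).2
      have h2 := (y p k).2
      simp only [r, h, if_false]
      rw [abs_le]
      constructor <;> linarith [h1.1, h1.2, h2.1, h2.2]
  let a : ℕ → HilbertCube × HilbertCube → ℝ := fun k p => max 0 (y p k - 2 * r k)
  let b : ℕ → HilbertCube × HilbertCube → ℝ := fun k p => min 1 (y p k + 2 * r k)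
  have hat : ∀ k p, (f (p.1, y p) k : ℝ) ∈ Icc (a k p) (b k p) := fun k p => by
    have h1 := abs_le.1 (hfr p k)
    have h2 := hr k
    exact ⟨max_le (f (p.1, y p) k).2.1 (by linarith [h1.1]),
      le_min (f (p.1, y p) k).2.2 (by linarith [h1.2])⟩
  have ha0 : ∀ k p, 0 ≤ a k p := fun k p => le_max_left _ _
  have hb1 : ∀ k p, b k p ≤ 1 := fun k p => min_le_left _ _
  have hab : ∀ k p, b k p - a k p ≤ 4 * r k := fun k p => by
    have h1 : y p k - 2 * r k ≤ a k p := le_max_right _ _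
    have h2 : b k p ≤ y p k + 2 * r k := min_le_right _ _
    linarith
  obtain ⟨κ, hκ0, hκ1, hκδ⟩ : ∃ κ : ℝ, 0 < κ ∧ κ ≤ 1 ∧ κ < δ :=
    ⟨min (δ / 2) 1, by positivity, min_le_right _ _, by linarith [min_le_left (δ / 2) 1]⟩
  let μ : ℕ → ℝ := fun k => min (η k) (r k)
  have hμ0 : ∀ k < 2 * N, 0 < μ k := fun k hk => lt_min (hη0 k hk) (hr k)
  have hμ1 : ∀ k < 2 * N, 1 ≤ 1 / μ k := fun k hk =>
    (one_le_div (hμ0 k hk)).2 ((min_le_left _ _).trans (hη1 k hk))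
  obtain ⟨Φ₂, hΦ₂, hΦ₂n, hΦ₂e⟩ := exists_block_homeomorph {k | k < N}
    (fun k p x => squeeze (1 / μ k) κ (a k p) (b k p) (f (p.1, y p) k) x)
    (fun k _ => Continuous.squeeze _ _ (by fun_prop) (by fun_prop) (by fun_prop) (by fun_prop))
    (fun k hk p q h1 h => by
      have e : y p = y q := funext fun i => h _ (by simp)
      simp only [a, b, h1, e])
    (fun k hk p => squeeze_strictMono (zero_lt_one.trans_le
      (hμ1 k (by simp only [mem_ofPred_eq] at hk; omega))) hκ0)
    (fun k hk p => squeeze_of_le hκ1 (hat k p) (ha0 k p))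
    (fun k hk p => squeeze_of_ge (hμ1 k (by simp only [mem_ofPred_eq] at hk; omega)) hκ1
      (hat k p) (hb1 k p))
  simp only [mem_ofPred_eq] at hΦ₁n hΦ₁e hΦ₂n hΦ₂e
  refine ⟨(Φ₀.trans Φ₁).trans Φ₂, fun p => ?_, fun p k hk => ?_, fun p hp => ?_⟩
  · simp only [Homeomorph.trans_apply, hΦ₀, hΦ₁, hΦ₂]
  · simp only [Homeomorph.trans_apply]
    have e0 := hΦ₀K p k (by omega)
    have e1 := hΦ₁n (Φ₀ p) k (by omega)
    have e2 : |((Φ₂ (Φ₁ (Φ₀ p))).2 k : ℝ) - (Φ₁ (Φ₀ p)).2 k| ≤ 4 * r k := by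
      rw [hΦ₂e _ k (by omega)]
      exact (abs_squeeze_sub_le (hμ1 k (by omega)) hκ0 hκ1 (hat k _)).trans (hab _ _)
    simp only [r, hk, if_true] at e2
    rw [e1] at e2
    rw [abs_le] at *
    constructor <;> linarith
  · simp only [Homeomorph.trans_apply]
    set q := Φ₁ (Φ₀ p) with hq
    have hqx : ∀ k < N, q.2 k = (Φ₀ p).2 k := fun k hk => hΦ₁n _ k (by omega)
    have hqy : ∀ k < N, |(q.2 k : ℝ) - y q k| ≤ ρ := fun k hk => by
      have h1 := hη (N + k) (by omega) p hp
      have h2 := hΦ₁e (Φ₀ p) (N + k) (by omega)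
      have h3 := (Φ₀ p).2 k |>.2
      have h4 := (Φ₀ p).2 (N + k) |>.2
      rw [squeeze_eq hρ.le hρ1.le (hη0 (N + k) (by omega))
        (one_div_mul_cancel (hη0 (N + k) (by omega)).ne') (by simp) ((Φ₀ p).2 _).2
        (by simpa using h1.1) h1.2, Nat.add_sub_cancel_left] at h2
      change |(q.2 k : ℝ) - q.2 (N + k)| ≤ ρ
      rw [hqx k hk, hq, h2, abs_le]
      constructor <;> nlinarith [h3.1, h3.2, h4.1, h4.2]
    have hmem : Φ₂ q = ((q.1, y q).1, (Φ₂ q).2) := Prod.ext (hΦ₂ q) rfl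
    rw [hmem]
    refine hN₀ (q.1, y q) _ fun k hk => ?_
    have hkN : k < N := by omega
    have h1 := hη k (by omega) p hp
    rw [← hqx k hkN] at h1
    have h2 := abs_le.1 (hqy k hkN)
    have h3 := hρr k
    have h4 : μ k ≤ η k := min_le_left _ _
    have h5 : μ k ≤ r k := min_le_right _ _
    have h6 : b k q - a k q ≤ 1 := by linarith [ha0 k q, hb1 k q]
    rw [hΦ₂e q k hkN, squeeze_eq hκ0.le hκ1 (hμ0 k (by omega))
      (one_div_mul_cancel (hμ0 k (by omega)).ne') h6 (hat k q)]
    · have h7 := (f (q.1, y q) k).2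
      have h8 := (q.2 k).2
      rw [abs_lt]
      constructor <;> nlinarith [h7.1, h7.2, h8.1, h8.2]
    · rw [← le_sub_iff_add_le]
      exact max_le (by linarith) (by linarith [h2.1])
    · rw [le_sub_iff_add_le]
      exact le_min (by linarith) (by linarith [h2.2])

theorem FiberedZSet.image_homeomorph {X Y : Type*} [TopologicalSpace X] [TopologicalSpace Y]
    {p : X → Y} {Z : Set X} (hZ : FiberedZSet p Z) (Φ : X ≃ₜ X) (hΦ : ∀ x, p (Φ x) = p x) :
    FiberedZSet p (Φ '' Z) := by
  refine ⟨Φ.isClosedMap _ hZ.1, fun 𝒰 h𝒰 => ?_⟩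
  obtain ⟨hc, ho, hu⟩ := h𝒰
  obtain ⟨f, hf, hfZ, hfp, hfU⟩ := hZ.2 ((fun U => Φ ⁻¹' U) '' 𝒰) ⟨hc.image _, by
    rintro _ ⟨U, hU, rfl⟩
    obtain ⟨φ, hφ, rfl⟩ := ho U hU
    exact ⟨φ ∘ Φ, hφ.comp Φ.continuous, rfl⟩, by
    refine eq_univ_of_forall fun x => ?_
    obtain ⟨U, hU, hx⟩ := (eq_univ_iff_forall.1 hu) (Φ x)
    exact ⟨_, mem_image_of_mem _ hU, hx⟩⟩
  have hΦ' : ∀ x, p (Φ.symm x) = p x := fun x => by rw [← hΦ, Φ.apply_symm_apply]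
  refine ⟨Φ ∘ f ∘ Φ.symm, Φ.continuous.comp (hf.comp Φ.symm.continuous), ?_, fun x => ?_,
    fun x => ?_⟩
  · rw [range_comp, Φ.symm.surjective.range_comp, ← Φ.image_closure,
      ← image_inter Φ.injective, hfZ, image_empty]
  · simp only [Function.comp_apply, hΦ, hfp, hΦ']
  · obtain ⟨_, ⟨U, hU, rfl⟩, h1, h2⟩ := hfU (Φ.symm x)
    exact ⟨U, hU, h1, by simpa using h2⟩

theorem tendsto_id_of_coordinates
    {F : ℕ → C(HilbertCube × HilbertCube, HilbertCube × HilbertCube)}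
    (hF : ∀ m p, (F m p).1 = p.1)
    (hF' : ∀ m p, ∀ k < m, |((F m p).2 k : ℝ) - p.2 k| ≤ 1 / ((m : ℝ) + 1)) :
    Filter.Tendsto F Filter.atTop (𝓝 (ContinuousMap.id _)) := by
  rw [ContinuousMap.tendsto_iff_tendstoUniformly, tendstoUniformly_iff_tendsto, uniformity_prod,
    Filter.tendsto_inf, Filter.tendsto_comap_iff, Filter.tendsto_comap_iff]
  constructor
  · refine Filter.tendsto_def.2 fun s hs => Filter.mem_of_superset Filter.univ_mem fun q _ => ?_
    simp only [mem_preimage, Function.comp_apply, hF]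
    exact refl_mem_uniformity hs
  · rw [Pi.uniformity, Filter.tendsto_iInf]
    intro k
    rw [Filter.tendsto_comap_iff, Metric.uniformity_basis_dist.tendsto_right_iff]
    intro ε hε
    have h1 : ∀ᶠ m : ℕ in Filter.atTop, 1 / ((m : ℝ) + 1) < ε :=
      tendsto_one_div_add_atTop_nhds_zero_nat.eventually_lt_const hε
    filter_upwards [(h1.and (Filter.eventually_gt_atTop k)).prod_inl ⊤] with q hq
    simp only [Function.comp_apply]
    rw [dist_comm, Subtype.dist_eq, Real.dist_eq]
    exact (hF' _ _ k hq.2).trans_lt hq.1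

/-- A fibered `Z`-set can be moved off all endfaces. -/
theorem FiberedZSet.exists_homeomorph_pseudoInterior {Z : Set (HilbertCube × HilbertCube)}
    (hZ : FiberedZSet Prod.fst Z) :
    ∃ Φ : (HilbertCube × HilbertCube) ≃ₜ (HilbertCube × HilbertCube),
      (∀ p, (Φ p).1 = p.1) ∧ ∀ p ∈ Z, ∀ k, (Φ p).2 k ∈ Ioo 0 1 := by
  let X := HilbertCube × HilbertCube
  let G : Set (C(X, X) × C(X, X)) :=
    {g | g.1.comp g.2 = .id X ∧ g.2.comp g.1 = .id X ∧ ∀ p, (g.1 p).1 = p.1}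
  have hG : IsClosed G := by
    refine (isClosed_eq ?_ continuous_const).inter ((isClosed_eq ?_ continuous_const).inter ?_)
    · exact continuous_fst.compCM continuous_snd
    · exact continuous_snd.compCM continuous_fst
    · have : {g : C(X, X) × C(X, X) | ∀ p, (g.1 p).1 = p.1} = ⋂ p, {g | (g.1 p).1 = p.1} := by
        ext g
        simp
      change IsClosed {g : C(X, X) × C(X, X) | ∀ p, (g.1 p).1 = p.1}
      rw [this]
      refine isClosed_iInter fun p => isClosed_eq (Continuous.fst ?_) continuous_const
      exact (ContinuousEvalConst.continuous_eval_const p).comp continuous_fst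
  have : BaireSpace G := by
    let := UniformSpace.metricSpace C(X, X)
    have := hG.isCompletelyMetrizableSpace
    infer_instance
  let E : ℕ → Set X := fun n => {p | p.2 n = 0 ∨ p.2 n = 1}
  have hE : ∀ n, IsClosed (E n) := fun n => by
    have hn : Continuous fun p : HilbertCube × HilbertCube => p.2 n := by fun_prop
    exact (isClosed_eq hn continuous_const).union (isClosed_eq hn continuous_const)
  let O : ℕ → Set G := fun n => {g | MapsTo g.1.1 Z (E n)ᶜ}
  have hO : ∀ n, IsOpen (O n) := fun n =>
    (ContinuousMap.isOpen_setOfPred_mapsTo hZ.1.isCompact (hE n).isOpen_compl).preimage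
      (continuous_fst.comp continuous_subtype_val)
  have hd : ∀ n, Dense (O n) := by
    rintro n ⟨⟨f, g⟩, h1, h2, h3⟩
    have h1' : ∀ p, f (g p) = p := fun p => DFunLike.congr_fun h1 p
    have h2' : ∀ p, g (f p) = p := fun p => DFunLike.congr_fun h2 p
    let Φ : X ≃ₜ X := ⟨⟨f, g, h2', h1'⟩, f.continuous, g.continuous⟩
    have hΦ := hZ.image_homeomorph Φ h3
    choose Ψ hΨ hΨm hΨn using fun m : ℕ =>
      hΦ.exists_homeomorph_endface n m (ε := 1 / ((m : ℝ) + 1)) Nat.one_div_pos_of_nat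
    have hΨ' : ∀ m p, ((Ψ m).symm p).1 = p.1 := fun m p => by
      rw [← hΨ m, Homeomorph.apply_symm_apply]
    have hΨm' : ∀ m p, ∀ k < m, |(((Ψ m).symm p).2 k : ℝ) - p.2 k| ≤ 1 / ((m : ℝ) + 1) :=
      fun m p k hk => by
        have := hΨm m ((Ψ m).symm p) k hk
        rwa [Homeomorph.apply_symm_apply, abs_sub_comm] at this
    have t1 := tendsto_id_of_coordinates (F := fun m => (Ψ m : C(X, X))) hΨ hΨm
    have t2 := tendsto_id_of_coordinates (F := fun m => ((Ψ m).symm : C(X, X))) hΨ' hΨm'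
    let s : ℕ → G := fun m => ⟨(((Ψ m).symm : C(X, X)).comp f, g.comp (Ψ m : C(X, X))), by
      refine ⟨?_, ?_, fun p => ?_⟩
      · ext1 p; simp [h1']
      · ext1 p; simp [h2']
      · simp [hΨ', h3]⟩
    refine mem_closure_of_tendsto (f := s) (b := Filter.atTop) ?_ (Filter.Eventually.of_forall ?_)
    · rw [tendsto_subtype_rng]
      exact (t2.compCM tendsto_const_nhds).prodMk_nhds (tendsto_const_nhds.compCM t1)
    · intro m p hp h
      refine hΨn m ((Ψ m).symm (f p)) h ?_
      rw [Homeomorph.apply_symm_apply]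
      exact ⟨p, hp, rfl⟩
  have hne : Nonempty G := ⟨⟨(.id X, .id X), by ext1; rfl, by ext1; rfl, fun _ => rfl⟩⟩
  obtain ⟨⟨⟨f, g⟩, h1, h2, h3⟩, hg⟩ := (dense_iInter_of_isOpen hO hd).nonempty
  refine ⟨⟨⟨f, g, fun p => DFunLike.congr_fun h2 p, fun p => DFunLike.congr_fun h1 p⟩,
    f.continuous, g.continuous⟩, h3, fun p hp k => ?_⟩
  have := mem_iInter.1 hg k hp
  change ¬ ((f p).2 k = 0 ∨ (f p).2 k = 1) at this
  push Not at this
  exact ⟨unitInterval.pos_iff_ne_zero.2 this.1, unitInterval.lt_one_iff_ne_one.2 this.2⟩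

/-- An increasing homeomorphism of `[0, 1]` taking `g` to `1 / 2`. -/
noncomputable def recenter (g x : ℝ) : ℝ :=
  min x g / (2 * g) + max (x - g) 0 / (2 * (1 - g))

theorem recenter_strictMono {g : ℝ} (hg : g ∈ Ioo (0 : ℝ) 1) : StrictMono (recenter g) := by
  intro x y hxy
  have h1 : 0 < 2 * g := by linarith [hg.1]
  have h2 : 0 < 2 * (1 - g) := by linarith [hg.2]
  unfold recenter
  rcases lt_or_ge x g with h | h
  · have h3 : min x g < min y g := by grind
    have h4 : max (x - g) 0 ≤ max (y - g) 0 := by grind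
    exact add_lt_add_of_lt_of_le (by gcongr) (by gcongr)
  · have h3 : min x g ≤ min y g := by grind
    have h4 : max (x - g) 0 < max (y - g) 0 := by grind
    exact add_lt_add_of_le_of_lt (by gcongr) (by gcongr)

theorem recenter_zero {g : ℝ} (hg : g ∈ Ioo (0 : ℝ) 1) : recenter g 0 = 0 := by
  simp [recenter, hg.1.le]

theorem recenter_one {g : ℝ} (hg : g ∈ Ioo (0 : ℝ) 1) : recenter g 1 = 1 := by
  have h1 : g ≠ 0 := hg.1.ne'
  have h2 : 1 - g ≠ 0 := by linarith [hg.2]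
  rw [recenter, min_eq_right hg.2.le, max_eq_left (by linarith [hg.2])]
  field_simp
  norm_num

theorem recenter_self {g : ℝ} (hg : g ∈ Ioo (0 : ℝ) 1) : recenter g g = 1 / 2 := by
  have h1 : g ≠ 0 := hg.1.ne'
  simp only [recenter, min_self, sub_self, max_self, zero_div, add_zero]
  field_simp

/-- The midpoint of the unit interval. -/
noncomputable def unitHalf : unitInterval := ⟨1 / 2, by norm_num, by norm_num⟩

/-- Replace the even coordinates of the second component by `1 / 2`. -/
noncomputable def flattenEven (p : HilbertCube × HilbertCube) : HilbertCube × HilbertCube :=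
  (p.1, fun k => if Even k then unitHalf else p.2 k)

theorem continuous_flattenEven : Continuous flattenEven := by
  refine continuous_fst.prodMk (continuous_pi fun k => ?_)
  by_cases h : Even k <;> simp only [h, if_true, if_false] <;> fun_prop

/-- **Klee's trick**: a compact set that is a graph of a function of the odd coordinates with
values in the pseudo-interior can be flattened. -/
theorem exists_homeomorph_eq_flattenEven {C : Type*} [TopologicalSpace C] [CompactSpace C]
    {u : C → HilbertCube × HilbertCube} (hu : Continuous u)
    (hinj : Function.Injective (flattenEven ∘ u))
    (hI : ∀ c k, Even k → (u c).2 k ∈ Ioo 0 1) :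
    ∃ Φ : (HilbertCube × HilbertCube) ≃ₜ (HilbertCube × HilbertCube),
      (∀ p, (Φ p).1 = p.1) ∧ ∀ c, Φ (u c) = flattenEven (u c) := by
  have he : IsClosedEmbedding (flattenEven ∘ u) :=
    (continuous_flattenEven.comp hu).isClosedEmbedding hinj
  have hg : ∀ k, Even k → ∃ g : C(HilbertCube × HilbertCube, ℝ),
      (∀ p, g p ∈ Ioo (0 : ℝ) 1) ∧ ∀ c, g (flattenEven (u c)) = (u c).2 k := fun k hk => by
    obtain ⟨g, h1, h2⟩ := ContinuousMap.exists_extension_forall_mem_of_isClosedEmbedding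
      ⟨fun c => ((u c).2 k : ℝ), by fun_prop⟩ (t := Ioo (0 : ℝ) 1) (fun c => hI c k hk)
      ⟨1 / 2, by norm_num, by norm_num⟩ he
    exact ⟨g, h1, fun c => congrFun h2 c⟩
  choose! g hg hgu using hg
  obtain ⟨Φ, h1, h2, h3⟩ := exists_block_homeomorph {k | Even k}
    (fun k p x => recenter (g k (flattenEven p)) x)
    (fun k hk => by
      have hc : Continuous fun p : (HilbertCube × HilbertCube) × ℝ => g k (flattenEven p.1) :=
        (g k).continuous.comp (continuous_flattenEven.comp continuous_fst)
      refine ((continuous_snd.min hc).div (continuous_const.mul hc) fun p => ?_).add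
        (((continuous_snd.sub hc).max continuous_const).div
          (continuous_const.mul (continuous_const.sub hc)) fun p => ?_)
      · exact mul_ne_zero two_ne_zero (hg k hk _).1.ne'
      · exact mul_ne_zero two_ne_zero (sub_ne_zero.2 (hg k hk _).2.ne'))
    (fun k _ p q h h' => by
      have : flattenEven p = flattenEven q := by
        refine Prod.ext h (funext fun j => ?_)
        by_cases hj : Even j
        · simp [flattenEven, hj]
        · simpa [flattenEven, hj] using h' j hj
      rw [this])
    (fun k hk p => recenter_strictMono (hg k hk _)) (fun k hk p => recenter_zero (hg k hk _))
    (fun k hk p => recenter_one (hg k hk _))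
  refine ⟨Φ, h1, fun c => Prod.ext (h1 _) (funext fun k => ?_)⟩
  by_cases hk : Even k
  · ext
    rw [h3 _ k hk, hgu k hk, recenter_self (hI c k hk)]
    simp [flattenEven, hk, unitHalf]
  · rw [h2 _ k hk]
    simp [flattenEven, hk]

/-- A fibered `Z`-set can be moved to a set of infinite deficiency. -/
theorem FiberedZSet.exists_homeomorph_deficient {Z : Set (HilbertCube × HilbertCube)}
    (hZ : FiberedZSet Prod.fst Z) :
    ∃ Φ : (HilbertCube × HilbertCube) ≃ₜ (HilbertCube × HilbertCube),
      (∀ p, (Φ p).1 = p.1) ∧ ∀ p ∈ Z, (∀ k, Even k → (Φ p).2 k = unitHalf) ∧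
        ∀ k, ¬ Even k → (Φ p).2 k ∈ Ioo 0 1 := by
  obtain ⟨Φ₀, hΦ₀, hΦ₀Z⟩ := hZ.exists_homeomorph_pseudoInterior
  have hη : ∀ k, ∃ η : ℝ, 0 < η ∧ η ≤ 1 ∧ ∀ p ∈ Z,
      η ≤ (Φ₀ p).2 k ∧ ((Φ₀ p).2 k : ℝ) ≤ 1 - η := fun k => by
    obtain ⟨η, h1, h2, h3⟩ := (hZ.1.isCompact.image Φ₀.continuous).exists_margin (k := k)
      (by rintro _ ⟨p, hp, rfl⟩; exact hΦ₀Z p hp k)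
    exact ⟨η, h1, h2, fun p hp => h3 _ ⟨p, hp, rfl⟩⟩
  choose η hη0 hη1 hη using hη
  let κ : ℕ → ℝ := fun l => 1 / ((l : ℝ) + 1)
  have hκ0 : ∀ l, 0 < κ l := fun l => Nat.one_div_pos_of_nat
  have hκ1 : ∀ l, κ l ≤ 1 := fun l => by
    simpa [κ] using Nat.one_div_le_one_div (α := ℝ) (Nat.zero_le l)
  -- an odd coordinate `2 * Nat.pair k l + 1` is made close to the coordinate `2 * k`
  obtain ⟨Φ₁, hΦ₁, hΦ₁n, hΦ₁e⟩ := exists_block_homeomorph {k | ¬ Even k}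
    (fun k p x => squeeze (1 / η k) (κ (k / 2).unpair.2) 0 1 (p.2 (2 * (k / 2).unpair.1)) x)
    (fun k _ => Continuous.squeeze _ _ continuous_const continuous_const (by fun_prop)
      (by fun_prop))
    (fun k _ p q _ h => by rw [h (2 * (k / 2).unpair.1) (by simp)])
    (fun k _ p => squeeze_strictMono (one_div_pos.2 (hη0 k)) (hκ0 _))
    (fun k _ p => squeeze_of_le (hκ1 _) (p.2 _).2 le_rfl)
    (fun k _ p => squeeze_of_ge ((one_le_div (hη0 k)).2 (hη1 k)) (hκ1 _) (p.2 _).2 le_rfl)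
  simp only [mem_ofPred_eq, not_not] at hΦ₁n hΦ₁e
  have hval : ∀ p ∈ Z, ∀ k, ¬ Even k → ((Φ₁ (Φ₀ p)).2 k : ℝ) =
      (Φ₀ p).2 (2 * (k / 2).unpair.1) + κ (k / 2).unpair.2 *
        ((Φ₀ p).2 k - (Φ₀ p).2 (2 * (k / 2).unpair.1)) := fun p hp k hk => by
    rw [hΦ₁e _ k hk, squeeze_eq (hκ0 _).le (hκ1 _) (hη0 k) (one_div_mul_cancel (hη0 k).ne')
      (by simp) ((Φ₀ p).2 _).2 (by simpa using (hη k p hp).1) (hη k p hp).2]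
  have hlim : ∀ p ∈ Z, ∀ k, Filter.Tendsto
      (fun l => ((Φ₁ (Φ₀ p)).2 (2 * Nat.pair k l + 1) : ℝ)) Filter.atTop
      (𝓝 ((Φ₀ p).2 (2 * k))) := fun p hp k => by
    have h0 : Filter.Tendsto (fun l => ((Φ₁ (Φ₀ p)).2 (2 * Nat.pair k l + 1) : ℝ) -
        (Φ₀ p).2 (2 * k)) Filter.atTop (𝓝 0) := by
      refine squeeze_zero_norm (a := κ) (fun l => ?_) tendsto_one_div_add_atTop_nhds_zero_nat
      have e : (2 * Nat.pair k l + 1) / 2 = Nat.pair k l := by omega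
      rw [hval p hp _ (by simp), e, Nat.unpair_pair, Real.norm_eq_abs, add_sub_cancel_left,
        abs_mul, abs_of_pos (hκ0 l)]
      refine mul_le_of_le_one_right (hκ0 l).le ?_
      have h1 := ((Φ₀ p).2 (2 * Nat.pair k l + 1)).2
      have h2 := ((Φ₀ p).2 (2 * k)).2
      rw [abs_le]
      constructor <;> linarith [h1.1, h1.2, h2.1, h2.2]
    simpa using h0.add_const ((Φ₀ p).2 (2 * k) : ℝ)
  have : CompactSpace Z := isCompact_iff_compactSpace.1 hZ.1.isCompact
  obtain ⟨Φ₂, hΦ₂, hΦ₂e⟩ := exists_homeomorph_eq_flattenEven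
    (u := fun z : Z => Φ₁ (Φ₀ z)) (by fun_prop)
    (fun z w hzw => by
      have e1 : (Φ₁ (Φ₀ z)).1 = (Φ₁ (Φ₀ w)).1 := (congrArg Prod.fst hzw : _)
      have e2 : ∀ k, ¬ Even k → (Φ₁ (Φ₀ z)).2 k = (Φ₁ (Φ₀ w)).2 k := fun k hk => by
        simpa [flattenEven, hk] using congrFun (congrArg Prod.snd hzw) k
      refine Subtype.ext (Φ₀.injective (Φ₁.injective (Prod.ext e1 (funext fun k => ?_))))
      by_cases hk : Even k
      · obtain ⟨j, rfl⟩ := even_iff_exists_two_mul.1 hk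
        rw [hΦ₁n _ _ hk, hΦ₁n _ _ hk]
        have h1 := hlim z z.2 j
        simp only [fun l => e2 (2 * Nat.pair j l + 1) (by simp)] at h1
        exact Subtype.ext (tendsto_nhds_unique h1 (hlim w w.2 j))
      · exact e2 k hk)
    (fun z k hk => by rw [hΦ₁n _ k hk]; exact hΦ₀Z z z.2 k)
  refine ⟨(Φ₀.trans Φ₁).trans Φ₂, fun p => by simp only [Homeomorph.trans_apply, hΦ₀, hΦ₁, hΦ₂],
    fun p hp => ?_⟩
  have e := hΦ₂e ⟨p, hp⟩
  simp only at e
  simp only [Homeomorph.trans_apply, e]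
  refine ⟨fun k hk => by simp [flattenEven, hk], fun k hk => ?_⟩
  simp only [flattenEven, hk, if_false]
  rw [mem_Ioo, ← Subtype.coe_lt_coe, ← Subtype.coe_lt_coe, hval p hp k hk]
  have h1 := hΦ₀Z p hp k
  have h2 := hΦ₀Z p hp (2 * (k / 2).unpair.1)
  have h3 := hκ0 (k / 2).unpair.2
  have h4 := hκ1 (k / 2).unpair.2
  rw [mem_Ioo, ← Subtype.coe_lt_coe, ← Subtype.coe_lt_coe] at h1 h2
  push_cast at h1 h2 ⊢
  constructor <;> nlinarith

/-- The exchange of the coordinates `2 * k` and `2 * k + 1` of the second component. -/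
theorem exists_swap_homeomorph :
    ∃ σ : (HilbertCube × HilbertCube) ≃ₜ (HilbertCube × HilbertCube),
      (∀ p, (σ p).1 = p.1) ∧ (∀ p, σ (σ p) = p) ∧ ∃ s : ℕ → ℕ,
      (∀ k, s (s k) = k) ∧ (∀ k, Even (s k) ↔ ¬ Even k) ∧ ∀ p k, (σ p).2 k = p.2 (s k) := by
  let s : ℕ → ℕ := fun k => if Even k then k + 1 else k - 1
  have hs : ∀ k, s (s k) = k := fun k => by
    simp only [s]; grind
  have hse : ∀ k, Even (s k) ↔ ¬ Even k := fun k => by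
    simp only [s]; grind
  let f : HilbertCube × HilbertCube → HilbertCube × HilbertCube := fun p => (p.1, fun k => p.2 (s k))
  have hf : Continuous f := by fun_prop
  have hff : ∀ p, f (f p) = p := fun p => Prod.ext rfl (funext fun k => congrArg p.2 (hs k))
  exact ⟨⟨⟨f, f, hff, hff⟩, hf, hf⟩, fun _ => rfl, hff, s, hs, hse, fun _ _ => rfl⟩

/-- Fibered `Z`-set unknotting in the Hilbert cube product `I^ω × I^ω` over the first projection. -/
theorem fibered_Z_set_unknotting_I_omega
    (Z F : Set ((ℕ → unitInterval) × (ℕ → unitInterval)))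
    (hZ : FiberedZSet Prod.fst Z) (hF : FiberedZSet Prod.fst F)
    (h : ↥Z ≃ₜ ↥F)
    (hfib : ∀ z : Z, ((h z : (ℕ → unitInterval) × (ℕ → unitInterval))).1 = (z : (ℕ → unitInterval) × (ℕ → unitInterval)).1) :
    ∃ H : ((ℕ → unitInterval) × (ℕ → unitInterval)) ≃ₜ ((ℕ → unitInterval) × (ℕ → unitInterval)),
      (∀ z : Z, H (z : (ℕ → unitInterval) × (ℕ → unitInterval)) = (h z : (ℕ → unitInterval) × (ℕ → unitInterval))) ∧
      ∀ x, (H x).1 = x.1 := by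
  obtain ⟨Φ, hΦ, hΦZ⟩ := hZ.exists_homeomorph_deficient
  obtain ⟨Ψ, hΨ, hΨF⟩ := hF.exists_homeomorph_deficient
  obtain ⟨σ, hσ, hσσ, s, hs, hse, hσs⟩ := exists_swap_homeomorph
  have : CompactSpace Z := isCompact_iff_compactSpace.1 hZ.1.isCompact
  -- `m` is the graph of the transported homeomorphism
  let m : Z → HilbertCube × HilbertCube := fun z =>
    ((z : HilbertCube × HilbertCube).1, fun k =>
      if Even k then (Ψ (h z)).2 (s k) else (Φ z).2 k)
  have hm : Continuous m := by
    refine (by fun_prop : Continuous fun z : Z => (z : HilbertCube × HilbertCube).1).prodMk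
      (continuous_pi fun k => ?_)
    by_cases hk : Even k <;> simp only [hk, if_true, if_false] <;> fun_prop
  have hm1 : ∀ z, flattenEven (m z) = Φ z := fun z => by
    refine Prod.ext (hΦ z).symm (funext fun k => ?_)
    by_cases hk : Even k
    · simp [flattenEven, hk, (hΦZ z z.2).1 k hk]
    · simp [flattenEven, hk, m]
  have hm2 : ∀ z, flattenEven (σ (m z)) = Ψ (h z) := fun z => by
    refine Prod.ext ?_ (funext fun k => ?_)
    · rw [hΨ, hfib]; exact hσ _
    by_cases hk : Even k
    · simp [flattenEven, hk, (hΨF (h z) (h z).2).1 k hk]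
    · simp [flattenEven, hk, hσs, m, hse, hs]
  obtain ⟨Θ₁, hΘ₁, hΘ₁m⟩ := exists_homeomorph_eq_flattenEven hm
    (fun z w hzw => by
      simp only [Function.comp_apply, hm1] at hzw
      exact Subtype.ext (Φ.injective hzw))
    (fun z k hk => by
      simp only [m, hk, if_true]
      exact (hΨF (h z) (h z).2).2 _ (by simpa [hse] using hk))
  obtain ⟨Θ₂, hΘ₂, hΘ₂m⟩ := exists_homeomorph_eq_flattenEven (σ.continuous.comp hm)
    (fun z w hzw => by
      simp only [Function.comp_apply, hm2] at hzw
      exact h.injective (Subtype.ext (Ψ.injective hzw)))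
    (fun z k hk => by
      have hk' : ¬ Even (s k) := by simpa [hse] using hk
      simp only [Function.comp_apply, hσs, m, hk', if_false]
      exact (hΦZ z z.2).2 _ hk')
  have symm_fst : ∀ (T : (HilbertCube × HilbertCube) ≃ₜ (HilbertCube × HilbertCube)),
      (∀ p, (T p).1 = p.1) → ∀ p, (T.symm p).1 = p.1 := fun T hT p => by
    rw [← hT, T.apply_symm_apply]
  refine ⟨(((Φ.trans Θ₁.symm).trans σ).trans Θ₂).trans Ψ.symm, fun z => ?_, fun p => ?_⟩
  · have e1 : Θ₁.symm (Φ z) = m z := by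
      rw [Homeomorph.symm_apply_eq, hΘ₁m, hm1]
    have e2 : Θ₂ (σ (m z)) = Ψ (h z) := (hΘ₂m z).trans (hm2 z)
    simp only [Homeomorph.trans_apply, e1, e2, Homeomorph.symm_apply_apply]
  · simp only [Homeomorph.trans_apply, symm_fst Ψ hΨ, hΘ₂, hσ, symm_fst Θ₁ hΘ₁, hΦ]
end

section
/- Let 𝒮 = {Xₙ, pₙ⁺¹ₙ, ω} be an inverse sequence consisting of Polish spaces Xₙ and soft continuous bonding maps pₙ⁺¹ₙ : Xₙ₊₁ → Xₙ, let X = lim 𝒮 be its inverse limit with limit projections pₙ : X → Xₙ, and let Z be a closed subset of X. Suppose that for each n ∈ ω there exists a continuous section sₙⁿ⁺¹ : Xₙ → Xₙ₊₁ of the projection pₙⁿ⁺¹ (i.e. pₙⁿ⁺¹ ∘ sₙⁿ⁺¹ = id) such that sₙⁿ⁺¹(Xₙ) ∩ pₙ₊₁(Z) = ∅. Then Z is a fibered Z-set in X with respect to the limit projection p₀ : X → X₀. -/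
open Set Topology

universe u

/-- A continuous surjection of Polish spaces is soft if maps into the target defined
on a Polish space lift, extending any given partial lift defined on a closed subset. -/
def SoftMap {X Y : Type u} [TopologicalSpace X] [TopologicalSpace Y] (f : X → Y) : Prop :=
  Continuous f ∧ Function.Surjective f ∧
  ∀ (B : Type u) (_ : TopologicalSpace B) (_ : PolishSpace B) (A : Set B), IsClosed A →
    ∀ (g : ↥A → X) (h : B → Y), Continuous g → Continuous h →
      (∀ a : ↥A, f (g a) = h (a : B)) →
      ∃ k : B → X, Continuous k ∧ (∀ a : ↥A, k (a : B) = g a) ∧ ∀ b, f (k b) = h b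

/-- The limit of an inverse sequence, as a subspace of the product. -/
abbrev SeqLimit {X : ℕ → Type u} (p : ∀ n, X (n + 1) → X n) : Type u :=
  {x : ∀ n, X n // ∀ n, p n (x (n + 1)) = x n}

section SeqLimit

variable {X : ℕ → Type u} [∀ n, TopologicalSpace (X n)] {p : ∀ n, X (n + 1) → X n}

theorem SeqLimit.continuous_proj (n : ℕ) : Continuous fun x : SeqLimit p => x.1 n :=
  (continuous_apply n).comp continuous_subtype_val

theorem SeqLimit.polishSpace [∀ n, PolishSpace (X n)] (hp : ∀ n, Continuous (p n)) :
    PolishSpace (SeqLimit p) := by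
  have h : IsClosed {x : ∀ n, X n | ∀ n, p n (x (n + 1)) = x n} := by
    simp only [ofPred_forall]
    exact isClosed_iInter fun n =>
      isClosed_eq ((hp n).comp (continuous_apply _)) (continuous_apply _)
  exact h.polishSpace

theorem SeqLimit.exists_isOpen_proj_of_le (hp : ∀ n, Continuous (p n)) {m n : ℕ} (hmn : m ≤ n)
    {V : Set (X m)} (hV : IsOpen V) :
    ∃ V' : Set (X n), IsOpen V' ∧ ∀ x : SeqLimit p, x.1 n ∈ V' ↔ x.1 m ∈ V := by
  induction n, hmn using Nat.le_induction with
  | base => exact ⟨V, hV, fun _ => Iff.rfl⟩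
  | succ n _ ih =>
    obtain ⟨V', hV', h⟩ := ih
    refine ⟨p n ⁻¹' V', hV'.preimage (hp n), fun x => ?_⟩
    rw [mem_preimage, x.2 n, h]

/-- Preimages of open sets under the limit projections form a base of the limit. -/
theorem SeqLimit.exists_proj_mem_subset (hp : ∀ n, Continuous (p n)) {U : Set (SeqLimit p)}
    (hU : IsOpen U) {x : SeqLimit p} (hx : x ∈ U) :
    ∃ n, ∃ V : Set (X n), IsOpen V ∧ x.1 n ∈ V ∧ ∀ y : SeqLimit p, y.1 n ∈ V → y ∈ U := by
  obtain ⟨O, hO, rfl⟩ := isOpen_induced_iff.1 hU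
  obtain ⟨I, u, hu, hIu⟩ := isOpen_pi_iff.1 hO x.1 hx
  have key : ∀ i : I, ∃ V : Set (X (I.sup id)), IsOpen V ∧
      ∀ y : SeqLimit p, y.1 (I.sup id) ∈ V ↔ y.1 i ∈ u i := fun i =>
    exists_isOpen_proj_of_le hp (Finset.le_sup (f := id) i.2) (hu i i.2).1
  choose V hV hVu using key
  refine ⟨I.sup id, ⋂ i, V i, isOpen_iInter_of_finite hV, ?_, fun y hy => hIu ?_⟩
  · exact mem_iInter.2 fun i => (hVu i x).2 (hu i i.2).2
  · exact fun i hi => (hVu ⟨i, hi⟩ y).1 (mem_iInter.1 hy _)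

end SeqLimit

theorem IsOpen.exists_continuous_pos_iff_mem {Y : Type*} [TopologicalSpace Y]
    [TopologicalSpace.MetrizableSpace Y] {W : Set Y} (hW : IsOpen W) :
    ∃ φ : Y → ℝ, Continuous φ ∧ ∀ y, 0 < φ y ↔ y ∈ W := by
  let _ := TopologicalSpace.metrizableSpaceMetric Y
  rcases Wᶜ.eq_empty_or_nonempty with h | h
  · exact ⟨fun _ => 1, continuous_const, fun y => by simp [compl_empty_iff.1 h]⟩
  · refine ⟨fun y => Metric.infDist y Wᶜ, Metric.continuous_infDist_pt _, fun y => ?_⟩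
    rw [← hW.isClosed_compl.notMem_iff_infDist_pos h, notMem_compl_iff]

/-- A continuous map into the base of a soft map lifts with prescribed values on two disjoint
closed sets. -/
theorem SoftMap.exists_lift_of_disjoint {X Y B : Type u} [TopologicalSpace X]
    [TopologicalSpace Y] [TopologicalSpace B] [PolishSpace B] {q : X → Y} (hq : SoftMap q)
    {A C : Set B} (hA : IsClosed A) (hC : IsClosed C) (hAC : Disjoint A C)
    {g : B → Y} (hg : Continuous g) {a c : B → X} (ha : Continuous a) (hc : Continuous c)
    (hqa : ∀ b ∈ A, q (a b) = g b) (hqc : ∀ b ∈ C, q (c b) = g b) :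
    ∃ k : B → X, Continuous k ∧ (∀ b, q (k b) = g b) ∧ EqOn k a A ∧ EqOn k c C := by
  classical
  have hCA : EqOn (A.piecewise a c) c C := fun b hb =>
    A.piecewise_eq_of_notMem _ _ (hAC.notMem_of_mem_right hb)
  have hAA : EqOn (A.piecewise a c) a A := A.piecewise_eqOn a c
  have hcont : ContinuousOn (A.piecewise a c) (A ∪ C) :=
    (ha.continuousOn.congr hAA).union_of_isClosed (hc.continuousOn.congr hCA) hA hC
  obtain ⟨k, hk, hkAC, hqk⟩ := hq.2.2 B _ inferInstance (A ∪ C) (hA.union hC)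
    ((A ∪ C).domRestrict (A.piecewise a c)) g hcont.domRestrict hg (by
      rintro ⟨b, hb | hb⟩
      · exact (congrArg q (hAA hb)).trans (hqa b hb)
      · exact (congrArg q (hCA hb)).trans (hqc b hb))
  exact ⟨k, hk, hqk, fun b hb => (hkAC ⟨b, .inl hb⟩).trans (hAA hb),
    fun b hb => (hkAC ⟨b, .inr hb⟩).trans (hCA hb)⟩

theorem FunctionallyOpen.isOpen {X : Type*} [TopologicalSpace X] {U : Set X}
    (hU : FunctionallyOpen U) : IsOpen U := by
  obtain ⟨φ, hφ, rfl⟩ := hU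
  exact isOpen_compl_singleton.preimage hφ

/-- A cover of the limit by open sets is controlled by a monotone sequence of functions on the
terms of the sequence. -/
theorem SeqLimit.exists_control {X : ℕ → Type u} [∀ n, TopologicalSpace (X n)]
    [∀ n, PolishSpace (X n)] {p : ∀ n, X (n + 1) → X n} (hp : ∀ n, Continuous (p n))
    {𝒰 : Set (Set (SeqLimit p))} (hopen : ∀ U ∈ 𝒰, IsOpen U) (hcover : ⋃₀ 𝒰 = univ) :
    ∃ ψ : ∀ n, X n → ℝ, (∀ n, Continuous (ψ n)) ∧ (∀ n y, ψ n (p n y) ≤ ψ (n + 1) y) ∧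
      (∀ x : SeqLimit p, ∃ n, 0 < ψ n (x.1 n)) ∧
      ∀ n, ∀ x y : SeqLimit p, x.1 n = y.1 n → 0 < ψ n (y.1 n) →
        ∃ U ∈ 𝒰, x ∈ U ∧ y ∈ U := by
  let W : ∀ n, Set (X n) := fun n =>
    ⋃₀ {V | IsOpen V ∧ ∃ U ∈ 𝒰, ∀ x : SeqLimit p, x.1 n ∈ V → x ∈ U}
  have hW : ∀ n, IsOpen (W n) := fun n => isOpen_sUnion fun V hV => hV.1
  choose φ hφ hφW using fun n => (hW n).exists_continuous_pos_iff_mem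
  let ψ : ∀ n, X n → ℝ := fun n =>
    Nat.rec (motive := fun n => X n → ℝ) (φ 0) (fun n r y => max (r (p n y)) (φ (n + 1) y)) n
  have hφψ : ∀ n y, φ n y ≤ ψ n y := by
    rintro (_ | n) y
    · exact le_rfl
    · exact le_max_right _ _
  refine ⟨ψ, fun n => ?_, fun n y => le_max_left _ _, fun x => ?_, fun n x y hxy hpos => ?_⟩
  · induction n with
    | zero => exact hφ 0
    | succ n ih => exact (ih.comp (hp n)).max (hφ (n + 1))
  · obtain ⟨U, hU, hxU⟩ := mem_sUnion.1 (hcover ▸ mem_univ x)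
    obtain ⟨n, V, hV, hxV, hVU⟩ := exists_proj_mem_subset hp (hopen U hU) hxU
    exact ⟨n, ((hφW n _).2 ⟨V, ⟨hV, U, hU, hVU⟩, hxV⟩).trans_le (hφψ n _)⟩
  · induction n with
    | zero =>
      obtain ⟨V, ⟨-, U, hU, hVU⟩, hyV⟩ := (hφW 0 _).1 hpos
      exact ⟨U, hU, hVU x (hxy ▸ hyV), hVU y hyV⟩
    | succ n ih =>
      rcases lt_max_iff.1 hpos with h | h
      · rw [y.2 n] at h
        exact ih (by rw [← x.2 n, ← y.2 n, hxy]) h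
      · obtain ⟨V, ⟨-, U, hU, hVU⟩, hyV⟩ := (hφW (n + 1) _).1 h
        exact ⟨U, hU, hVU x (hxy ▸ hyV), hVU y hyV⟩

/-- Given a monotone sequence of control functions, soft bonding maps with sections admit a self-map
of the limit that keeps the `n`-th coordinate where the control is small and follows the
section where it is large. -/
theorem SeqLimit.exists_controlled_map {X : ℕ → Type u} [∀ n, TopologicalSpace (X n)]
    [∀ n, PolishSpace (X n)] {p : ∀ n, X (n + 1) → X n} (hp : ∀ n, SoftMap (p n))
    {s : ∀ n, X n → X (n + 1)} (hs : ∀ n, Continuous (s n)) (hsec : ∀ n x, p n (s n x) = x)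
    {ψ : ∀ n, X n → ℝ} (hψ : ∀ n, Continuous (ψ n))
    (hmono : ∀ n y, ψ n (p n y) ≤ ψ (n + 1) y) {ε : ℕ → ℝ} (hε : StrictAnti ε) :
    ∃ f : SeqLimit p → SeqLimit p, Continuous f ∧ (∀ x, (f x).1 0 = x.1 0) ∧
      (∀ n x, ψ n (x.1 n) ≤ ε (n + 1) → (f x).1 (n + 1) = x.1 (n + 1)) ∧
      ∀ n x, ε n ≤ ψ n (x.1 n) → (f x).1 (n + 1) = s n ((f x).1 n) := by
  have : PolishSpace (SeqLimit p) := polishSpace fun n => (hp n).1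
  let P : ∀ n, (SeqLimit p → X n) → Prop := fun n g =>
    Continuous g ∧ ∀ x, ψ n (x.1 n) ≤ ε (n + 1) → g x = x.1 n
  have step : ∀ n (g : {g // P n g}), ∃ k : {k // P (n + 1) k},
      (∀ x, p n (k.1 x) = g.1 x) ∧
      (∀ x, ψ n (x.1 n) ≤ ε (n + 1) → k.1 x = x.1 (n + 1)) ∧
      ∀ x, ε n ≤ ψ n (x.1 n) → k.1 x = s n (g.1 x) := by
    rintro n ⟨g, hg, hgA⟩
    have hψn : Continuous fun x : SeqLimit p => ψ n (x.1 n) := (hψ n).comp (continuous_proj n)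
    obtain ⟨k, hk, hpk, hkA, hkC⟩ := (hp n).exists_lift_of_disjoint
      (A := {x : SeqLimit p | ψ n (x.1 n) ≤ ε (n + 1)}) (C := {x | ε n ≤ ψ n (x.1 n)})
      (isClosed_le hψn continuous_const) (isClosed_le continuous_const hψn)
      (disjoint_left.2 fun x hx hx' => (hε n.lt_succ_self).not_ge (le_trans hx' hx))
      hg (continuous_proj (n + 1)) ((hs n).comp hg)
      (fun x hx => (x.2 n).trans (hgA x hx).symm) (fun x _ => hsec n _)
    refine ⟨⟨k, hk, fun x hx => hkA ?_⟩, hpk, fun x hx => hkA hx, fun x hx => hkC hx⟩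
    have := hmono n (x.1 (n + 1))
    rw [x.2 n] at this
    exact this.trans (hx.trans (hε (n + 1).lt_succ_self).le)
  choose next hnext_p hnext_A hnext_C using step
  let F : ∀ n, {g // P n g} := fun n =>
    Nat.rec ⟨fun x => x.1 0, continuous_proj 0, fun _ _ => rfl⟩ (fun n g => next n g) n
  refine ⟨fun x => ⟨fun n => (F n).1 x, fun n => hnext_p n (F n) x⟩, ?_, fun _ => rfl,
    fun n x hx => hnext_A n (F n) x hx, fun n x hx => hnext_C n (F n) x hx⟩
  exact Continuous.subtype_mk (continuous_pi fun n => (F n).2.1) _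

/-- If each bonding map of an inverse sequence of Polish spaces is soft and admits,
at each level, a section missing the projection of `Z`, then `Z` is a fibered `Z`-set
in the limit with respect to the limit projection `p₀`. -/
theorem fibered_Z_set_of_sections
    (X : ℕ → Type u) [∀ n, TopologicalSpace (X n)] [∀ n, PolishSpace (X n)]
    (p : ∀ n, X (n + 1) → X n) (hp : ∀ n, SoftMap (p n))
    (Z : Set {x : ∀ n, X n // ∀ n, p n (x (n + 1)) = x n}) (hZcl : IsClosed Z)
    (s : ∀ n, X n → X (n + 1)) (hscont : ∀ n, Continuous (s n))
    (hsec : ∀ n x, p n (s n x) = x)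
    (hdisj : ∀ n, Set.range (s n) ∩
      ((fun x : {x : ∀ n, X n // ∀ n, p n (x (n + 1)) = x n} => x.1 (n + 1)) '' Z) = ∅) :
    FiberedZSet (fun x : {x : ∀ n, X n // ∀ n, p n (x (n + 1)) = x n} => x.1 0) Z := by
  refine ⟨hZcl, fun 𝒰 h𝒰 => ?_⟩
  obtain ⟨ψ, hψ, hmono, hpos, hclose⟩ := SeqLimit.exists_control (fun n => (hp n).1)
    (fun U hU => (h𝒰.2.1 U hU).isOpen) h𝒰.2.2
  let ε : ℕ → ℝ := fun n => 1 / ((n : ℝ) + 1)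
  have hε : StrictAnti ε := fun m n hmn => Nat.one_div_lt_one_div hmn
  obtain ⟨f, hf, hf0, hfA, hfC⟩ :=
    SeqLimit.exists_controlled_map hp hscont hsec hψ hmono hε
  have hmono' : ∀ x : SeqLimit p, Monotone fun n => ψ n (x.1 n) := fun x =>
    monotone_nat_of_le_succ fun n => by simpa only [x.2 n] using hmono n (x.1 (n + 1))
  have hlarge : ∀ x : SeqLimit p, ∃ n, ε (n + 1) < ψ n (x.1 n) := by
    intro x
    obtain ⟨m, hm⟩ := hpos x
    obtain ⟨N, hN⟩ := exists_nat_one_div_lt hm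
    refine ⟨max m N, ?_⟩
    calc ε (max m N + 1) ≤ ε N := hε.antitone ((le_max_right m N).trans (Nat.le_succ _))
      _ < ψ m (x.1 m) := hN
      _ ≤ _ := hmono' x (le_max_left m N)
  have hfix : ∀ n x, (∀ m < n, ψ m (x.1 m) ≤ ε (m + 1)) → (f x).1 n = x.1 n := by
    rintro (_ | n) x h
    · exact hf0 x
    · exact hfA n x (h n n.lt_succ_self)
  refine ⟨f, hf, ?_, hf0, fun x => ?_⟩
  · refine eq_empty_of_forall_notMem fun z ⟨hz, hzZ⟩ => ?_
    obtain ⟨n, hn⟩ := hlarge z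
    let G : Set (SeqLimit p) := {y | ε (n + 1) < ψ n (y.1 n)}
    have hG : IsOpen G :=
      isOpen_lt continuous_const ((hψ n).comp (SeqLimit.continuous_proj n))
    have hsub : G ∩ range f ⊆ {y | s (n + 1) (y.1 (n + 1)) = y.1 (n + 2)} := by
      rintro _ ⟨hy, x, rfl⟩
      refine (hfC (n + 1) x ?_).symm
      by_contra! hlt
      have hle : ψ n (x.1 n) ≤ ε (n + 1) := (hmono' x n.le_succ).trans hlt.le
      have hxn : (f x).1 n = x.1 n := by
        rw [← (f x).2 n, hfA n x hle, x.2 n]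
      exact hle.not_gt (by simpa only [G, mem_ofPred_eq, hxn] using hy)
    have hclosed : IsClosed {y : SeqLimit p | s (n + 1) (y.1 (n + 1)) = y.1 (n + 2)} :=
      isClosed_eq ((hscont _).comp (SeqLimit.continuous_proj _)) (SeqLimit.continuous_proj _)
    have hzs := closure_minimal hsub hclosed (hG.inter_closure ⟨hn, hz⟩)
    exact (hdisj (n + 1)).subset ⟨⟨_, hzs⟩, z, hzZ, rfl⟩
  · classical
    have hx := Nat.find_spec (hlarge x)
    have hεpos : 0 < ε (Nat.find (hlarge x) + 1) := Nat.one_div_pos_of_nat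
    exact hclose _ (f x) x
      (hfix _ x fun m hm => not_lt.1 (Nat.find_min (hlarge x) hm)) (hεpos.trans hx)
end

section
/- Let τ > ω be a cardinal, Y a Tychonoff space, and X a z-embedded subspace of a product ∏{Xₜ : t ∈ T} of separable metrizable spaces with |T| = τ. Then for every continuous map f : Y → X, the family of sets B(f, S) = {g ∈ C_τ(Y, X) : π_S ∘ g = π_S ∘ f}, where S ranges over subsets of T with |S| < τ, forms a neighborhood base at f in the space C_τ(Y, X). -/
open Set Topology

universe u

/-- A zero set: the preimage of `0` under a continuous real-valued function. -/
def IsZeroSet {W : Type*} [TopologicalSpace W] (Z : Set W) : Prop :=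
  ∃ φ : W → ℝ, Continuous φ ∧ Z = φ ⁻¹' {(0 : ℝ)}

/-- A subspace `X` of `P` is z-embedded if every zero set of `X` is the trace on `X`
of a zero set of `P`. -/
def ZEmbedded {P : Type*} [TopologicalSpace P] (X : Set P) : Prop :=
  ∀ Z : Set ↥X, IsZeroSet Z → ∃ W : Set P, IsZeroSet W ∧ Z = Subtype.val ⁻¹' W

/-- Open sets of the `τ`-limitation topology `C_τ(Y, X)` on the set of continuous maps:
`G` is open if around each `h ∈ G` there is a family of fewer than `τ` countable
functionally open covers of `X` whose closeness-ball is contained in `G`. -/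
def TauOpen {Y X : Type u} [TopologicalSpace Y] [TopologicalSpace X] (τ : Cardinal.{u})
    (G : Set {g : Y → X // Continuous g}) : Prop :=
  ∀ h ∈ G, ∃ 𝒞 : Set (Set (Set X)), Cardinal.mk ↥𝒞 < τ ∧ (∀ 𝒰 ∈ 𝒞, IsCFOCover 𝒰) ∧
    {g : {g : Y → X // Continuous g} | ∀ 𝒰 ∈ 𝒞, UClose 𝒰 g.1 h.1} ⊆ G

open TopologicalSpace in
/-- The basic open box of a product determined by finitely many coordinate conditions. -/
def basicBox {T : Type*} {Xt : T → Type*} [∀ t, TopologicalSpace (Xt t)]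
    [∀ t, SecondCountableTopology (Xt t)] (c : Finset (Σ t, ↥(countableBasis (Xt t)))) :
    Set (∀ t, Xt t) :=
  {x | ∀ p ∈ c, x p.1 ∈ p.2.1}

open TopologicalSpace in
lemma exists_mem_basicBox_subset {T : Type*} {Xt : T → Type*} [∀ t, TopologicalSpace (Xt t)]
    [∀ t, SecondCountableTopology (Xt t)] {U : Set (∀ t, Xt t)} (hU : IsOpen U)
    {x : ∀ t, Xt t} (hx : x ∈ U) :
    ∃ c : Finset (Σ t, ↥(countableBasis (Xt t))), x ∈ basicBox c ∧ basicBox c ⊆ U := by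
  classical
  obtain ⟨I, u, hu, hIU⟩ := isOpen_pi_iff.1 hU x hx
  have key : ∀ t, ∃ v : ↥(countableBasis (Xt t)), x t ∈ v.1 ∧ (t ∈ I → v.1 ⊆ u t) := by
    intro t
    by_cases ht : t ∈ I
    · obtain ⟨v, hv, hxv, hvu⟩ := (isBasis_countableBasis (Xt t)).exists_subset_of_mem_open
        (hu t ht).2 (hu t ht).1
      exact ⟨⟨v, hv⟩, hxv, fun _ => hvu⟩
    · obtain ⟨v, hv, hxv, -⟩ := (isBasis_countableBasis (Xt t)).exists_subset_of_mem_open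
        (mem_univ (x t)) isOpen_univ
      exact ⟨⟨v, hv⟩, hxv, fun h => (ht h).elim⟩
  choose v hxv hvu using key
  refine ⟨I.image fun t => ⟨t, v t⟩, ?_, ?_⟩
  · intro p hp
    obtain ⟨t, -, rfl⟩ := Finset.mem_image.1 hp
    exact hxv t
  · intro z hz
    exact hIU fun t ht => hvu t ht (hz ⟨t, v t⟩ (Finset.mem_image_of_mem _ ht))

/-- Closing off under a finitary operation whose indices have countable fibres over `T`. -/
lemma exists_countable_closed_under {T K : Type*} (π : K → T)
    (hπ : ∀ t, (π ⁻¹' {t}).Countable) (step : Finset K → Finset K) :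
    ∃ A : Set T, A.Countable ∧ ∀ c : Finset K, (∀ p ∈ c, π p ∈ A) → ∀ p ∈ step c, π p ∈ A := by
  let Φ : Set T → Set T := fun A =>
    A ∪ ⋃ c ∈ {c : Finset K | (c : Set K) ⊆ π ⁻¹' A}, π '' (step c)
  let A : ℕ → Set T := fun n => Φ^[n] ∅
  have hsucc : ∀ n, A (n + 1) = Φ (A n) := fun n => Function.iterate_succ_apply' _ _ _
  have hmono : Monotone A := monotone_nat_of_le_succ fun n => by
    rw [hsucc]; exact subset_union_left
  have hcount : ∀ n, (A n).Countable := by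
    intro n
    induction n with
    | zero => exact countable_empty
    | succ n ih =>
      rw [hsucc]
      have hpre : (π ⁻¹' A n).Countable := by
        rw [← biUnion_preimage_singleton]
        exact ih.biUnion fun t _ => hπ t
      have hfin : {c : Finset K | (c : Set K) ⊆ π ⁻¹' A n}.Countable := by
        refine ((countable_ofPred_finite_subset hpre).preimage_of_injOn
          (f := fun c : Finset K => (c : Set K)) Finset.coe_injective.injOn).mono ?_
        exact fun c hc => ⟨c.finite_toSet, hc⟩
      exact ih.union (hfin.biUnion fun c _ => (step c).finite_toSet.countable.image π)
  refine ⟨⋃ n, A n, countable_iUnion hcount, fun c hc p hp => ?_⟩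
  have hbound : ∃ n, ∀ p ∈ c, π p ∈ A n := by
    have : ∀ p ∈ c, ∃ n, π p ∈ A n := fun p hp => mem_iUnion.1 (hc p hp)
    choose! k hk using this
    exact ⟨c.sup k, fun p hp => hmono (Finset.le_sup hp) (hk p hp)⟩
  obtain ⟨n, hn⟩ := hbound
  refine mem_iUnion.2 ⟨n + 1, ?_⟩
  rw [hsucc]
  exact Or.inr (mem_biUnion (show (c : Set K) ⊆ π ⁻¹' A n from hn) (mem_image_of_mem π hp))

/-- In a product of second countable spaces, the closure of an open set depends on countably
many coordinates. -/
lemma IsOpen.closure_dependsOn_countable {T : Type*} {Xt : T → Type*}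
    [∀ t, TopologicalSpace (Xt t)] [∀ t, SecondCountableTopology (Xt t)]
    {U : Set (∀ t, Xt t)} (hU : IsOpen U) :
    ∃ A : Set T, A.Countable ∧
      ∀ x z : ∀ t, Xt t, (∀ t ∈ A, x t = z t) → x ∈ closure U → z ∈ closure U := by
  classical
  have hbox : ∀ c : Finset (Σ t, ↥(TopologicalSpace.countableBasis (Xt t))),
      IsOpen (basicBox c) := by
    intro c
    have : basicBox c = ⋂ p ∈ c, (fun x : ∀ t, Xt t => x p.1) ⁻¹' p.2.1 := by
      ext x; simp [basicBox]
    rw [this]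
    exact isOpen_biInter_finset fun p _ =>
      ((TopologicalSpace.isBasis_countableBasis _).isOpen p.2.2).preimage (continuous_apply p.1)
  have hstep : ∀ c : Finset (Σ t, ↥(TopologicalSpace.countableBasis (Xt t))),
      ∃ d : Finset (Σ t, ↥(TopologicalSpace.countableBasis (Xt t))),
        (basicBox c ∩ U).Nonempty → (basicBox d).Nonempty ∧ basicBox d ⊆ basicBox c ∩ U := by
    intro c
    by_cases h : (basicBox c ∩ U).Nonempty
    · obtain ⟨x, hx⟩ := h
      obtain ⟨d, hxd, hd⟩ := exists_mem_basicBox_subset ((hbox c).inter hU) hx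
      exact ⟨d, fun _ => ⟨⟨x, hxd⟩, hd⟩⟩
    · exact ⟨∅, fun h' => (h h').elim⟩
  choose step hstep using hstep
  obtain ⟨A, hA, hclosed⟩ := exists_countable_closed_under
    (Sigma.fst : (Σ t, ↥(TopologicalSpace.countableBasis (Xt t))) → T)
    (fun t => by
      have := (TopologicalSpace.countable_countableBasis (Xt t)).to_subtype
      refine (countable_range (Sigma.mk (β := fun t => ↥(TopologicalSpace.countableBasis (Xt t)))
        t)).mono ?_
      rintro ⟨s, v⟩ rfl
      exact mem_range_self v) step
  refine ⟨A, hA, fun x z hxz hx => mem_closure_iff.2 fun O hO hzO => ?_⟩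
  obtain ⟨c, hzc, hcO⟩ := exists_mem_basicBox_subset hO hzO
  have hxc : x ∈ basicBox (c.filter fun p => p.1 ∈ A) := by
    intro p hp
    obtain ⟨hpc, hpA⟩ := Finset.mem_filter.1 hp
    rw [hxz p.1 hpA]
    exact hzc p hpc
  obtain ⟨⟨w, hw⟩, hsub⟩ := hstep _ (mem_closure_iff.1 hx _ (hbox _) hxc)
  have hsupp := hclosed (c.filter fun p => p.1 ∈ A) fun p hp => (Finset.mem_filter.1 hp).2
  let y : ∀ t, Xt t := fun t => if t ∈ A then w t else z t
  have hy : y ∈ basicBox (step (c.filter fun p => p.1 ∈ A)) := by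
    intro p hp
    simpa [y, hsupp p hp] using hw p hp
  refine ⟨y, hcO fun p hp => ?_, (hsub hy).2⟩
  by_cases hpA : p.1 ∈ A
  · exact (hsub hy).1 p (Finset.mem_filter.2 ⟨hp, hpA⟩)
  · simpa [y, hpA] using hzc p hp

/-- In a product of second countable spaces, a zero set depends on countably many coordinates. -/
lemma IsZeroSet.dependsOn_countable {T : Type*} {Xt : T → Type*}
    [∀ t, TopologicalSpace (Xt t)] [∀ t, SecondCountableTopology (Xt t)]
    {Z : Set (∀ t, Xt t)} (hZ : IsZeroSet Z) :
    ∃ A : Set T, A.Countable ∧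
      ∀ x z : ∀ t, Xt t, (∀ t ∈ A, x t = z t) → z ∈ Z → x ∈ Z := by
  obtain ⟨φ, hφ, rfl⟩ := hZ
  have hopen : ∀ n : ℕ, IsOpen {x | 1 / ((n : ℝ) + 1) < |φ x|} := fun n =>
    isOpen_lt continuous_const hφ.abs
  choose A hA hdep using fun n => (hopen n).closure_dependsOn_countable
  refine ⟨⋃ n, A n, countable_iUnion hA, fun x z hxz hz => ?_⟩
  by_contra hx
  obtain ⟨n, hn⟩ := exists_nat_one_div_lt (abs_pos.2 hx)
  have hzn := hdep n x z (fun t ht => hxz t (mem_iUnion.2 ⟨n, ht⟩)) (subset_closure hn)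
  have hle : 1 / ((n : ℝ) + 1) ≤ |φ z| :=
    closure_minimal (fun w hw => le_of_lt hw) (isClosed_le continuous_const hφ.abs) hzn
  have hφz : φ z = 0 := hz
  rw [hφz, abs_zero] at hle
  exact absurd hle (not_le.2 Nat.one_div_pos_of_nat)

/-- Functionally open subsets of a z-embedded subspace depend on countably many coordinates. -/
lemma FunctionallyOpen.dependsOn_countable {T : Type*} {Xt : T → Type*}
    [∀ t, TopologicalSpace (Xt t)] [∀ t, SecondCountableTopology (Xt t)]
    {X : Set (∀ t, Xt t)} (hX : ZEmbedded X) {U : Set ↥X} (hU : FunctionallyOpen U) :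
    ∃ A : Set T, A.Countable ∧
      ∀ x z : ↥X, (∀ t ∈ A, x.1 t = z.1 t) → x ∈ U → z ∈ U := by
  obtain ⟨φ, hφ, rfl⟩ := hU
  obtain ⟨W, hW, hWφ⟩ := hX (φ ⁻¹' {0}) ⟨φ, hφ, rfl⟩
  obtain ⟨A, hA, hdep⟩ := hW.dependsOn_countable
  refine ⟨A, hA, fun x z hxz hx hz => hx ?_⟩
  have hzW : z ∈ (Subtype.val ⁻¹' W : Set ↥X) := hWφ ▸ hz
  have hxW : x ∈ (Subtype.val ⁻¹' W : Set ↥X) := hdep _ _ hxz hzW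
  rwa [← hWφ] at hxW

lemma functionallyOpen_preimage_ball {X M : Type*} [TopologicalSpace X] [PseudoMetricSpace M]
    {u : X → M} (hu : Continuous u) (d : M) (ε : ℝ) :
    FunctionallyOpen (u ⁻¹' Metric.ball d ε) := by
  refine ⟨fun x => max 0 (ε - dist (u x) d), by fun_prop, ?_⟩
  ext x
  simp [Metric.mem_ball]

/-- A continuous map to a separable metrizable space yields a sequence of countable functionally
open covers such that points that are close for all of them have equal images. -/
lemma exists_seq_isCFOCover_separating {X M : Type*} [TopologicalSpace X] [TopologicalSpace M]
    [TopologicalSpace.MetrizableSpace M] [TopologicalSpace.SeparableSpace M]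
    {u : X → M} (hu : Continuous u) :
    ∃ 𝒰 : ℕ → Set (Set X), (∀ n, IsCFOCover (𝒰 n)) ∧
      ∀ x z : X, (∀ n, ∃ U ∈ 𝒰 n, x ∈ U ∧ z ∈ U) → u x = u z := by
  let := TopologicalSpace.metrizableSpaceMetric M
  obtain ⟨D, hD, hdense⟩ := TopologicalSpace.exists_countable_dense M
  refine ⟨fun n => (fun d => u ⁻¹' Metric.ball d (1 / ((n : ℝ) + 1))) '' D,
    fun n => ⟨hD.image _, ?_, ?_⟩, fun x z hxz => ?_⟩
  · rintro _ ⟨d, -, rfl⟩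
    exact functionallyOpen_preimage_ball hu d _
  · refine eq_univ_of_forall fun x => ?_
    obtain ⟨d, hd, hxd⟩ := hdense.exists_dist_lt (u x) (ε := 1 / ((n : ℝ) + 1))
      Nat.one_div_pos_of_nat
    exact ⟨_, mem_image_of_mem _ hd, hxd⟩
  · refine eq_of_forall_dist_le fun ε hε => ?_
    obtain ⟨n, hn⟩ := exists_nat_one_div_lt (half_pos hε)
    obtain ⟨_, ⟨d, -, rfl⟩, hx, hz⟩ := hxz n
    have hx' : dist (u x) d < 1 / ((n : ℝ) + 1) := hx
    have hz' : dist (u z) d < 1 / ((n : ℝ) + 1) := hz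
    linarith [dist_triangle_right (u x) (u z) d]

/-- For `τ > ω` and a z-embedded subspace `X` of a product of `τ` many separable
metrizable spaces, the sets `B(f, S) = {g : π_S ∘ g = π_S ∘ f}`, `|S| < τ`, form a
neighborhood base at `f` in `C_τ(Y, X)`. -/
theorem tau_topology_neighborhood_base
    (τ : Cardinal.{u}) (hτ : Cardinal.aleph0 < τ)
    (T : Type u) (hT : Cardinal.mk T = τ)
    (Xt : T → Type u) [∀ t, TopologicalSpace (Xt t)]
    [∀ t, TopologicalSpace.MetrizableSpace (Xt t)]
    [∀ t, TopologicalSpace.SeparableSpace (Xt t)]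
    (X : Set (∀ t, Xt t)) (hXz : ZEmbedded X)
    (Y : Type u) [TopologicalSpace Y] [T35Space Y]
    (f : Y → ↥X) (hf : Continuous f) :
    (∀ S : Set T, Cardinal.mk ↥S < τ →
      ∃ G : Set {g : Y → ↥X // Continuous g}, TauOpen τ G ∧ ⟨f, hf⟩ ∈ G ∧
        G ⊆ {g : {g : Y → ↥X // Continuous g} |
              ∀ y, ∀ t ∈ S, ((g.1 y : ∀ t, Xt t) t = (f y : ∀ t, Xt t) t)}) ∧
    (∀ N : Set {g : Y → ↥X // Continuous g},
      (∃ G, TauOpen τ G ∧ (⟨f, hf⟩ : {g : Y → ↥X // Continuous g}) ∈ G ∧ G ⊆ N) →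
      ∃ S : Set T, Cardinal.mk ↥S < τ ∧
        {g : {g : Y → ↥X // Continuous g} |
          ∀ y, ∀ t ∈ S, ((g.1 y : ∀ t, Xt t) t = (f y : ∀ t, Xt t) t)} ⊆ N) := by
  have : ∀ t, SecondCountableTopology (Xt t) := fun t =>
    let := TopologicalSpace.metrizableSpaceMetric (Xt t)
    UniformSpace.secondCountable_of_separable (Xt t)
  refine ⟨fun S hS => ⟨{g | ∀ y, ∀ t ∈ S, ((g.1 y : ∀ t, Xt t) t = (f y : ∀ t, Xt t) t)}, ?_,
    fun _ _ _ => rfl, subset_rfl⟩, ?_⟩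
  · intro h hh
    choose 𝒰 h𝒰 hsep using fun t => exists_seq_isCFOCover_separating
      (u := fun x : ↥X => (x : ∀ t, Xt t) t) ((continuous_apply t).comp continuous_subtype_val)
    refine ⟨range fun p : ↥S × ℕ => 𝒰 p.1 p.2, ?_, ?_, ?_⟩
    · refine Cardinal.mk_range_le.trans_lt ?_
      rw [Cardinal.mk_prod]
      simpa using Cardinal.mul_lt_of_lt hτ.le hS hτ
    · rintro _ ⟨p, rfl⟩
      exact h𝒰 _ _
    · intro g hg y t ht
      exact (hsep t _ _ fun n => hg _ ⟨(⟨t, ht⟩, n), rfl⟩ y).trans (hh y t ht)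
  · rintro N ⟨G, hG, hfG, hGN⟩
    obtain ⟨𝒞, h𝒞τ, h𝒞, hsub⟩ := hG _ hfG
    have hdep : ∀ 𝒰 : ↥𝒞, ∃ A : Set T, A.Countable ∧ ∀ U ∈ 𝒰.1,
        ∀ x z : ↥X, (∀ t ∈ A, x.1 t = z.1 t) → x ∈ U → z ∈ U := by
      intro 𝒰
      obtain ⟨hcount, hopen, -⟩ := h𝒞 _ 𝒰.2
      choose! A hA hAdep using fun U hU => (hopen U hU).dependsOn_countable hXz
      exact ⟨⋃ U ∈ 𝒰.1, A U, hcount.biUnion hA, fun U hU x z hxz =>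
        hAdep U hU x z fun t ht => hxz t (mem_biUnion hU ht)⟩
    choose A hA hAdep using hdep
    refine ⟨⋃ 𝒰, A 𝒰, ?_, fun g hg => hGN (hsub fun 𝒰 h𝒰 y => ?_)⟩
    · calc Cardinal.mk ↥(⋃ 𝒰, A 𝒰) ≤ Cardinal.sum fun 𝒰 => Cardinal.mk ↥(A 𝒰) :=
            Cardinal.mk_iUnion_le_sum_mk
        _ ≤ Cardinal.sum fun _ : ↥𝒞 => Cardinal.aleph0 :=
            Cardinal.sum_le_sum _ _ fun 𝒰 => (hA 𝒰).le_aleph0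
        _ = Cardinal.mk ↥𝒞 * Cardinal.aleph0 := Cardinal.sum_const' _ _
        _ < τ := Cardinal.mul_lt_of_lt hτ.le h𝒞τ hτ
    · obtain ⟨U, hU, hfU⟩ : f y ∈ ⋃₀ 𝒰 := by rw [(h𝒞 𝒰 h𝒰).2.2]; exact mem_univ _
      exact ⟨U, hU, hAdep ⟨𝒰, h𝒰⟩ U hU _ _
        (fun t ht => (hg y t (mem_iUnion.2 ⟨_, ht⟩)).symm) hfU, hfU⟩
end

section
/- Let A be a set with |A| > ω and let f : ℝ^A × ℝ^A → ℝ^A × ℝ^A be a continuous map. Then the set ℳ_f, consisting of those countable subsets C ⊆ A for which f factors through C, is cofinal and ω-closed in the partially ordered set exp_ω A of countable subsets of A. Moreover, if in addition f is B-invariant for some subset B ⊆ A, then f factors through B ∪ C for every C ∈ ℳ_f. -/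
open Set Topology

universe u

/-- Restriction of a pair of points of `ℝ^A` to the subproduct `ℝ^C × ℝ^C`. -/
def resP {A : Type u} (C : Set A) (x : (A → ℝ) × (A → ℝ)) : (↥C → ℝ) × (↥C → ℝ) :=
  (fun c => x.1 c, fun c => x.2 c)

/-- `f : ℝ^A × ℝ^A → ℝ^A × ℝ^A` factors through `C ⊆ A` if there is a continuous
`f_C : ℝ^C × ℝ^C → ℝ^C × ℝ^C` with `(π_C × π_C) ∘ f = f_C ∘ (π_C × π_C)`. -/
def FactorsThrough {A : Type u} (f : (A → ℝ) × (A → ℝ) → (A → ℝ) × (A → ℝ))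
    (C : Set A) : Prop :=
  ∃ fC : (↥C → ℝ) × (↥C → ℝ) → (↥C → ℝ) × (↥C → ℝ),
    Continuous fC ∧ ∀ x, resP C (f x) = fC (resP C x)

/-- `f` is `B`-invariant if `(π_B × π_B) ∘ f = π_B × π_B`. -/
def BInvariant {A : Type u} (f : (A → ℝ) × (A → ℝ) → (A → ℝ) × (A → ℝ))
    (B : Set A) : Prop :=
  ∀ x, resP B (f x) = resP B x

/-- `ℳ` is cofinal in `exp_ω A`: every countable subset of `A` is contained in a member. -/
def CofinalInExpOmega {A : Type u} (ℳ : Set (Set A)) : Prop :=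
  ∀ D : Set A, D.Countable → ∃ C ∈ ℳ, D ⊆ C

/-- `ℳ` is ω-closed: the union of any countable increasing chain of members is a member. -/
def OmegaClosed {A : Type u} (ℳ : Set (Set A)) : Prop :=
  ∀ c : ℕ → Set A, (∀ n, c n ∈ ℳ) → (∀ n, c n ⊆ c (n + 1)) → (⋃ n, c n) ∈ ℳ

open MeasureTheory ProbabilityTheory in
/-- The space `ℝ^ι` satisfies the countable chain condition, tested on open boxes. -/
theorem countable_of_pairwiseDisjoint_openBox {ι : Type*} {t : Set (Finset ι × (ι → Set ℝ))}
    (hopen : ∀ b ∈ t, ∀ i ∈ b.1, IsOpen (b.2 i))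
    (hne : ∀ b ∈ t, (Set.pi (b.1 : Set ι) b.2).Nonempty)
    (hdisj : t.PairwiseDisjoint fun b => Set.pi (b.1 : Set ι) b.2) : t.Countable := by
  let μ : Measure (ι → ℝ) := Measure.infinitePi fun _ => gaussianReal 0 1
  have hmeas : ∀ b : t, MeasurableSet (Set.pi (b.1.1 : Set ι) b.1.2) := fun b =>
    MeasurableSet.pi b.1.1.countable_toSet fun i hi => (hopen b b.2 i hi).measurableSet
  have hpos : ∀ b : t, 0 < μ (Set.pi (b.1.1 : Set ι) b.1.2) := by
    intro b
    rw [Measure.infinitePi_pi _ fun i hi => (hopen b b.2 i hi).measurableSet,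
      pos_iff_ne_zero, Finset.prod_ne_zero_iff]
    intro i hi h
    obtain ⟨x, hx⟩ := hne b b.2
    exact ((hopen b b.2 i hi).measure_pos volume ⟨x i, hx i hi⟩).ne'
      (gaussianReal_absolutelyContinuous' 0 one_ne_zero h)
  have hcount := Measure.countable_meas_pos_of_disjoint_iUnion (μ := μ) hmeas
    fun b c hbc => hdisj b.2 c.2 (Subtype.coe_injective.ne hbc)
  rw [← countable_coe_iff, ← countable_univ_iff]
  exact hcount.mono fun b _ => hpos b

/-- Every open subset of `ℝ^ι` has a dense subset determined by countably many coordinates. -/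
theorem IsOpen.exists_dense_subset_dependsOn {ι : Type*} {U : Set (ι → ℝ)} (hU : IsOpen U) :
    ∃ C : Set ι, C.Countable ∧ ∃ V ⊆ U, U ⊆ closure V ∧ DependsOn (· ∈ V) C := by
  let box : Finset ι × (ι → Set ℝ) → Set (ι → ℝ) := fun b => Set.pi (b.1 : Set ι) b.2
  let t : Set (Finset ι × (ι → Set ℝ)) :=
    {b | (∀ i ∈ b.1, IsOpen (b.2 i)) ∧ (box b).Nonempty ∧ box b ⊆ U}
  obtain ⟨u, hut, hdisj, hmeet⟩ := Vitali.exists_disjoint_subfamily_covering_enlargement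
    box t (fun _ => 1) 2 one_lt_two (fun _ _ => zero_le_one) 1 (fun _ _ => le_rfl)
    fun b hb => hb.2.1
  have hu : u.Countable := countable_of_pairwiseDisjoint_openBox
    (fun b hb => (hut hb).1) (fun b hb => (hut hb).2.1) hdisj
  refine ⟨⋃ b ∈ u, (b.1 : Set ι), hu.biUnion fun b _ => b.1.countable_toSet,
    ⋃ b ∈ u, box b, iUnion₂_subset fun b hb => (hut hb).2.2, ?_, ?_⟩
  · intro x hx
    rw [mem_closure_iff]
    intro W hW hxW
    obtain ⟨F, v, hv, hsub⟩ := isOpen_pi_iff.1 (hU.inter hW) x ⟨hx, hxW⟩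
    have hsub' : box (F, v) ⊆ U ∩ W := hsub
    obtain ⟨b, hb, ⟨y, hy, hyb⟩, -⟩ := hmeet (F, v) ⟨fun i hi => (hv i hi).1,
      ⟨x, fun i hi => (hv i hi).2⟩, hsub'.trans inter_subset_left⟩
    exact ⟨y, (hsub' hy).2, mem_iUnion₂.2 ⟨b, hb, hyb⟩⟩
  · intro x y hxy
    simp only [mem_iUnion, eq_iff_iff]
    refine exists_congr fun b => exists_congr fun hb => forall₂_congr fun i hi => ?_
    rw [hxy i (mem_iUnion₂.2 ⟨b, hb, hi⟩)]

/-- The closure of a set determined by the coordinates in `C` is determined by them as well. -/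
theorem DependsOn.mem_closure {ι : Type*} {V : Set (ι → ℝ)} {C : Set ι}
    (hV : DependsOn (· ∈ V) C) {x y : ι → ℝ} (hxy : ∀ i ∈ C, x i = y i) (hx : x ∈ closure V) :
    y ∈ closure V := by
  classical
  have hcont : Continuous fun z : ι → ℝ => C.piecewise z y := by
    refine continuous_pi fun i => ?_
    by_cases hi : i ∈ C
    · simpa [hi] using continuous_apply i
    · simpa [hi] using continuous_const
  have hmaps : MapsTo (fun z : ι → ℝ => C.piecewise z y) V V := fun z hz =>
    (hV fun i hi => (C.piecewise_eq_of_mem z y hi).symm).mp hz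
  convert map_mem_closure hcont hx hmaps using 1
  ext i
  by_cases hi : i ∈ C <;> simp [hi, hxy]

/-- A continuous real function on `ℝ^ι` depends on countably many coordinates. -/
theorem Continuous.exists_countable_dependsOn {ι : Type*} {g : (ι → ℝ) → ℝ}
    (hg : Continuous g) : ∃ C : Set ι, C.Countable ∧ DependsOn g C := by
  choose C hC V hVU hUV hV using fun q : ℚ =>
    (isOpen_lt hg (continuous_const (y := (q : ℝ)))).exists_dense_subset_dependsOn
  have hle : ∀ x y : ι → ℝ, (∀ i ∈ ⋃ q, C q, x i = y i) → g y ≤ g x := by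
    intro x y hxy
    by_contra! h
    obtain ⟨q, hxq, hqy⟩ := exists_rat_btwn h
    have hy : y ∈ closure (V q) :=
      (hV q).mem_closure (fun i hi => hxy i (mem_iUnion.2 ⟨q, hi⟩)) (hUV q hxq)
    have : g y ≤ q := closure_minimal ((hVU q).trans fun z hz => le_of_lt hz)
      (isClosed_le hg continuous_const) hy
    exact this.not_gt hqy
  exact ⟨⋃ q, C q, countable_iUnion hC, fun x y hxy =>
    le_antisymm (hle y x fun i hi => (hxy i hi).symm) (hle x y hxy)⟩

/-- A continuous real function on `ℝ^A × ℝ^A` factors set-theoretically through `ℝ^C × ℝ^C` for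
some countable `C`. -/
theorem Continuous.exists_countable_resP {A : Type u} {g : (A → ℝ) × (A → ℝ) → ℝ}
    (hg : Continuous g) :
    ∃ C : Set A, C.Countable ∧ ∀ x y, resP C x = resP C y → g x = g y := by
  let e := Homeomorph.sumArrowHomeomorphProdArrow (ι := A) (ι' := A) (X := ℝ)
  obtain ⟨S, hS, hgS⟩ := (hg.comp e.continuous).exists_countable_dependsOn
  refine ⟨Sum.inl ⁻¹' S ∪ Sum.inr ⁻¹' S, (hS.preimage Sum.inl_injective).union
    (hS.preimage Sum.inr_injective), fun x y hxy => ?_⟩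
  have key : (g ∘ e) (e.symm x) = (g ∘ e) (e.symm y) := by
    refine hgS fun i hi => ?_
    rcases i with a | a
    · exact congrFun (congrArg Prod.fst hxy) ⟨a, Or.inl hi⟩
    · exact congrFun (congrArg Prod.snd hxy) ⟨a, Or.inr hi⟩
  simpa using key

theorem resP_eq_iff {A : Type u} {C : Set A} {x y : (A → ℝ) × (A → ℝ)} :
    resP C x = resP C y ↔ ∀ a ∈ C, x.1 a = y.1 a ∧ x.2 a = y.2 a := by
  simp [resP, Prod.ext_iff, funext_iff, forall_and]

theorem resP_eq_of_subset {A : Type u} {C D : Set A} (h : C ⊆ D) {x y : (A → ℝ) × (A → ℝ)}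
    (hxy : resP D x = resP D y) : resP C x = resP C y :=
  resP_eq_iff.2 fun a ha => resP_eq_iff.1 hxy a (h ha)

theorem continuous_resP {A : Type u} (C : Set A) : Continuous (resP C) := by
  unfold resP
  fun_prop

/-- For a continuous map, a set-theoretic factorization is automatically continuous. -/
theorem factorsThrough_iff_resP {A : Type u} {f : (A → ℝ) × (A → ℝ) → (A → ℝ) × (A → ℝ)}
    (hf : Continuous f) {C : Set A} :
    FactorsThrough f C ↔ ∀ x y, resP C x = resP C y → resP C (f x) = resP C (f y) := by
  classical
  constructor
  · rintro ⟨fC, -, h⟩ x y hxy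
    rw [h, h, hxy]
  · intro h
    let extend : (C → ℝ) → A → ℝ := fun z a => if ha : a ∈ C then z ⟨a, ha⟩ else 0
    have hextend : Continuous extend := by
      refine continuous_pi fun a => ?_
      by_cases ha : a ∈ C
      · simpa [extend, ha] using continuous_apply _
      · simpa [extend, ha] using continuous_const
    refine ⟨fun z => resP C (f (Prod.map extend extend z)),
      (continuous_resP C).comp (hf.comp (hextend.prodMap hextend)), fun x => h _ _ ?_⟩
    exact resP_eq_iff.2 fun a ha => by simp [extend, resP, ha]

theorem cofinalInExpOmega_factorsThrough {A : Type u}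
    {f : (A → ℝ) × (A → ℝ) → (A → ℝ) × (A → ℝ)} (hf : Continuous f) :
    CofinalInExpOmega {C : Set A | C.Countable ∧ FactorsThrough f C} := by
  intro D hD
  choose S hS hfS using fun a : A =>
    ((continuous_apply a).comp (continuous_fst.comp hf)).exists_countable_resP
  choose T hT hfT using fun a : A =>
    ((continuous_apply a).comp (continuous_snd.comp hf)).exists_countable_resP
  let E : ℕ → Set A := fun n => Nat.rec D (fun _ C => ⋃ a ∈ C, (S a ∪ T a)) n
  have hE : ∀ n, (E n).Countable := by
    intro n
    induction n with
    | zero => exact hD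
    | succ n ih => exact ih.biUnion fun a _ => (hS a).union (hT a)
  refine ⟨⋃ n, E n, ⟨countable_iUnion hE, (factorsThrough_iff_resP hf).2 fun x y hxy => ?_⟩,
    subset_iUnion E 0⟩
  refine resP_eq_iff.2 fun a ha => ?_
  obtain ⟨n, hn⟩ := mem_iUnion.1 ha
  have hsub : S a ∪ T a ⊆ ⋃ n, E n :=
    (subset_biUnion_of_mem (u := fun a => S a ∪ T a) hn).trans (subset_iUnion E (n + 1))
  exact ⟨hfS a x y (resP_eq_of_subset (subset_union_left.trans hsub) hxy),
    hfT a x y (resP_eq_of_subset (subset_union_right.trans hsub) hxy)⟩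

theorem FactorsThrough.iUnion {A : Type u} {ι : Sort*}
    {f : (A → ℝ) × (A → ℝ) → (A → ℝ) × (A → ℝ)} (hf : Continuous f) {c : ι → Set A}
    (hc : ∀ n, FactorsThrough f (c n)) : FactorsThrough f (⋃ n, c n) := by
  refine (factorsThrough_iff_resP hf).2 fun x y hxy => resP_eq_iff.2 fun a ha => ?_
  obtain ⟨n, hn⟩ := mem_iUnion.1 ha
  exact resP_eq_iff.1 ((factorsThrough_iff_resP hf).1 (hc n) x y
    (resP_eq_of_subset (subset_iUnion c n) hxy)) a hn

theorem BInvariant.factorsThrough {A : Type u} {f : (A → ℝ) × (A → ℝ) → (A → ℝ) × (A → ℝ)}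
    {B : Set A} (hB : BInvariant f B) : FactorsThrough f B :=
  ⟨id, continuous_id, hB⟩

/-- For `|A| > ω` and continuous `f : ℝ^A × ℝ^A → ℝ^A × ℝ^A`, the set `ℳ_f` of
countable `C ⊆ A` through which `f` factors is cofinal and ω-closed in `exp_ω A`;
moreover if `f` is `B`-invariant then `f` factors through `B ∪ C` for all `C ∈ ℳ_f`. -/
theorem factorization_set_cofinal_omega_closed
    (A : Type u) (hA : Cardinal.aleph0 < Cardinal.mk A)
    (f : (A → ℝ) × (A → ℝ) → (A → ℝ) × (A → ℝ)) (hf : Continuous f) :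
    CofinalInExpOmega {C : Set A | C.Countable ∧ FactorsThrough f C} ∧
    OmegaClosed {C : Set A | C.Countable ∧ FactorsThrough f C} ∧
    ∀ B : Set A, BInvariant f B →
      ∀ C : Set A, C ∈ {C : Set A | C.Countable ∧ FactorsThrough f C} →
        FactorsThrough f (B ∪ C) := by
  refine ⟨cofinalInExpOmega_factorsThrough hf, fun c hc _ => ⟨countable_iUnion fun n => (hc n).1,
    FactorsThrough.iUnion hf fun n => (hc n).2⟩, fun B hB C hC => ?_⟩
  rw [union_eq_iUnion]
  exact FactorsThrough.iUnion hf (Bool.forall_bool.2 ⟨hC.2, hB.factorsThrough⟩)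
end
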